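/- Let p < 1/2 and r ∈ [0,1], and let R_1 and R_2 be disjoint rectangles in the plane. Then for every ε > 0 there exists λ_0 > 0 such that for all λ > λ_0 and for any events A_1, A_2 that are defined in terms of the colours of the vertices in λR_1 ∩ ℤ² and λR_2 ∩ ℤ² respectively, one has |ℙ_{p,r}(A_1 ∩ A_2) − ℙ_{p,r}(A_1)·ℙ_{p,r}(A_2)| ≤ ε. -/

import Mathlib

/-!
Common definitions for the Divide-and-Colour (DaC) model of
Bálint, Camia and Meester, "Sharp phase transition and critical
behaviour in 2D divide and colour models".

The model is built concretely: a single uniform random variable on `(0,1]`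
is decomposed into countably many i.i.d. uniform random variables (via its
binary digits); one family of uniforms drives the Bernoulli(p) bond
percolation (the edge configuration), and an independent family of uniforms
attaches an independent Bernoulli(r) colour to each bond cluster (the colour
of a cluster is determined by the uniform label of its canonical
representative, the vertex of minimal encoding).  The DaC measure
`ℙ_{p,r}` is the pushforward of Lebesgue measure on `(0,1]` under the map
producing the pair (edge configuration, colour configuration).
-/

open MeasureTheory ENNReal

namespace DaC

/-- Vertices of the lattice. -/
abbrev V : Type := ℤ × ℤ

/-- Square lattice adjacency: Euclidean distance `1`. -/
def SqAdj (u v : V) : Prop := (u.1 - v.1) ^ 2 + (u.2 - v.2) ^ 2 = 1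

/-- `*`-adjacency (matching graph of the square lattice):
Euclidean distance `1` or `√2`. -/
def StarAdj (u v : V) : Prop :=
  (u.1 - v.1) ^ 2 + (u.2 - v.2) ^ 2 = 1 ∨ (u.1 - v.1) ^ 2 + (u.2 - v.2) ^ 2 = 2

/-- Triangular lattice adjacency. -/
def TriAdj (u v : V) : Prop :=
  (u.1 - v.1, u.2 - v.2) ∈
    ({(1, 0), (-1, 0), (0, 1), (0, -1), (1, 1), (-1, -1)} : Set (ℤ × ℤ))

/-- Classical indicator of a proposition, as a boolean. -/
noncomputable def boolOf (P : Prop) : Bool := @decide P (Classical.propDecidable P)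

/-- The `n`-th binary digit of a real number `x ∈ (0,1]`. -/
noncomputable def bit (n : ℕ) (x : ℝ) : Bool := boolOf (⌊x * 2 ^ (n + 1)⌋ % 2 = 1)

/-- A countable family of i.i.d. uniform random variables on `[0,1]`, extracted
from a single uniform sample `x` by splitting its binary digits. -/
noncomputable def unif (i : ℕ) (x : ℝ) : ℝ :=
  ∑' k : ℕ, if bit (Nat.pair i k) x then ((2 : ℝ)⁻¹) ^ (k + 1) else 0

/-- A symmetric encoding of (unordered) pairs of vertices. -/
noncomputable def eIdx (u v : V) : ℕ :=
  min (Encodable.encode (u, v)) (Encodable.encode (v, u))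

/-- The uniform label attached to the edge `{u,v}`. -/
noncomputable def edgeU (u v : V) (x : ℝ) : ℝ := unif (2 * eIdx u v) x

/-- The uniform label attached to the vertex `v` (independent of the edge labels). -/
noncomputable def vtxU (v : V) (x : ℝ) : ℝ := unif (2 * Encodable.encode v + 1) x

/-- Edge configurations: a boolean (open/closed) for each (ordered) pair of
vertices; configurations arising from the model are symmetric and are
supported on pairs of adjacent vertices. -/
abbrev EdgeCfg : Type := V → V → Bool

/-- Colour configurations: a colour (black = `true`, white = `false`) for each vertex. -/
abbrev ColourCfg : Type := V → Bool

/-- Full configurations of the DaC model: an edge configuration together with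
a colour configuration. -/
abbrev Config : Type := EdgeCfg × ColourCfg

/-- The Bernoulli(p) edge configuration determined by the uniform sample `x`,
on the lattice with adjacency `adj`: an edge `{u,v}` of the lattice is open
iff its uniform label is `< p`. -/
noncomputable def edgeCfg (adj : V → V → Prop) (p : ℝ) (x : ℝ) : EdgeCfg :=
  fun u v => boolOf (adj u v) && boolOf (edgeU u v x < p)

/-- Connectivity through open edges of the edge configuration `η`. -/
def Conn (η : EdgeCfg) (u v : V) : Prop :=
  Relation.ReflTransGen (fun a b => η a b = true) u v

/-- The `p`-cluster of the vertex `v`: its connected component in the graph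
retaining only open edges. -/
def pCluster (η : EdgeCfg) (v : V) : Set V := {w | Conn η v w}

/-- Canonical representative of the `p`-cluster of `v`: the vertex of the
cluster with minimal encoding. -/
noncomputable def clusterRep (η : EdgeCfg) (v : V) : V :=
  (Encodable.decode (α := V) (sInf (Encodable.encode '' pCluster η v))).getD v

/-- The colour configuration with parameters `p, r` determined by the uniform
sample `x`: every `p`-cluster is coloured black (with probability `r`)
or white, independently of all other `p`-clusters, according to the uniform
label of its canonical representative. -/
noncomputable def colourCfg (adj : V → V → Prop) (p r : ℝ) (x : ℝ) : ColourCfg :=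
  fun v => boolOf (vtxU (clusterRep (edgeCfg adj p x) v) x < r)

/-- The uniform sample: Lebesgue measure on `(0,1]`. -/
noncomputable def base : Measure ℝ := volume.restrict (Set.Ioc 0 1)

/-- `ν_p`: the product Bernoulli(p) measure on edge configurations of the
lattice with adjacency `adj`. -/
noncomputable def edgeMeasure (adj : V → V → Prop) (p : ℝ) : Measure EdgeCfg :=
  base.map (edgeCfg adj p)

/-- `ℙ_{p,r}`: the DaC measure on pairs (edge configuration, colour
configuration) for the lattice with adjacency `adj`. -/
noncomputable def DaCMeasure (adj : V → V → Prop) (p r : ℝ) : Measure Config :=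
  base.map (fun x => (edgeCfg adj p x, colourCfg adj p r x))

/-- Monochromatic connectivity: `u` and `v` are joined by a path (for the
adjacency `adj`) all of whose vertices have colour `c`. -/
def MonoConn (adj : V → V → Prop) (ξ : ColourCfg) (c : Bool) (u v : V) : Prop :=
  Relation.ReflTransGen (fun a b => adj a b ∧ ξ a = c ∧ ξ b = c) u v

/-- The colour-`c` cluster of `v` (for the adjacency `adj`): empty if `v` does
not have colour `c`, and otherwise the maximal `adj`-connected set of
`c`-coloured vertices containing `v`. -/
def monoCluster (adj : V → V → Prop) (ξ : ColourCfg) (c : Bool) (v : V) : Set V :=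
  {w | ξ v = c ∧ MonoConn adj ξ c v w}

/-- The origin. -/
def origin : V := (0, 0)

/-- The size (cardinality) of a set of vertices, with values in `ℝ≥0∞`. -/
noncomputable def sizeE (S : Set V) : ℝ≥0∞ := S.encard

/-- The probability, under the DaC measure with edge adjacency `eadj` and
parameters `p, r`, that the origin lies in an infinite colour-`c` cluster for
the adjacency `cadj`. -/
noncomputable def percProb (eadj cadj : V → V → Prop) (c : Bool) (p r : ℝ) : ℝ≥0∞ :=
  DaCMeasure eadj p r {ω | (monoCluster cadj ω.2 c origin).Infinite}

/-- `Θ(p,r)` for the square lattice: probability that the origin lies in an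
infinite black `r`-cluster. -/
noncomputable def thetaSq (p r : ℝ) : ℝ≥0∞ := percProb SqAdj SqAdj true p r

/-- `Θ*(p,s)` for the square lattice: the `ℙ_{p,1-s}`-probability that the
origin lies in an infinite white `*`-cluster. -/
noncomputable def thetaStarSq (p s : ℝ) : ℝ≥0∞ := percProb SqAdj StarAdj false p (1 - s)

/-- `Θ(p,r)` for the triangular lattice. -/
noncomputable def thetaTri (p r : ℝ) : ℝ≥0∞ := percProb TriAdj TriAdj true p r

/-- The critical colouring density `r_c(p)` of the square lattice DaC model. -/
noncomputable def rcSq (p : ℝ) : ℝ :=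
  sSup {r : ℝ | r ∈ Set.Icc (0 : ℝ) 1 ∧ thetaSq p r = 0}

/-- The critical colouring density `r_c*(p)` for white `*`-percolation. -/
noncomputable def rcStarSq (p : ℝ) : ℝ :=
  sSup {s : ℝ | s ∈ Set.Icc (0 : ℝ) 1 ∧ thetaStarSq p s = 0}

/-- The critical colouring density `r_c(p)` of the triangular lattice DaC model. -/
noncomputable def rcTri (p : ℝ) : ℝ :=
  sSup {r : ℝ | r ∈ Set.Icc (0 : ℝ) 1 ∧ thetaTri p r = 0}

/-! ### Rectangles and crossings -/

/-- The rectangle `S_{n,m} = ([0,n] × [0,m]) ∩ ℤ²`. -/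
def Rect (n m : ℕ) : Set V :=
  {v | 0 ≤ v.1 ∧ v.1 ≤ (n : ℤ) ∧ 0 ≤ v.2 ∧ v.2 ≤ (m : ℤ)}

/-- The top side of `S_{n,m}`. -/
def TopSide (n m : ℕ) : Set V := {v | v ∈ Rect n m ∧ v.2 = (m : ℤ)}

/-- The bottom side of `S_{n,m}`. -/
def BotSide (n m : ℕ) : Set V := {v | v ∈ Rect n m ∧ v.2 = 0}

/-- The left side of `S_{n,m}`. -/
def LeftSide (n m : ℕ) : Set V := {v | v ∈ Rect n m ∧ v.1 = 0}

/-- The right side of `S_{n,m}`. -/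
def RightSide (n m : ℕ) : Set V := {v | v ∈ Rect n m ∧ v.1 = (n : ℤ)}

/-- There is a path (for the adjacency `adj`), all of whose vertices lie in the
region `R` and satisfy the predicate `good`, from the set `A` to the set `B`. -/
def HasCrossing (adj : V → V → Prop) (good : V → Prop) (R A B : Set V) : Prop :=
  ∃ (k : ℕ) (f : Fin (k + 1) → V),
    (∀ i, f i ∈ R ∧ good (f i)) ∧
    (∀ i : Fin k, adj (f i.castSucc) (f i.succ)) ∧
    f 0 ∈ A ∧ f (Fin.last k) ∈ B

/-- `V^b_{n,m}` as a set of colour configurations: there is a black vertical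
crossing of `S_{n,m}` (for the adjacency `adj`). -/
def VertBC (adj : V → V → Prop) (n m : ℕ) : Set ColourCfg :=
  {ξ | HasCrossing adj (fun v => ξ v = true) (Rect n m) (TopSide n m) (BotSide n m)}

/-- `V^{w*}_{n,m}` as a set of colour configurations: there is a white vertical
`*`-crossing of `S_{n,m}`. -/
def VertWStarC (n m : ℕ) : Set ColourCfg :=
  {ξ | HasCrossing StarAdj (fun v => ξ v = false) (Rect n m) (TopSide n m) (BotSide n m)}

/-- `H^{w*}_{n,m}` as a set of colour configurations: there is a white
horizontal `*`-crossing of `S_{n,m}`. -/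
def HorizWStarC (n m : ℕ) : Set ColourCfg :=
  {ξ | HasCrossing StarAdj (fun v => ξ v = false) (Rect n m) (LeftSide n m) (RightSide n m)}

/-- The event (set of full configurations) determined by a set of colour
configurations. -/
def colourEvent (C : Set ColourCfg) : Set Config := {ω | ω.2 ∈ C}

/-! ### Events depending on colours, increasing events, pivotal clusters -/

/-- The event `A` is defined in terms of the colours of the vertices in `W`. -/
def DependsOnColoursIn (A : Set Config) (W : Set V) : Prop :=
  ∀ ω ω' : Config, (∀ v ∈ W, ω.2 v = ω'.2 v) → (ω ∈ A ↔ ω' ∈ A)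

/-- The event `A` is increasing (for the partial order comparing colour
configurations pointwise, black = `true` above white = `false`). -/
def IncreasingColourEvent (A : Set Config) : Prop :=
  ∀ ω ω' : Config, (∀ v : V, ω.2 v = true → ω'.2 v = true) → ω ∈ A → ω' ∈ A

/-- Flip the colours of the vertices of `C`. -/
noncomputable def flipOn (C : Set V) (ξ : ColourCfg) : ColourCfg :=
  fun v => @ite _ (v ∈ C) (Classical.propDecidable _) (!ξ v) (ξ v)

/-- The set `C` is a pivotal `p`-cluster for the event `A` in the
configuration `ω`: `C` is a `p`-cluster of the edge configuration of `ω`, and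
flipping the colour of (all the vertices of) `C` changes whether the
configuration belongs to `A`. -/
def IsPivotal (A : Set Config) (ω : Config) (C : Set V) : Prop :=
  (∃ v : V, C = pCluster ω.1 v) ∧ ¬ (ω ∈ A ↔ (ω.1, flipOn C ω.2) ∈ A)

/-- `n(A)`: the number of pivotal `p`-clusters for the event `A`, with values
in `ℝ≥0∞`. -/
noncomputable def numPivotal (A : Set Config) (ω : Config) : ℝ≥0∞ :=
  {C : Set V | IsPivotal A ω C}.encard

/-! ### Barriers -/

/-- Connectivity in the square lattice avoiding the edges of `E`. -/
def AvoidConn (E : Set (V × V)) (u v : V) : Prop :=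
  Relation.ReflTransGen (fun a b => SqAdj a b ∧ (a, b) ∉ E ∧ (b, a) ∉ E) u v

/-- `E` is a barrier: a set of edges of the square lattice whose removal
(keeping the end-vertices) separates `ℤ²` into two or more connected
components, exactly one of which is infinite. -/
def IsBarrier (E : Set (V × V)) : Prop :=
  (∀ e ∈ E, SqAdj e.1 e.2) ∧
  (∃ v, {w | AvoidConn E v w}.Infinite) ∧
  (∀ v w, {x | AvoidConn E v x}.Infinite → {x | AvoidConn E w x}.Infinite → AvoidConn E v w) ∧
  (∃ v, {w | AvoidConn E v w}.Finite)

/-- The exterior of a barrier: its unique infinite complementary component. -/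
def barrierExt (E : Set (V × V)) : Set V := {v | {w | AvoidConn E v w}.Infinite}

/-- The interior of a barrier: the union of the finite complementary components. -/
def barrierInt (E : Set (V × V)) : Set V := {v | {w | AvoidConn E v w}.Finite}

/-- The event `A ⊆ EdgeCfg` is increasing (opening edges preserves it). -/
def IncreasingEdgeEvent (A : Set EdgeCfg) : Prop :=
  ∀ η η' : EdgeCfg, (∀ a b : V, η a b = true → η' a b = true) → η ∈ A → η' ∈ A

/-- The event `A ⊆ EdgeCfg` depends only on the states of the edges both of
whose endpoints lie in `W`. -/
def DependsOnEdgesIn (A : Set EdgeCfg) (W : Set V) : Prop :=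
  ∀ η η' : EdgeCfg, (∀ a b : V, a ∈ W → b ∈ W → η a b = η' a b) → (η ∈ A ↔ η' ∈ A)

/-! ### Translations -/

/-- Translation of configurations by the vector `u`. -/
def shift (u : V) (ω : Config) : Config :=
  (fun a b => ω.1 (a + u) (b + u), fun a => ω.2 (a + u))

end DaC

namespace Perc
open Finset Classical

section fincalc
variable {α : Type*} [DecidableEq α]

noncomputable def Ex (p : ℝ) (F : Finset α) (f : Finset α → ℝ) : ℝ :=
  ∑ T ∈ F.powerset, p ^ T.card * (1 - p) ^ (F \ T).card * f T

theorem Ex_empty (p : ℝ) (f : Finset α → ℝ) : Ex p ∅ f = f ∅ := by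
  simp [Ex]

theorem Ex_insert (p : ℝ) {F : Finset α} {a : α} (ha : a ∉ F) (f : Finset α → ℝ) :
    Ex p (insert a F) f = p * Ex p F (fun T => f (insert a T)) + (1 - p) * Ex p F f := by
  unfold Ex
  rw [Finset.sum_powerset_insert ha, add_comm, Finset.mul_sum, Finset.mul_sum]
  congr 1
  · refine Finset.sum_congr rfl fun T hT => ?_
    have hT' := Finset.mem_powerset.1 hT
    have haT : a ∉ T := fun h => ha (hT' h)
    rw [Finset.card_insert_of_notMem haT]
    have : insert a F \ insert a T = F \ T := by
      ext x; simp only [mem_sdiff, mem_insert]; constructor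
      · rintro ⟨h1 | h1, h2⟩
        · exact absurd (Or.inl h1) h2
        · exact ⟨h1, fun h => h2 (Or.inr h)⟩
      · rintro ⟨h1, h2⟩
        refine ⟨Or.inr h1, ?_⟩
        rintro (h | h)
        · exact ha (h ▸ h1)
        · exact h2 h
    rw [this, pow_succ]; ring
  · refine Finset.sum_congr rfl fun T hT => ?_
    have hT' := Finset.mem_powerset.1 hT
    have haT : a ∉ T := fun h => ha (hT' h)
    rw [Finset.insert_sdiff_of_notMem _ haT, Finset.card_insert_of_notMem, pow_succ]
    · ring
    · simp [ha]

theorem Ex_congr (p : ℝ) {F : Finset α} {f g : Finset α → ℝ} (h : ∀ T ⊆ F, f T = g T) :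
    Ex p F f = Ex p F g := by
  unfold Ex
  refine Finset.sum_congr rfl fun T hT => ?_
  rw [h T (Finset.mem_powerset.1 hT)]

theorem Ex_mono {p : ℝ} (h0 : 0 ≤ p) (h1 : p ≤ 1) {F : Finset α} {f g : Finset α → ℝ}
    (h : ∀ T ⊆ F, f T ≤ g T) : Ex p F f ≤ Ex p F g := by
  unfold Ex
  refine Finset.sum_le_sum fun T hT => ?_
  have : 0 ≤ 1 - p := by linarith
  exact mul_le_mul_of_nonneg_left (h T (Finset.mem_powerset.1 hT)) (by positivity)

theorem Ex_const (p : ℝ) (F : Finset α) (c : ℝ) : Ex p F (fun _ => c) = c := by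
  induction F using Finset.induction_on with
  | empty => rw [Ex_empty]
  | insert a F ha ih => rw [Ex_insert p ha, ih]; ring

theorem Ex_add (p : ℝ) (F : Finset α) (f g : Finset α → ℝ) :
    Ex p F (fun T => f T + g T) = Ex p F f + Ex p F g := by
  unfold Ex; rw [← Finset.sum_add_distrib]
  refine Finset.sum_congr rfl fun T _ => by ring

theorem Ex_mul (p : ℝ) (F : Finset α) (c : ℝ) (f : Finset α → ℝ) :
    Ex p F (fun T => c * f T) = c * Ex p F f := by
  unfold Ex; rw [Finset.mul_sum]
  refine Finset.sum_congr rfl fun T _ => by ring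

theorem Ex_sub (p : ℝ) (F : Finset α) (f g : Finset α → ℝ) :
    Ex p F (fun T => f T - g T) = Ex p F f - Ex p F g := by
  unfold Ex; rw [← Finset.sum_sub_distrib]
  refine Finset.sum_congr rfl fun T _ => by ring

theorem Ex_sum (p : ℝ) (F : Finset α) {ι : Type*} (s : Finset ι) (f : ι → Finset α → ℝ) :
    Ex p F (fun T => ∑ i ∈ s, f i T) = ∑ i ∈ s, Ex p F (f i) := by
  unfold Ex; rw [Finset.sum_comm]
  refine Finset.sum_congr rfl fun T _ => by rw [Finset.mul_sum]

theorem Ex_nonneg {p : ℝ} (h0 : 0 ≤ p) (h1 : p ≤ 1) {F : Finset α} {f : Finset α → ℝ}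
    (h : ∀ T ⊆ F, 0 ≤ f T) : 0 ≤ Ex p F f := by
  have := Ex_mono h0 h1 (f := fun _ => 0) (g := f) h
  rwa [Ex_const] at this

theorem Ex_union (p : ℝ) {F G : Finset α} (h : Disjoint F G) (f : Finset α → ℝ) :
    Ex p (F ∪ G) f = Ex p F (fun T => Ex p G (fun U => f (T ∪ U))) := by
  induction F using Finset.induction_on generalizing f with
  | empty => simp [Ex_empty]
  | insert a F ha ih =>
    rw [Finset.disjoint_insert_left] at h
    rw [Finset.insert_union, Ex_insert p (by simp [ha, h.1]), Ex_insert p ha, ih h.2, ih h.2]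
    simp only [Finset.insert_union]

theorem Ex_inter (p : ℝ) {F F' : Finset α} (h : F' ⊆ F) (f : Finset α → ℝ) :
    Ex p F (fun T => f (T ∩ F')) = Ex p F' f := by
  have hF : F = F' ∪ (F \ F') := by simp [h]
  rw [hF, Ex_union p (Finset.disjoint_sdiff)]
  refine Ex_congr p fun T hT => ?_
  rw [Ex_congr p (g := fun _ => f T), Ex_const]
  intro U hU
  congr 1
  ext x
  simp only [mem_inter, mem_union]
  constructor
  · rintro ⟨h1 | h1, h2⟩
    · exact h1
    · exact absurd h2 (Finset.mem_sdiff.1 (hU h1)).2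
  · intro h1; exact ⟨Or.inl h1, hT h1⟩

theorem Ex_indep (p : ℝ) {F G : Finset α} (h : Disjoint F G) (f g : Finset α → ℝ) :
    Ex p (F ∪ G) (fun T => f (T ∩ F) * g (T ∩ G)) = Ex p F f * Ex p G g := by
  rw [Ex_union p h, mul_comm, ← Ex_mul]
  refine Ex_congr p fun T hT => ?_
  rw [mul_comm, ← Ex_mul]
  refine Ex_congr p fun U hU => ?_
  have h1 : (T ∪ U) ∩ F = T := by
    rw [Finset.union_inter_distrib_right, Finset.inter_eq_left.2 hT,
      Finset.disjoint_iff_inter_eq_empty.1 (Finset.disjoint_of_subset_left hU h.symm)]; simp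
  have h2 : (T ∪ U) ∩ G = U := by
    rw [Finset.union_inter_distrib_right, Finset.inter_eq_left.2 hU,
      Finset.disjoint_iff_inter_eq_empty.1 (Finset.disjoint_of_subset_left hT h)]; simp
  rw [h1, h2]

theorem Ex_image (p : ℝ) (F : Finset α) {φ : α → α} (hφ : Function.Injective φ)
    (f : Finset α → ℝ) : Ex p (F.image φ) f = Ex p F (fun T => f (T.image φ)) := by
  induction F using Finset.induction_on generalizing f with
  | empty => simp [Ex_empty]
  | insert a F ha ih =>
    rw [Finset.image_insert, Ex_insert p (by simpa [hφ.eq_iff] using ha), Ex_insert p ha, ih, ih]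
    simp only [Finset.image_insert]

theorem Ex_mono_set {p : ℝ} (h0 : 0 ≤ p) (h1 : p ≤ 1) {F F' : Finset α} (h : F' ⊆ F)
    {f : Finset α → ℝ} (hf : Monotone f) : Ex p F' f ≤ Ex p F f := by
  rw [← Ex_inter p h]
  exact Ex_mono h0 h1 fun T _ => hf Finset.inter_subset_left

theorem Ex_harris {p : ℝ} (h0 : 0 ≤ p) (h1 : p ≤ 1) (F : Finset α)
    {f g : Finset α → ℝ} (hf : Antitone f) (hg : Antitone g) :
    Ex p F f * Ex p F g ≤ Ex p F (fun T => f T * g T) := by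
  induction F using Finset.induction_on generalizing f g with
  | empty => simp [Ex_empty]
  | insert a F ha ih =>
    rw [Ex_insert p ha, Ex_insert p ha, Ex_insert p ha]
    have hf' : Antitone fun T => f (insert a T) := fun S T h => hf (Finset.insert_subset_insert a h)
    have hg' : Antitone fun T => g (insert a T) := fun S T h => hg (Finset.insert_subset_insert a h)
    have i1 := ih hf' hg'
    have i2 := ih hf hg
    have m1 : Ex p F (fun T => f (insert a T)) ≤ Ex p F f :=
      Ex_mono h0 h1 fun T _ => hf (Finset.subset_insert a T)
    have m2 : Ex p F (fun T => g (insert a T)) ≤ Ex p F g :=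
      Ex_mono h0 h1 fun T _ => hg (Finset.subset_insert a T)
    have h1' : 0 ≤ 1 - p := by linarith
    have k1 := mul_le_mul_of_nonneg_left i1 h0
    have k2 := mul_le_mul_of_nonneg_left i2 h1'
    have k3 := mul_nonneg (mul_nonneg h0 h1') (mul_nonneg (sub_nonneg.2 m1) (sub_nonneg.2 m2))
    nlinarith

theorem Ex_hasDeriv (F : Finset α) (f : Finset α → ℝ) (p : ℝ) :
    HasDerivAt (fun p => Ex p F f)
      (Ex p F (fun T => ∑ e ∈ F, (f (insert e T) - f (T.erase e)))) p := by
  induction F using Finset.induction_on generalizing f with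
  | empty => simp only [Ex_empty]; simpa using hasDerivAt_const p (f ∅)
  | insert a F ha ih =>
    simp only [Ex_insert _ ha]
    have h1 := (hasDerivAt_id p).mul (ih (fun T => f (insert a T)))
    have h2 := ((hasDerivAt_const p (1 : ℝ)).sub (hasDerivAt_id p)).mul (ih f)
    have h3 := h1.add h2
    refine h3.congr_deriv ?_
    simp only [id, Pi.sub_apply]
    have e1 : Ex p F (fun T => ∑ e ∈ insert a F, (f (insert e (insert a T)) - f ((insert a T).erase e)))
        = Ex p F (fun T => f (insert a T)) - Ex p F f +
          Ex p F (fun T => ∑ e ∈ F, (f (insert a (insert e T)) - f (insert a (T.erase e)))) := by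
      rw [← Ex_sub, ← Ex_add]
      refine Ex_congr p fun T hT => ?_
      rw [Finset.sum_insert ha]
      have haT : a ∉ T := fun h => ha (hT h)
      rw [Finset.erase_insert haT, Finset.insert_idem]
      congr 1
      refine Finset.sum_congr rfl fun e he => ?_
      have : e ≠ a := fun h => ha (h ▸ he)
      rw [Finset.insert_comm, Finset.erase_insert_of_ne this.symm]
    have e2 : Ex p F (fun T => ∑ e ∈ insert a F, (f (insert e T) - f (T.erase e)))
        = Ex p F (fun T => f (insert a T)) - Ex p F f +
          Ex p F (fun T => ∑ e ∈ F, (f (insert e T) - f (T.erase e))) := by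
      rw [← Ex_sub, ← Ex_add]
      refine Ex_congr p fun T hT => ?_
      have haT : a ∉ T := fun h => ha (hT h)
      rw [Finset.sum_insert ha, Finset.erase_eq_of_notMem haT]
    rw [e1, e2]; ring

noncomputable def ind (P : Prop) : ℝ := if P then 1 else 0

theorem ind_true {P : Prop} (h : P) : ind P = 1 := by simp [ind, h]
theorem ind_false {P : Prop} (h : ¬P) : ind P = 0 := by simp [ind, h]
theorem ind_nonneg (P : Prop) : 0 ≤ ind P := by unfold ind; split_ifs <;> norm_num
theorem ind_le_one (P : Prop) : ind P ≤ 1 := by unfold ind; split_ifs <;> norm_num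
theorem ind_mono {P Q : Prop} (h : P → Q) : ind P ≤ ind Q := by
  by_cases hP : P
  · rw [ind_true hP, ind_true (h hP)]
  · rw [ind_false hP]; exact ind_nonneg Q
theorem ind_not (P : Prop) : ind (¬P) = 1 - ind P := by
  by_cases hP : P <;> simp [ind, hP]
theorem ind_and (P Q : Prop) : ind (P ∧ Q) = ind P * ind Q := by
  by_cases hP : P <;> by_cases hQ : Q <;> simp [ind, hP, hQ]
theorem ind_congr {P Q : Prop} (h : P ↔ Q) : ind P = ind Q := by rw [propext h]

noncomputable def Pr (p : ℝ) (F : Finset α) (A : Finset α → Prop) : ℝ :=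
  Ex p F (fun T => ind (A T))

theorem Pr_nonneg {p : ℝ} (h0 : 0 ≤ p) (h1 : p ≤ 1) (F : Finset α) (A : Finset α → Prop) :
    0 ≤ Pr p F A := Ex_nonneg h0 h1 fun _ _ => ind_nonneg _

theorem Pr_mono {p : ℝ} (h0 : 0 ≤ p) (h1 : p ≤ 1) {F : Finset α} {A B : Finset α → Prop}
    (h : ∀ T ⊆ F, A T → B T) : Pr p F A ≤ Pr p F B := Ex_mono h0 h1 fun T hT => ind_mono (h T hT)

theorem Pr_le_one {p : ℝ} (h0 : 0 ≤ p) (h1 : p ≤ 1) (F : Finset α) (A : Finset α → Prop) :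
    Pr p F A ≤ 1 := by
  have := Ex_mono h0 h1 (F := F) (f := fun T => ind (A T)) (g := fun _ => 1) fun T _ => ind_le_one _
  rwa [Ex_const] at this

theorem Pr_not (p : ℝ) (F : Finset α) (A : Finset α → Prop) :
    Pr p F (fun T => ¬ A T) = 1 - Pr p F A := by
  unfold Pr; simp only [ind_not]; rw [Ex_sub, Ex_const]

/-- uniform law: bijection invariance at `p = 1/2` -/
theorem Ex_half (F : Finset α) (f : Finset α → ℝ) :
    Ex (1/2) F f = (1/2 : ℝ) ^ F.card * ∑ T ∈ F.powerset, f T := by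
  unfold Ex; rw [Finset.mul_sum]
  refine Finset.sum_congr rfl fun T hT => ?_
  have hT' := Finset.mem_powerset.1 hT
  have : (1:ℝ) - 1/2 = 1/2 := by norm_num
  rw [this, ← pow_add, add_comm, Finset.card_sdiff_add_card_eq_card hT']

end fincalc

/-! lattice -/
abbrev V : Type := ℤ × ℤ
abbrev Edge : Type := (ℤ × ℤ) × Bool

def src (e : Edge) : V := e.1
def tgt (e : Edge) : V := match e.2 with
  | true => (e.1.1, e.1.2 + 1)
  | false => (e.1.1 + 1, e.1.2)

def Adj (T : Finset Edge) (u v : V) : Prop :=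
  ∃ e ∈ T, (src e = u ∧ tgt e = v) ∨ (src e = v ∧ tgt e = u)

def Conn (T : Finset Edge) (u v : V) : Prop := Relation.ReflTransGen (Adj T) u v

theorem Adj.symm {T : Finset Edge} {u v : V} (h : Adj T u v) : Adj T v u := by
  obtain ⟨e, he, h⟩ := h; exact ⟨e, he, h.symm⟩

theorem Adj.mono {S T : Finset Edge} (h : S ⊆ T) {u v : V} (a : Adj S u v) : Adj T u v := by
  obtain ⟨e, he, a⟩ := a; exact ⟨e, h he, a⟩

theorem Conn.refl (T : Finset Edge) (u : V) : Conn T u u := Relation.ReflTransGen.refl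

theorem Conn.symm {T : Finset Edge} {u v : V} (h : Conn T u v) : Conn T v u := by
  induction h with
  | refl => exact Conn.refl _ _
  | tail _ hb ih => exact Relation.ReflTransGen.head hb.symm ih

theorem Conn.trans {T : Finset Edge} {u v w : V} (h : Conn T u v) (h' : Conn T v w) : Conn T u w :=
  Relation.ReflTransGen.trans h h'

theorem Conn.mono {S T : Finset Edge} (h : S ⊆ T) {u v : V} (a : Conn S u v) : Conn T u v :=
  Relation.ReflTransGen.mono (fun _ _ => Adj.mono h) _ _ a

theorem Conn.edge {T : Finset Edge} {e : Edge} (h : e ∈ T) : Conn T (src e) (tgt e) :=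
  Relation.ReflTransGen.single ⟨e, h, Or.inl ⟨rfl, rfl⟩⟩

/-- connection from a root set -/
def CK (T : Finset Edge) (K : Set V) (z : V) : Prop := ∃ k ∈ K, Conn T k z

def touch (e : Edge) (K : Set V) : Prop := src e ∈ K ∨ tgt e ∈ K

theorem CK.mono {S T : Finset Edge} (h : S ⊆ T) {K : Set V} {z : V} (a : CK S K z) : CK T K z := by
  obtain ⟨k, hk, c⟩ := a; exact ⟨k, hk, c.mono h⟩

theorem CK.trans {T : Finset Edge} {K : Set V} {z w : V} (a : CK T K z) (c : Conn T z w) :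
    CK T K w := by
  obtain ⟨k, hk, c'⟩ := a; exact ⟨k, hk, c'.trans c⟩

theorem CK_insert {T : Finset Edge} {K : Set V} {e : Edge} (he : touch e K) (z : V) :
    CK (insert e T) K z ↔ CK T (K ∪ {src e, tgt e}) z := by
  constructor
  · rintro ⟨k, hk, c⟩
    induction c with
    | refl => exact ⟨k, Or.inl hk, Conn.refl _ _⟩
    | tail _ hb ih =>
      obtain ⟨f, hf, hb⟩ := hb
      rcases Finset.mem_insert.1 hf with rfl | hf
      · rcases hb with ⟨_, h⟩ | ⟨h, _⟩
        · exact ⟨_, Or.inr (by simp [h]), Conn.refl _ _⟩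
        · exact ⟨_, Or.inr (by simp [h]), Conn.refl _ _⟩
      · exact ih.trans (Relation.ReflTransGen.single ⟨f, hf, hb⟩)
  · rintro ⟨k, hk, c⟩
    have c' := c.mono (Finset.subset_insert e T)
    have hE : Conn (insert e T) (src e) (tgt e) := Conn.edge (Finset.mem_insert_self _ _)
    rcases hk with hk | hk
    · exact ⟨k, hk, c'⟩
    · rcases hk with rfl | hk
      · rcases he with he | he
        · exact ⟨_, he, c'⟩
        · exact ⟨_, he, hE.symm.trans c'⟩
      · rw [Set.mem_singleton_iff] at hk; subst hk
        rcases he with he | he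
        · exact ⟨_, he, hE.trans c'⟩
        · exact ⟨_, he, c'⟩

/-- adding one edge -/
theorem conn_insert_cases {T : Finset Edge} {e : Edge} {u w : V} (h : Conn (insert e T) u w)
    (hn : ¬ Conn T u w) : (Conn T u (src e) ∧ Conn T (tgt e) w) ∨
      (Conn T u (tgt e) ∧ Conn T (src e) w) := by
  induction h with
  | refl => exact absurd (Conn.refl _ _) hn
  | @tail b c _ hb ih =>
    obtain ⟨f, hf, hb⟩ := hb
    rcases Finset.mem_insert.1 hf with rfl | hf
    · by_cases hub : Conn T u b
      · rcases hb with ⟨rfl, rfl⟩ | ⟨rfl, rfl⟩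
        · exact Or.inl ⟨hub, Conn.refl _ _⟩
        · exact Or.inr ⟨hub, Conn.refl _ _⟩
      · rcases ih hub with ⟨h1, h2⟩ | ⟨h1, h2⟩
        · rcases hb with ⟨rfl, rfl⟩ | ⟨rfl, rfl⟩
          · exact Or.inl ⟨h1, Conn.refl _ _⟩
          · exact absurd h1 hn
        · rcases hb with ⟨rfl, rfl⟩ | ⟨rfl, rfl⟩
          · exact absurd h1 hn
          · exact Or.inr ⟨h1, Conn.refl _ _⟩
    · have hbc : Conn T b c := Relation.ReflTransGen.single ⟨f, hf, hb⟩
      have hub : ¬ Conn T u b := fun h => hn (h.trans hbc)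
      rcases ih hub with ⟨h1, h2⟩ | ⟨h1, h2⟩
      · exact Or.inl ⟨h1, h2.trans hbc⟩
      · exact Or.inr ⟨h1, h2.trans hbc⟩

/-- if joining by extra edges `E`, then a pivotal edge can be produced -/
theorem exists_pivot {T E : Finset Edge} {u w : V} (hn : ¬ Conn T u w) (h : Conn (T ∪ E) u w) :
    ∃ U ⊆ E, ∃ e ∈ E, ¬ Conn (T ∪ U) u w ∧ e ∉ T ∪ U ∧
      ((Conn (T ∪ U) u (src e) ∧ Conn (T ∪ U) (tgt e) w) ∨
      (Conn (T ∪ U) u (tgt e) ∧ Conn (T ∪ U) (src e) w)) := by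
  induction E using Finset.induction_on with
  | empty => simp at h; exact absurd h hn
  | insert e E he ih =>
    by_cases hc : Conn (T ∪ E) u w
    · obtain ⟨U, hU, e', he', r⟩ := ih hc
      exact ⟨U, hU.trans (Finset.subset_insert _ _), e', Finset.mem_insert_of_mem he', r⟩
    · rw [Finset.union_insert] at h
      refine ⟨E, Finset.subset_insert _ _, e, Finset.mem_insert_self _ _, hc, ?_,
        conn_insert_cases h hc⟩
      intro hmem
      rw [Finset.insert_eq_of_mem hmem] at h
      exact hc h

/-- exploration induction -/
theorem explore {P : Finset Edge → Set V → Prop}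
    (base : ∀ F K, (∀ e ∈ F, ¬ touch e K) → P F K)
    (step : ∀ F K e, e ∉ F → touch e K → P F (K ∪ {src e, tgt e}) → P F K → P (insert e F) K)
    (F : Finset Edge) (K : Set V) : P F K := by
  induction hn : F.card generalizing F K with
  | zero =>
    rw [Finset.card_eq_zero] at hn; subst hn
    exact base _ _ (by simp)
  | succ n ih =>
    by_cases h : ∀ e ∈ F, ¬ touch e K
    · exact base _ _ h
    · push Not at h
      obtain ⟨e, he, ht⟩ := h
      have hc : (F.erase e).card = n := by rw [Finset.card_erase_of_mem he, hn]; rfl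
      have := step (F.erase e) K e (by simp) ht (ih _ _ hc) (ih _ _ hc)
      rwa [Finset.insert_erase he] at this

theorem CK_base {T : Finset Edge} {K : Set V} (h : ∀ e ∈ T, ¬ touch e K) {z : V}
    (c : CK T K z) : z ∈ K := by
  obtain ⟨k, hk, c⟩ := c
  induction c with
  | refl => exact hk
  | tail _ hb ih =>
    obtain ⟨e, he, hb⟩ := hb
    rcases hb with ⟨h1, _⟩ | ⟨_, h1⟩
    · exact absurd (Or.inl (h1 ▸ ih)) (h e he)
    · exact absurd (Or.inr (h1 ▸ ih)) (h e he)

end Perc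

namespace Perc
open Finset Classical

noncomputable def ES (S : Finset V) : Finset Edge :=
  (S ×ˢ (Finset.univ : Finset Bool)).filter (fun e => tgt e ∈ S)

theorem mem_ES {S : Finset V} {e : Edge} : e ∈ ES S ↔ src e ∈ S ∧ tgt e ∈ S := by
  simp [ES, src]

theorem ES_mono {S S' : Finset V} (h : S ⊆ S') : ES S ⊆ ES S' := fun e he => by
  rw [mem_ES] at *; exact ⟨h he.1, h he.2⟩

theorem card_ES_le (S : Finset V) : (ES S).card ≤ 2 * S.card := by
  refine (Finset.card_filter_le _ _).trans ?_
  simp [Finset.card_product, mul_comm]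

/-- lattice symmetries -/
structure Sym where
  g : V ≃ V
  φ : Edge ≃ Edge
  h : ∀ e, (src (φ e) = g (src e) ∧ tgt (φ e) = g (tgt e)) ∨
    (src (φ e) = g (tgt e) ∧ tgt (φ e) = g (src e))

theorem Sym.conn (s : Sym) (T : Finset Edge) (u v : V) :
    Conn (T.image s.φ) (s.g u) (s.g v) ↔ Conn T u v := by
  constructor
  · intro h
    have key : ∀ w, Conn (T.image s.φ) (s.g u) w → Conn T u (s.g.symm w) := by
      intro w hw
      induction hw with
      | refl => simpa using Conn.refl T u
      | tail _ hb ih =>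
        refine ih.trans (Relation.ReflTransGen.single ?_)
        obtain ⟨e, he, hb⟩ := hb
        obtain ⟨e, he2, rfl⟩ := Finset.mem_image.1 he
        refine ⟨e, he2, ?_⟩
        rcases s.h e with ⟨h1, h2⟩ | ⟨h1, h2⟩ <;> rcases hb with ⟨h3, h4⟩ | ⟨h3, h4⟩ <;>
          rw [← h3, ← h4, h1, h2] <;> simp
    simpa using key _ h
  · intro h
    induction h with
    | refl => exact Conn.refl _ _
    | tail _ hb ih =>
      refine ih.trans (Relation.ReflTransGen.single ?_)
      obtain ⟨e, he, hb⟩ := hb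
      refine ⟨s.φ e, Finset.mem_image_of_mem _ he, ?_⟩
      rcases s.h e with ⟨h1, h2⟩ | ⟨h1, h2⟩ <;> rcases hb with ⟨h3, h4⟩ | ⟨h3, h4⟩ <;>
          rw [← h3, ← h4, h1, h2] <;> simp

theorem Sym.ES_image (s : Sym) (S : Finset V) : (ES S).image s.φ = ES (S.image s.g) := by
  ext e
  have hE : e = s.φ (s.φ.symm e) := by simp
  generalize s.φ.symm e = f at hE
  subst hE
  have hm : s.φ f ∈ (ES S).image s.φ ↔ f ∈ ES S := by simp
  have hg : ∀ v, s.g v ∈ S.image s.g ↔ v ∈ S := by simp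
  rw [hm, mem_ES, mem_ES]
  rcases s.h f with ⟨h1, h2⟩ | ⟨h1, h2⟩ <;> rw [h1, h2, hg, hg]
  tauto

theorem Sym.Pr (s : Sym) (p : ℝ) (F : Finset Edge) (A : Finset Edge → Prop) :
    Perc.Pr p (F.image s.φ) A = Perc.Pr p F (fun T => A (T.image s.φ)) :=
  Ex_image p F s.φ.injective _

def transl (a : V) : Sym where
  g := Equiv.addRight a
  φ := ⟨fun e => (e.1 + a, e.2), fun e => (e.1 - a, e.2), fun e => by simp, fun e => by simp⟩
  h := by
    rintro ⟨⟨x, y⟩, b⟩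
    left
    cases b <;> simp [src, tgt, Prod.ext_iff] <;> ring

def transp : Sym where
  g := Equiv.prodComm ℤ ℤ
  φ := ⟨fun e => ((e.1.2, e.1.1), !e.2), fun e => ((e.1.2, e.1.1), !e.2), fun e => by simp,
    fun e => by simp⟩
  h := by
    rintro ⟨⟨x, y⟩, b⟩
    left
    cases b <;> simp [src, tgt]

def reflx : Sym where
  g := ⟨fun v => (-v.1, v.2), fun v => (-v.1, v.2), fun v => by simp, fun v => by simp⟩
  φ := ⟨fun e => match e with
        | ((x, y), true) => ((-x, y), true)
        | ((x, y), false) => ((-x - 1, y), false),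
      fun e => match e with
        | ((x, y), true) => ((-x, y), true)
        | ((x, y), false) => ((-x - 1, y), false),
      by rintro ⟨⟨x, y⟩, b⟩; cases b <;> simp, by rintro ⟨⟨x, y⟩, b⟩; cases b <;> simp⟩
  h := by
    rintro ⟨⟨x, y⟩, b⟩
    cases b
    · right; simp [src, tgt]; ring
    · left; simp [src, tgt]

/-! ### planar duality -/

def bd (z : Edge → ZMod 2) (v : V) : ZMod 2 :=
  z (v, false) + z ((v.1 - 1, v.2), false) + z (v, true) + z ((v.1, v.2 - 1), true)

def dl (a b : V) : ZMod 2 := if a = b then 1 else 0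

theorem bd_single (e : Edge) (v : V) :
    bd (Pi.single e 1) v = dl (src e) v + dl (tgt e) v := by
  obtain ⟨⟨x, y⟩, b⟩ := e
  obtain ⟨a, c⟩ := v
  cases b
  · have : (a - 1 = x ∧ c = y) ↔ (x + 1 = a ∧ y = c) := by omega
    have h2 : (a = x ∧ c = y) ↔ (x = a ∧ y = c) := by omega
    simp [bd, dl, src, tgt, Pi.single_apply, this, h2]
  · have : (a = x ∧ c - 1 = y) ↔ (x = a ∧ y + 1 = c) := by omega
    have h2 : (a = x ∧ c = y) ↔ (x = a ∧ y = c) := by omega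
    simp [bd, dl, src, tgt, Pi.single_apply, this, h2]

theorem bd_add (z w : Edge → ZMod 2) (v : V) : bd (z + w) v = bd z v + bd w v := by
  simp [bd]; ring

theorem exists_chain {T : Finset Edge} {u w : V} (h : Conn T u w) :
    ∃ z : Edge → ZMod 2, (∀ e, e ∉ T → z e = 0) ∧ ∀ v, bd z v = dl u v + dl w v := by
  induction h with
  | refl =>
    refine ⟨0, fun _ _ => rfl, fun v => ?_⟩
    rw [CharTwo.add_self_eq_zero]; simp [bd]
  | @tail b c _ hb ih =>
    obtain ⟨z, hz, hbd⟩ := ih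
    obtain ⟨e, he, hb⟩ := hb
    refine ⟨z + Pi.single e 1, fun f hf => ?_, fun v => ?_⟩
    · have : f ≠ e := fun h => hf (h ▸ he)
      simp [hz f hf, this]
    · rw [bd_add, hbd, bd_single]
      have h2 := CharTwo.add_self_eq_zero (dl b v)
      rcases hb with ⟨rfl, rfl⟩ | ⟨rfl, rfl⟩
      · linear_combination h2
      · linear_combination h2

def sg (e : Edge) : Edge := match e with
  | ((x, y), false) => ((y, x), false)
  | ((x, y), true) => ((y + 1, x - 1), true)

theorem sg_sg (e : Edge) : sg (sg e) = e := by
  obtain ⟨⟨x, y⟩, b⟩ := e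
  cases b <;> simp [sg]

noncomputable def DD (N : ℤ) : Finset V := Finset.Icc (-N) (N + 1) ×ˢ Finset.Icc (-N) N

theorem mem_DD {N : ℤ} {v : V} : v ∈ DD N ↔ (-N ≤ v.1 ∧ v.1 ≤ N + 1) ∧ (-N ≤ v.2 ∧ v.2 ≤ N) := by
  simp [DD]

def cross (N : ℤ) (T : Finset Edge) : Prop :=
  ∃ u w : V, u ∈ DD N ∧ w ∈ DD N ∧ u.1 = -N ∧ w.1 = N + 1 ∧ Conn T u w

theorem not_both {N : ℤ} (hN : 0 ≤ N) {T T' : Finset Edge} (hT : T ⊆ ES (DD N))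
    (hT' : T' ⊆ ES (DD N)) (hd : ∀ e ∈ T', sg e ∉ T) (h : cross N T) (h' : cross N T') : False := by
  obtain ⟨u, w, hu, hw, hu1, hw1, c⟩ := h
  obtain ⟨u', w', hu', hw', hu1', hw1', c'⟩ := h'
  obtain ⟨z, hz, hbd⟩ := exists_chain c
  rw [mem_DD] at hu hw hu' hw'
  have hz0 : ∀ x y : ℤ, (y < -N ∨ N ≤ y) → z ((x, y), true) = 0 := by
    intro x y hxy
    refine hz _ fun hmem => ?_
    have := mem_ES.1 (hT hmem)
    rw [mem_DD, mem_DD] at this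
    simp [src, tgt] at this
    omega
  have hzl : ∀ y : ℤ, z ((-N - 1, y), false) = 0 := by
    intro y
    refine hz _ fun hmem => ?_
    have := mem_ES.1 (hT hmem)
    rw [mem_DD, mem_DD] at this
    simp [src, tgt] at this
  -- height function
  let H : ℤ → ℤ → ZMod 2 := fun X Y => ∑ j ∈ Finset.Ico (-N) X, z ((Y, j), false)
  have Hsucc : ∀ X Y : ℤ, -N ≤ X → H (X + 1) Y = H X Y + z ((Y, X), false) := by
    intro X Y hX
    simp only [H]
    rw [← Finset.insert_Ico_right_eq_Ico_add_one (by omega), Finset.sum_insert (by simp), add_comm]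
  have H0 : ∀ Y, H (-N) Y = 0 := by intro Y; simp [H]
  have Hside : ∀ X Y : ℤ, -N ≤ X → X ≤ N + 1 → -N ≤ Y → Y < N →
      H X (Y + 1) = H X Y + z ((Y + 1, X - 1), true) := by
    intro X Y hX
    induction X, hX using Int.leInduction with
    | base =>
      intro _ _ _
      rw [H0, H0, hz0 _ _ (by omega)]; simp
    | succ X hX ih =>
      intro h1 h2 h3
      have i := ih (by omega) h2 h3
      rw [Hsucc _ _ hX, Hsucc _ _ hX, i]
      have b := hbd (Y + 1, X)
      have d1 : dl u (Y + 1, X) = 0 := by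
        simp only [dl]; rw [if_neg]; intro h; rw [h] at hu1; simp at hu1; omega
      have d2 : dl w (Y + 1, X) = 0 := by
        simp only [dl]; rw [if_neg]; intro h; rw [h] at hw1; simp at hw1; omega
      rw [d1, d2] at b
      simp only [bd, add_sub_cancel_right] at b
      have t1 := CharTwo.add_self_eq_zero (z ((Y, X), false))
      have t2 := CharTwo.add_self_eq_zero (z ((Y + 1, X), true))
      rw [add_sub_cancel_right]
      linear_combination b - t1 - t2
  have Hleft : ∀ X : ℤ, -N ≤ X → X ≤ N + 1 →
      H X (-N) = (if u.2 < X then 1 else 0) + z ((-N, X - 1), true) := by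
    intro X hX
    induction X, hX using Int.leInduction with
    | base =>
      intro _
      rw [H0, hz0 _ _ (by omega), if_neg (by omega)]; simp
    | succ X hX ih =>
      intro h1
      have i := ih (by omega)
      rw [Hsucc _ _ hX, i]
      have b := hbd (-N, X)
      have d2 : dl w (-N, X) = 0 := by
        simp only [dl]; rw [if_neg]; intro h; rw [h] at hw1; simp at hw1; omega
      have d1 : (if u.2 < X then (1 : ZMod 2) else 0) + dl u (-N, X) = if u.2 < X + 1 then 1 else 0 := by
        have : u = (-N, X) ↔ u.2 = X := by
          rw [Prod.ext_iff]; simp [hu1]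
        simp only [dl, this]
        rcases lt_trichotomy u.2 X with h | h | h
        · rw [if_pos h, if_neg (by omega), if_pos (by omega)]; simp
        · rw [if_neg (by omega), if_pos h, if_pos (by omega)]; simp
        · rw [if_neg (by omega), if_neg (by omega), if_neg (by omega)]; simp
      rw [d2] at b
      simp only [bd, hzl] at b
      rw [← d1]
      have t2 := CharTwo.add_self_eq_zero (z ((-N, X), true))
      rw [add_sub_cancel_right]
      linear_combination b - t2
  have Htop : ∀ Y : ℤ, -N ≤ Y → Y ≤ N → H (N + 1) Y = 1 := by
    intro Y hY
    induction Y, hY using Int.leInduction with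
    | base =>
      intro _
      rw [Hleft _ (by omega) (by omega), if_pos (by omega), hz0 _ _ (by omega)]; simp
    | succ Y hY ih =>
      intro h
      rw [Hside _ _ (by omega) (by omega) hY (by omega), ih (by omega), hz0 _ _ (by omega)]; simp
  have inv : ∀ v, Conn T' u' v → H v.1 v.2 = H u'.1 u'.2 := by
    intro v hv
    induction hv with
    | refl => rfl
    | @tail b c _ hb ih =>
      rw [← ih]
      obtain ⟨e, he, hb⟩ := hb
      have hmem := mem_ES.1 (hT' he)
      rw [mem_DD, mem_DD] at hmem
      have hzz := hz _ (hd e he)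
      have key : H (tgt e).1 (tgt e).2 = H (src e).1 (src e).2 := by
        obtain ⟨⟨x, y⟩, b⟩ := e
        cases b
        · simp only [src, tgt, sg] at *
          rw [Hsucc _ _ (by omega), hzz, add_zero]
        · simp only [src, tgt, sg] at *
          rw [Hside _ _ (by omega) (by omega) (by omega) (by omega), hzz, add_zero]
      rcases hb with ⟨rfl, rfl⟩ | ⟨rfl, rfl⟩
      · exact key
      · exact key.symm
  have := inv _ c'
  rw [hw1', hu1', H0, Htop _ (by omega) (by omega)] at this
  exact one_ne_zero this

theorem cross_le_half {N : ℤ} (hN : 0 ≤ N) : Pr (1/2) (ES (DD N)) (cross N) ≤ 1/2 := by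
  set F := ES (DD N) with hF
  let st : Edge → Edge := fun e => if sg e ∈ F then sg e else e
  have st_mem : ∀ e ∈ F, st e ∈ F := by
    intro e he; simp only [st]; split_ifs with h <;> assumption
  have st_st : ∀ e ∈ F, st (st e) = e := by
    intro e he; simp only [st]
    by_cases h : sg e ∈ F
    · simp [h, sg_sg, he]
    · simp [h]
  let τ : Finset Edge → Finset Edge := fun T => F.filter (fun e => st e ∉ T)
  have τsub : ∀ T, τ T ⊆ F := fun T => Finset.filter_subset _ _
  have ττ : ∀ T ⊆ F, τ (τ T) = T := by
    intro T hT
    ext e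
    simp only [τ, Finset.mem_filter, not_and, not_not]
    constructor
    · rintro ⟨h1, h2⟩
      have := h2 (st_mem e h1); rwa [st_st e h1] at this
    · intro h
      refine ⟨hT h, fun _ => ?_⟩
      rw [st_st e (hT h)]; exact h
  have hsum : ∑ T ∈ F.powerset, ind (cross N T) = ∑ T ∈ F.powerset, ind (cross N (τ T)) := by
    refine Finset.sum_bij' (fun T _ => τ T) (fun T _ => τ T) ?_ ?_ ?_ ?_ ?_
    · intro T _; exact Finset.mem_powerset.2 (τsub T)
    · intro T _; exact Finset.mem_powerset.2 (τsub T)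
    · intro T hT; exact ττ T (Finset.mem_powerset.1 hT)
    · intro T hT; exact ττ T (Finset.mem_powerset.1 hT)
    · intro T hT; rw [ττ T (Finset.mem_powerset.1 hT)]
  have hP : Pr (1/2) F (cross N) = Pr (1/2) F (fun T => cross N (τ T)) := by
    unfold Pr; rw [Ex_half, Ex_half, hsum]
  have hle : Pr (1/2) F (fun T => cross N (τ T)) ≤ Pr (1/2) F (fun T => ¬ cross N T) := by
    refine Pr_mono (by norm_num) (by norm_num) fun T hT h1 h2 => ?_
    refine not_both hN hT (τsub T) (fun e he hs => ?_) h2 h1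
    rw [Finset.mem_filter] at he
    have : st e = sg e := by simp only [st]; rw [if_pos (hT hs)]
    exact he.2 (this ▸ hs)
  rw [Pr_not] at hle
  linarith

end Perc

namespace Perc
open Finset Classical

def cl (T : Finset Edge) (K : Set V) : Set V := {z | CK T K z}

noncomputable def cA (T : Finset Edge) (K : Set V) : ℕ := (T.filter (fun e => touch e (cl T K))).card
noncomputable def cB (F T : Finset Edge) (K : Set V) : ℕ :=
  ((F \ T).filter (fun e => touch e (cl T K))).card

theorem subset_cl (T : Finset Edge) (K : Set V) : K ⊆ cl T K := fun k hk => ⟨k, hk, Conn.refl _ _⟩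

theorem touch_mono {e : Edge} {K K' : Set V} (h : K ⊆ K') (t : touch e K) : touch e K' :=
  t.imp (fun x => h x) (fun x => h x)

theorem genfun (s : ℝ) (F : Finset Edge) (K : Set V) :
    Ex (1/2) F (fun T => (1 + s) ^ cA T K * (1 - s) ^ cB F T K) = 1 := by
  refine explore (P := fun F K => Ex (1/2) F (fun T => (1 + s) ^ cA T K * (1 - s) ^ cB F T K) = 1)
    ?_ ?_ F K
  · intro F K h
    rw [Ex_congr (g := fun _ => 1), Ex_const]
    intro T hT
    have hcl : cl T K = K := by
      refine Set.Subset.antisymm (fun z hz => ?_) (subset_cl T K)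
      exact CK_base (fun e he => h e (hT he)) hz
    have h1 : cA T K = 0 := by
      unfold cA; rw [hcl, Finset.card_eq_zero, Finset.filter_eq_empty_iff]
      exact fun e he => h e (hT he)
    have h2 : cB F T K = 0 := by
      unfold cB; rw [hcl, Finset.card_eq_zero, Finset.filter_eq_empty_iff]
      exact fun e he => h e (Finset.mem_sdiff.1 he).1
    rw [h1, h2]; simp
  · intro F K e he ht ih1 ih2
    rw [Ex_insert _ he]
    have a1 : Ex (1/2) F (fun T => (1 + s) ^ cA (insert e T) K * (1 - s) ^ cB (insert e F) (insert e T) K)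
        = (1 + s) * Ex (1/2) F (fun T => (1 + s) ^ cA T (K ∪ {src e, tgt e}) *
            (1 - s) ^ cB F T (K ∪ {src e, tgt e})) := by
      rw [← Ex_mul]
      refine Ex_congr _ fun T hT => ?_
      have heT : e ∉ T := fun h => he (hT h)
      have hcl : cl (insert e T) K = cl T (K ∪ {src e, tgt e}) := by
        ext z; exact CK_insert ht z
      have hte : touch e (cl T (K ∪ {src e, tgt e})) :=
        touch_mono (Set.subset_union_left.trans (subset_cl _ _)) ht
      have h1 : cA (insert e T) K = cA T (K ∪ {src e, tgt e}) + 1 := by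
        unfold cA; rw [hcl, Finset.filter_insert, if_pos hte, Finset.card_insert_of_notMem]
        simp [heT]
      have h2 : cB (insert e F) (insert e T) K = cB F T (K ∪ {src e, tgt e}) := by
        unfold cB; rw [hcl]
        congr 2
        rw [Finset.insert_sdiff_insert, Finset.sdiff_insert_of_notMem he]
      rw [h1, h2, pow_succ]; ring
    have a2 : Ex (1/2) F (fun T => (1 + s) ^ cA T K * (1 - s) ^ cB (insert e F) T K)
        = (1 - s) * Ex (1/2) F (fun T => (1 + s) ^ cA T K * (1 - s) ^ cB F T K) := by
      rw [← Ex_mul]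
      refine Ex_congr _ fun T hT => ?_
      have heT : e ∉ T := fun h => he (hT h)
      have hte : touch e (cl T K) := touch_mono (subset_cl _ _) ht
      have h2 : cB (insert e F) T K = cB F T K + 1 := by
        unfold cB
        rw [Finset.insert_sdiff_of_notMem _ heT, Finset.filter_insert, if_pos hte,
          Finset.card_insert_of_notMem]
        simp [he]
      rw [h2, pow_succ]; ring
    rw [a1, a2, ih1, ih2]; ring

theorem exp_le_aux {s : ℝ} (h1 : -(1/2) ≤ s) (h2 : s ≤ 1/2) : Real.exp (s - 2 * s ^ 2) ≤ 1 + s := by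
  have h3 : 0 < 1 - s + 2 * s ^ 2 := by nlinarith
  have h4 : 1 - s + 2 * s ^ 2 ≤ Real.exp (-(s - 2 * s ^ 2)) := by
    have := Real.add_one_le_exp (-(s - 2 * s ^ 2)); linarith
  rw [Real.exp_neg] at h4
  have h5 : Real.exp (s - 2 * s ^ 2) ≤ (1 - s + 2 * s ^ 2)⁻¹ := by
    rw [le_inv_comm₀ (Real.exp_pos _) h3]; exact h4
  refine h5.trans ?_
  rw [inv_le_iff_one_le_mul₀ h3]
  nlinarith [sq_nonneg s, mul_nonneg (sq_nonneg s) (by linarith : (0:ℝ) ≤ 1 + 2 * s)]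

theorem exp_le_one {s : ℝ} (h1 : -(1/2) ≤ s) (h2 : s ≤ 1/2) (F : Finset Edge) (K : Set V) :
    Ex (1/2) F (fun T => Real.exp (s * ((cA T K : ℝ) - cB F T K) - 2 * s ^ 2 * ((cA T K : ℝ) + cB F T K)))
      ≤ 1 := by
  refine le_of_le_of_eq ?_ (genfun s F K)
  refine Ex_mono (by norm_num) (by norm_num) fun T _ => ?_
  have e1 : Real.exp (s * ((cA T K : ℝ) - cB F T K) - 2 * s ^ 2 * ((cA T K : ℝ) + cB F T K))
      = Real.exp (s - 2 * s ^ 2) ^ cA T K * Real.exp ((-s) - 2 * (-s) ^ 2) ^ cB F T K := by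
    rw [← Real.exp_nat_mul, ← Real.exp_nat_mul, ← Real.exp_add]; congr 1; ring
  rw [e1]
  have k1 := exp_le_aux h1 h2
  have k2 := exp_le_aux (s := -s) (by linarith) (by linarith)
  have k3 : (0:ℝ) ≤ 1 + s := by linarith
  refine mul_le_mul (pow_le_pow_left₀ (Real.exp_pos _).le k1 _)
    (pow_le_pow_left₀ (Real.exp_pos _).le (by simpa [sub_eq_add_neg] using k2) _) ?_ ?_
  · exact pow_nonneg (Real.exp_pos _).le _
  · exact pow_nonneg k3 _

noncomputable def Rep (T : Finset Edge) (Z : Finset V) : Finset V :=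
  Z.filter (fun v => ∀ w ∈ Z, Conn T v w → Encodable.encode v ≤ Encodable.encode w)

noncomputable def RepOf (T : Finset Edge) (Z : Finset V) (z : V) : Finset V :=
  (Rep T Z).filter (fun v => Conn T v z)

theorem RepOf_card_le (T : Finset Edge) (Z : Finset V) (z : V) : (RepOf T Z z).card ≤ 1 := by
  rw [Finset.card_le_one]
  intro a ha b hb
  simp only [RepOf, Rep, Finset.mem_filter] at ha hb
  have hab : Conn T a b := ha.2.trans hb.2.symm
  exact Encodable.encode_injective
    (le_antisymm (ha.1.2 b hb.1.1 hab) (hb.1.2 a ha.1.1 hab.symm))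

theorem RepOf_nonempty {T : Finset Edge} {Z : Finset V} {z : V} (h : CK T Z z) :
    (RepOf T Z z).Nonempty := by
  obtain ⟨k, hk, c⟩ := h
  obtain ⟨v, hv, hmin⟩ := Finset.exists_min_image (Z.filter (fun v => Conn T v z))
    (fun v => Encodable.encode v) ⟨k, by simpa using ⟨hk, c⟩⟩
  rw [Finset.mem_filter] at hv
  refine ⟨v, ?_⟩
  simp only [RepOf, Rep, Finset.mem_filter]
  refine ⟨⟨hv.1, fun w hw hc => hmin w ?_⟩, hv.2⟩
  rw [Finset.mem_filter]; exact ⟨hw, hc.symm.trans hv.2⟩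

theorem touch_cl_iff {T : Finset Edge} {Z : Finset V} {e : Edge} :
    (Rep T Z).filter (fun v => touch e (cl T {v})) = RepOf T Z (src e) ∪ RepOf T Z (tgt e) := by
  ext v
  simp only [RepOf, Finset.mem_filter, Finset.mem_union, touch, cl, CK, Set.mem_ofPred_eq,
    Set.mem_singleton_iff, exists_eq_left]
  tauto

theorem RepOf_nonempty_iff {T : Finset Edge} {Z : Finset V} {z : V} :
    (RepOf T Z z).Nonempty ↔ CK T Z z := by
  refine ⟨fun ⟨v, hv⟩ => ?_, RepOf_nonempty⟩
  simp only [RepOf, Rep, Finset.mem_filter] at hv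
  exact ⟨v, hv.1.1, hv.2⟩

noncomputable def X2 (F T : Finset Edge) (Z : Finset V) : ℕ :=
  (F.filter (fun e => ¬ Conn T (src e) (tgt e) ∧ CK T Z (src e) ∧ CK T Z (tgt e))).card

theorem sumA {T : Finset Edge} {Z : Finset V} :
    ∑ v ∈ Rep T Z, cA T {v} ≤ cA T Z := by
  unfold cA
  have := Finset.sum_card_bipartiteAbove_eq_sum_card_bipartiteBelow
    (s := Rep T Z) (t := T) (fun v e => touch e (cl T {v}))
  simp only [Finset.bipartiteAbove, Finset.bipartiteBelow] at this
  rw [this, Finset.card_filter]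
  refine Finset.sum_le_sum fun e he => ?_
  rw [touch_cl_iff]
  have heq : RepOf T Z (src e) = RepOf T Z (tgt e) := by
    unfold RepOf
    refine Finset.filter_congr fun v _ => ?_
    exact ⟨fun h => h.trans (Conn.edge he), fun h => h.trans (Conn.edge he).symm⟩
  rw [← heq, Finset.union_self]
  split_ifs with h
  · exact RepOf_card_le _ _ _
  · have : ¬ (RepOf T Z (src e)).Nonempty := by
      rw [RepOf_nonempty_iff]; exact fun hc => h (Or.inl hc)
    rw [Finset.not_nonempty_iff_eq_empty] at this
    simp [this]

theorem sumB {F T : Finset Edge} {Z : Finset V} (hT : T ⊆ F) :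
    cB F T Z + X2 F T Z ≤ ∑ v ∈ Rep T Z, cB F T {v} := by
  unfold cB
  have := Finset.sum_card_bipartiteAbove_eq_sum_card_bipartiteBelow
    (s := Rep T Z) (t := F \ T) (fun v e => touch e (cl T {v}))
  simp only [Finset.bipartiteAbove, Finset.bipartiteBelow] at this
  have hX : X2 F T Z = ((F \ T).filter
      (fun e => ¬ Conn T (src e) (tgt e) ∧ CK T Z (src e) ∧ CK T Z (tgt e))).card := by
    unfold X2; congr 1; ext e
    simp only [Finset.mem_filter, Finset.mem_sdiff]
    constructor
    · rintro ⟨h1, h2⟩; exact ⟨⟨h1, fun h => h2.1 (Conn.edge h)⟩, h2⟩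
    · rintro ⟨h1, h2⟩; exact ⟨h1.1, h2⟩
  rw [this, hX, Finset.card_filter, Finset.card_filter, ← Finset.sum_add_distrib]
  refine Finset.sum_le_sum fun e he => ?_
  rw [touch_cl_iff]
  by_cases h2 : ¬ Conn T (src e) (tgt e) ∧ CK T Z (src e) ∧ CK T Z (tgt e)
  · rw [if_pos h2, if_pos (show touch e (cl T ↑Z) from Or.inl h2.2.1), Finset.card_union_of_disjoint]
    · have a := Finset.card_pos.2 (RepOf_nonempty h2.2.1)
      have b := Finset.card_pos.2 (RepOf_nonempty h2.2.2)
      omega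
    · rw [Finset.disjoint_left]
      intro v h3 h4
      simp only [RepOf, Finset.mem_filter] at h3 h4
      exact h2.1 (h3.2.symm.trans h4.2)
  · rw [if_neg h2]
    split_ifs with h
    · have : (RepOf T Z (src e) ∪ RepOf T Z (tgt e)).Nonempty := by
        rcases h with h | h
        · exact (RepOf_nonempty h).mono Finset.subset_union_left
        · exact (RepOf_nonempty h).mono Finset.subset_union_right
      exact Finset.card_pos.2 this
    · simp

theorem sumAB {F T : Finset Edge} {Z : Finset V} (hT : T ⊆ F) :
    ∑ v ∈ Rep T Z, (cA T {v} + cB F T {v}) ≤ 2 * F.card := by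
  have h1 : ∀ v : V, cA T {v} + cB F T {v} = (F.filter (fun e => touch e (cl T {v}))).card := by
    intro v; unfold cA cB
    rw [← Finset.card_union_of_disjoint
      (Finset.disjoint_filter_filter (Finset.disjoint_sdiff)), ← Finset.filter_union,
      Finset.union_sdiff_of_subset hT]
  have := Finset.sum_card_bipartiteAbove_eq_sum_card_bipartiteBelow
    (s := Rep T Z) (t := F) (fun v e => touch e (cl T {v}))
  simp only [Finset.bipartiteAbove, Finset.bipartiteBelow] at this
  simp only [h1]
  rw [this, mul_comm, ← smul_eq_mul, ← Finset.sum_const]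
  refine Finset.sum_le_sum fun e he => ?_
  rw [touch_cl_iff]
  refine (Finset.card_union_le _ _).trans ?_
  have a := RepOf_card_le T Z (src e)
  have b := RepOf_card_le T Z (tgt e)
  omega

theorem akn (F : Finset Edge) (Z : Finset V) {s : ℝ} (hs : 0 < s) (hs2 : s ≤ 1/2) :
    Ex (1/2) F (fun T => (X2 F T Z : ℝ)) ≤ Z.card / s + 6 * s * F.card := by
  let ex : Finset Edge → Set V → ℝ := fun T K =>
    Real.exp ((-s) * ((cA T K : ℝ) - cB F T K) - 2 * (-s) ^ 2 * ((cA T K : ℝ) + cB F T K))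
  let ex' : Finset Edge → Set V → ℝ := fun T K =>
    Real.exp (s * ((cA T K : ℝ) - cB F T K) - 2 * s ^ 2 * ((cA T K : ℝ) + cB F T K))
  have key : ∀ T ⊆ F, s * (X2 F T Z : ℝ) ≤ (∑ v ∈ Z, ex T {v}) + (ex' T Z + (-1 + 6 * s ^ 2 * F.card)) := by
    intro T hT
    have a1 : ((∑ v ∈ Rep T Z, cA T {v} : ℕ) : ℝ) ≤ cA T Z := by exact_mod_cast sumA
    have a2 : ((cB F T Z + X2 F T Z : ℕ) : ℝ) ≤ (∑ v ∈ Rep T Z, cB F T {v} : ℕ) := by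
      exact_mod_cast sumB hT
    have a3 : ((∑ v ∈ Rep T Z, (cA T {v} + cB F T {v}) : ℕ) : ℝ) ≤ (2 * F.card : ℕ) := by
      exact_mod_cast sumAB hT
    have a4 : ∑ v ∈ Rep T Z, ((-s) * ((cA T {v} : ℝ) - cB F T {v}) - 2 * (-s) ^ 2 * ((cA T {v} : ℝ) + cB F T {v}))
        ≤ ∑ v ∈ Z, ex T {v} := by
      refine (Finset.sum_le_sum fun v _ => ?_).trans (Finset.sum_le_sum_of_subset_of_nonneg
        (Finset.filter_subset _ _) fun v _ _ => (Real.exp_pos _).le)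
      have := Real.add_one_le_exp ((-s) * ((cA T {v} : ℝ) - cB F T {v}) - 2 * (-s) ^ 2 * ((cA T {v} : ℝ) + cB F T {v}))
      simp only [ex]
      linarith
    have a5 : s * ((cA T Z : ℝ) - cB F T Z) - 2 * s ^ 2 * ((cA T Z : ℝ) + cB F T Z) + 1 ≤ ex' T Z :=
      Real.add_one_le_exp _
    have a6 : (cA T Z : ℝ) + cB F T Z ≤ F.card := by
      have : cA T Z + cB F T Z ≤ F.card := by
        unfold cA cB
        rw [← Finset.card_union_of_disjoint
          (Finset.disjoint_filter_filter (Finset.disjoint_sdiff)), ← Finset.filter_union,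
          Finset.union_sdiff_of_subset hT]
        exact Finset.card_filter_le _ _
      exact_mod_cast this
    rw [Finset.sum_sub_distrib, ← Finset.mul_sum, ← Finset.mul_sum, Finset.sum_sub_distrib,
      Finset.sum_add_distrib] at a4
    push_cast at a1 a2 a3
    rw [Finset.sum_add_distrib] at a3
    have b1 := mul_le_mul_of_nonneg_left a3 (by positivity : 0 ≤ 2 * s ^ 2)
    have b2 := mul_le_mul_of_nonneg_left a6 (by positivity : 0 ≤ 2 * s ^ 2)
    have b3 := mul_le_mul_of_nonneg_left a1 hs.le
    have b4 := mul_le_mul_of_nonneg_left a2 hs.le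
    nlinarith
  have h2 := Ex_mono (p := 1/2) (by norm_num) (by norm_num) key
  rw [Ex_mul, Ex_add, Ex_sum, Ex_add, Ex_const] at h2
  have h3 : ∑ v ∈ Z, Ex (1/2) F (fun T => ex T {v}) ≤ Z.card := by
    rw [Finset.card_eq_sum_ones]; push_cast
    exact Finset.sum_le_sum fun v _ => exp_le_one (by linarith) (by linarith) F {v}
  have h4 : Ex (1/2) F (fun T => ex' T Z) ≤ 1 := exp_le_one (by linarith) hs2 F Z
  have h5 : s * Ex (1/2) F (fun T => (X2 F T Z : ℝ)) ≤ Z.card + 6 * s ^ 2 * F.card := by linarith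
  have h6 : (Z.card : ℝ) / s + 6 * s * F.card = (Z.card + 6 * s ^ 2 * F.card) / s := by
    field_simp
  rw [h6, le_div_iff₀ hs]; linarith

end Perc

namespace Perc
open Finset Classical

noncomputable def B (c : V) (n : ℤ) : Finset V :=
  Finset.Icc (c.1 - n) (c.1 + n) ×ˢ Finset.Icc (c.2 - n) (c.2 + n)

theorem mem_B {c v : V} {n : ℤ} : v ∈ B c n ↔
    (c.1 - n ≤ v.1 ∧ v.1 ≤ c.1 + n) ∧ (c.2 - n ≤ v.2 ∧ v.2 ≤ c.2 + n) := by simp [B]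

def far (c : V) (n : ℤ) (v : V) : Prop :=
  v.1 ≤ c.1 - n ∨ c.1 + n ≤ v.1 ∨ v.2 ≤ c.2 - n ∨ c.2 + n ≤ v.2

def reach (T : Finset Edge) (u c : V) (n : ℤ) : Prop := ∃ z, far c n z ∧ Conn T u z

theorem tgt_cases (e : Edge) : (tgt e).1 = (src e).1 + 1 ∧ (tgt e).2 = (src e).2 ∨
    (tgt e).1 = (src e).1 ∧ (tgt e).2 = (src e).2 + 1 := by
  obtain ⟨⟨x, y⟩, b⟩ := e
  cases b <;> simp [src, tgt]

theorem reach.mono {T T' : Finset Edge} (h : T ⊆ T') {u c : V} {n : ℤ} (r : reach T u c n) :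
    reach T' u c n := by
  obtain ⟨z, hz, hc⟩ := r; exact ⟨z, hz, hc.mono h⟩

theorem reach.weaken {T : Finset Edge} {u c c' : V} {n n' : ℤ} (r : reach T u c n)
    (h : ∀ z, far c n z → far c' n' z) : reach T u c' n' := by
  obtain ⟨z, hz, hc⟩ := r; exact ⟨z, h z hz, hc⟩

theorem reach.of_conn {T : Finset Edge} {u w c : V} {n : ℤ} (r : reach T u c n) (h : Conn T w u) :
    reach T w c n := by
  obtain ⟨z, hz, hc⟩ := r; exact ⟨z, hz, h.trans hc⟩

theorem hit {S : Finset V} {T : Finset Edge} {u z : V} {Zp : V → Prop}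
    (hZ : ∀ e, (src e ∈ S → tgt e ∉ S → Zp (src e)) ∧ (tgt e ∈ S → src e ∉ S → Zp (tgt e)))
    (hu : u ∈ S) (c : Conn T u z) :
    (z ∈ S ∧ Conn (T ∩ ES S) u z) ∨ ∃ z' ∈ S, Zp z' ∧ Conn (T ∩ ES S) u z' := by
  induction c with
  | refl => exact Or.inl ⟨hu, Conn.refl _ _⟩
  | @tail b d _ hb ih =>
    rcases ih with ⟨h1, h2⟩ | h
    · obtain ⟨e, he, hb'⟩ := hb
      by_cases hd : d ∈ S
      · left
        refine ⟨hd, h2.trans (Relation.ReflTransGen.single ⟨e, ?_, hb'⟩)⟩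
        rw [Finset.mem_inter, mem_ES]
        rcases hb' with ⟨rfl, rfl⟩ | ⟨rfl, rfl⟩
        · exact ⟨he, h1, hd⟩
        · exact ⟨he, hd, h1⟩
      · right
        refine ⟨b, h1, ?_, h2⟩
        rcases hb' with ⟨rfl, rfl⟩ | ⟨rfl, rfl⟩
        · exact (hZ e).1 h1 hd
        · exact (hZ e).2 h1 hd
    · exact Or.inr h

theorem far_exit (c : V) (n : ℤ) (e : Edge) :
    (src e ∈ B c n → tgt e ∉ B c n → far c n (src e)) ∧
    (tgt e ∈ B c n → src e ∉ B c n → far c n (tgt e)) := by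
  simp only [mem_B, far]
  rcases tgt_cases e with h | h <;> omega

theorem reach_hit {T : Finset Edge} {u c : V} {n : ℤ} (hu : u ∈ B c n) (r : reach T u c n) :
    ∃ z ∈ B c n, far c n z ∧ Conn (T ∩ ES (B c n)) u z := by
  obtain ⟨z, hz, hc⟩ := r
  rcases hit (far_exit c n) hu hc with h | h
  · exact ⟨z, h.1, hz, h.2⟩
  · exact h

theorem reach_inter {T : Finset Edge} {u c : V} {n : ℤ} (hu : u ∈ B c n) :
    reach (T ∩ ES (B c n)) u c n ↔ reach T u c n := by
  refine ⟨fun h => h.mono Finset.inter_subset_left, fun h => ?_⟩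
  obtain ⟨z, _, h2, h3⟩ := reach_hit hu h
  exact ⟨z, h2, h3⟩

theorem B_self {c : V} {n : ℤ} (h : 0 ≤ n) : c ∈ B c n := by rw [mem_B]; omega

theorem B_transl (c a : V) (n : ℤ) : (B c n).image (transl a).g = B (c + a) n := by
  ext v
  simp only [Finset.mem_image, mem_B]
  constructor
  · rintro ⟨w, hw, rfl⟩; simp [transl]; omega
  · intro h
    refine ⟨v - a, ?_, by simp [transl]⟩
    simp at h ⊢; omega

theorem far_transl {c a v : V} {n : ℤ} : far (c + a) n (v + a) ↔ far c n v := by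
  simp [far]; omega

theorem reach_transl {T : Finset Edge} {u c : V} {n : ℤ} (a : V) :
    reach (T.image (transl a).φ) (u + a) (c + a) n ↔ reach T u c n := by
  have hg : ∀ v, (transl a).g v = v + a := fun v => by simp [transl]
  constructor
  · rintro ⟨z, hz, hc⟩
    refine ⟨z - a, ?_, ?_⟩
    · rw [← far_transl (a := a)]; simpa using hz
    · rw [← (transl a).conn, hg, hg]; simpa using hc
  · rintro ⟨z, hz, hc⟩
    refine ⟨z + a, far_transl.2 hz, ?_⟩
    rw [← (transl a).conn, hg, hg] at hc; exact hc

noncomputable def th (p : ℝ) (n : ℤ) : ℝ := Pr p (ES (B 0 n)) (fun T => reach T 0 0 n)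

theorem Pr_congr (p : ℝ) {F : Finset Edge} {A A' : Finset Edge → Prop} (h : ∀ T ⊆ F, A T ↔ A' T) :
    Pr p F A = Pr p F A' := Ex_congr p fun T hT => ind_congr (h T hT)

theorem Pr_inter (p : ℝ) {F F' : Finset Edge} (h : F' ⊆ F) (A : Finset Edge → Prop) :
    Pr p F (fun T => A (T ∩ F')) = Pr p F' A := by
  unfold Pr; exact Ex_inter p h (fun T => ind (A T))

theorem Pr_mono_set {p : ℝ} (h0 : 0 ≤ p) (h1 : p ≤ 1) {F F' : Finset Edge} (h : F' ⊆ F)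
    {A : Finset Edge → Prop} (hA : ∀ T T', T ⊆ T' → A T → A T') : Pr p F' A ≤ Pr p F A :=
  Ex_mono_set h0 h1 h fun T T' hT => ind_mono (hA T T' hT)

theorem th_eq (p : ℝ) {n : ℤ} (hn : 0 ≤ n) (c : V) {F : Finset Edge} (hF : ES (B c n) ⊆ F) :
    Pr p F (fun T => reach T c c n) = th p n := by
  have h1 : Pr p F (fun T => reach T c c n) = Pr p (ES (B c n)) (fun T => reach T c c n) := by
    rw [← Pr_inter p hF]
    exact Pr_congr p fun T _ => (reach_inter (B_self hn)).symm
  rw [h1, th]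
  have h2 : ES (B c n) = (ES (B 0 n)).image (transl c).φ := by
    rw [Sym.ES_image, B_transl, zero_add]
  rw [h2, Sym.Pr]
  refine Pr_congr p fun T _ => ?_
  have := reach_transl (T := T) (u := 0) (c := 0) (n := n) c
  rwa [zero_add] at this

theorem th_ge {p : ℝ} (h0 : 0 ≤ p) (h1 : p ≤ 1) {n : ℤ} (hn : 0 ≤ n) (c : V) (F : Finset Edge) :
    Pr p F (fun T => reach T c c n) ≤ th p n := by
  rw [← th_eq p hn c (F := F ∪ ES (B c n)) Finset.subset_union_right]
  exact Pr_mono_set h0 h1 Finset.subset_union_left fun T T' h r => r.mono h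

theorem B_mono {c c' : V} {n n' : ℤ} (h1 : |c.1 - c'.1| + n ≤ n') (h2 : |c.2 - c'.2| + n ≤ n') :
    B c n ⊆ B c' n' := by
  intro v; rw [mem_B, mem_B]
  have := abs_le.1 (le_sub_iff_add_le.2 h1)
  have := abs_le.1 (le_sub_iff_add_le.2 h2)
  omega

theorem B_mono0 {c : V} {n n' : ℤ} (h : n ≤ n') : B c n ⊆ B c n' := B_mono (by simpa) (by simpa)

theorem th_anti {p : ℝ} (h0 : 0 ≤ p) (h1 : p ≤ 1) {n m : ℤ} (hn : 0 ≤ n) (h : n ≤ m) :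
    th p m ≤ th p n := by
  rw [← th_eq p hn 0 (F := ES (B 0 m)) (ES_mono (B_mono0 h))]
  refine Pr_mono h0 h1 fun T _ r => r.weaken fun z => ?_
  simp only [far]; omega

theorem Pr_union_le {ι : Type*} {p : ℝ} (h0 : 0 ≤ p) (h1 : p ≤ 1) (F : Finset Edge) (s : Finset ι)
    (A : ι → Finset Edge → Prop) : Pr p F (fun T => ∃ i ∈ s, A i T) ≤ ∑ i ∈ s, Pr p F (A i) := by
  unfold Pr
  rw [← Ex_sum]
  refine Ex_mono h0 h1 fun T _ => ?_
  by_cases h : ∃ i ∈ s, A i T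
  · rw [ind_true h]
    obtain ⟨i, hi, h⟩ := h
    rw [← ind_true h]
    exact Finset.single_le_sum (f := fun i => ind (A i T)) (fun i _ => ind_nonneg _) hi
  · rw [ind_false h]; exact Finset.sum_nonneg fun i _ => ind_nonneg _

theorem Pr_or_le {p : ℝ} (h0 : 0 ≤ p) (h1 : p ≤ 1) (F : Finset Edge)
    (A A' : Finset Edge → Prop) : Pr p F (fun T => A T ∨ A' T) ≤ Pr p F A + Pr p F A' := by
  unfold Pr
  rw [← Ex_add]
  refine Ex_mono h0 h1 fun T _ => ?_
  by_cases h : A T <;> by_cases h' : A' T <;> simp [ind, h, h']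

theorem Pr_forall_indep {ι : Type*} {p : ℝ} (h0 : 0 ≤ p) (h1 : p ≤ 1) {q : ℝ} (s : Finset ι)
    (G : ι → Finset Edge) (A : ι → Finset Edge → Prop)
    (hG : ∀ i ∈ s, ∀ j ∈ s, i ≠ j → Disjoint (G i) (G j))
    (hA : ∀ i ∈ s, Pr p (G i) (A i) ≤ q) (F : Finset Edge) (hF : ∀ i ∈ s, G i ⊆ F) :
    Pr p F (fun T => ∀ i ∈ s, A i (T ∩ G i)) ≤ q ^ s.card := by
  have key : Pr p (s.biUnion G) (fun T => ∀ i ∈ s, A i (T ∩ G i)) ≤ q ^ s.card := by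
    clear hF
    induction s using Finset.induction_on with
    | empty => simpa using Pr_le_one h0 h1 _ _
    | insert a s ha ih =>
      have hd : Disjoint (G a) (s.biUnion G) := by
        rw [Finset.disjoint_biUnion_right]
        intro i hi
        exact hG a (by simp) i (by simp [hi]) (fun h => ha (h ▸ hi))
      have e1 : Pr p ((insert a s).biUnion G) (fun T => ∀ i ∈ insert a s, A i (T ∩ G i)) =
          Pr p (G a) (A a) * Pr p (s.biUnion G) (fun T => ∀ i ∈ s, A i (T ∩ G i)) := by
        unfold Pr
        rw [← Ex_indep p hd, Finset.biUnion_insert]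
        refine Ex_congr p fun T _ => ?_
        rw [← ind_and]
        refine ind_congr ?_
        simp only [Finset.forall_mem_insert]
        refine and_congr Iff.rfl (forall₂_congr fun i hi => ?_)
        rw [Finset.inter_assoc, Finset.inter_eq_right.2 (Finset.subset_biUnion_of_mem G hi)]
      rw [e1, Finset.card_insert_of_notMem ha, pow_succ, mul_comm]
      refine mul_le_mul (ih (fun i hi j hj => hG i (by simp [hi]) j (by simp [hj]))
        fun i hi => hA i (by simp [hi])) (hA a (by simp)) (Pr_nonneg h0 h1 _ _) ?_
      exact pow_nonneg ((Pr_nonneg h0 h1 _ _).trans (hA a (by simp))) _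
  have hs : s.biUnion G ⊆ F := Finset.biUnion_subset.2 hF
  rw [← Pr_inter p hs] at key
  refine le_trans (le_of_eq ?_) key
  refine Pr_congr p fun T _ => forall₂_congr fun i hi => ?_
  rw [Finset.inter_assoc, Finset.inter_eq_right.2 (Finset.subset_biUnion_of_mem G hi)]

end Perc

namespace Perc
open Finset Classical

theorem Pr_and_not (p : ℝ) (F : Finset Edge) (A A' : Finset Edge → Prop) (h : ∀ T ⊆ F, A' T → A T) :
    Pr p F (fun T => A T ∧ ¬ A' T) = Pr p F A - Pr p F A' := by
  unfold Pr
  rw [← Ex_sub]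
  refine Ex_congr p fun T hT => ?_
  have := h T hT
  by_cases h1 : A T <;> by_cases h2 : A' T <;> simp_all [ind]

theorem half0 : (0:ℝ) ≤ 1/2 := by norm_num
theorem half1 : (1/2:ℝ) ≤ 1 := by norm_num

theorem whp {t : ℝ} (ht : 0 < t) (hlow : ∀ n, 0 ≤ n → t ≤ th (1/2) n)
    (happ : ∀ ε > 0, ∃ m, 0 ≤ m ∧ th (1/2) m ≤ t + ε) {ε : ℝ} (hε : 0 < ε) :
    ∃ k : ℤ, 0 ≤ k ∧ ∀ N, k ≤ N →
      Pr (1/2) (ES (B 0 N)) (fun T => ¬ ∃ u ∈ B 0 k, reach T u 0 N) ≤ ε := by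
  have ht1 : t ≤ 1 := (hlow 0 le_rfl).trans (Pr_le_one half0 half1 _ _)
  obtain ⟨J, hJ⟩ := exists_pow_lt_of_lt_one (half_pos hε) (by linarith : 1 - t < 1)
  obtain ⟨m, hm, hm2⟩ := happ (ε / (2 * (J + 1))) (by positivity)
  refine ⟨J * (2 * m + 1), by positivity, fun N hN => ?_⟩
  let x : ℕ → V := fun i => (i * (2 * m + 1), 0)
  have hx : ∀ i ∈ range J, 0 ≤ (x i).1 ∧ (x i).1 + (2 * m + 1) ≤ J * (2 * m + 1) := by
    intro i hi
    have hi' : (i : ℤ) + 1 ≤ J := by have := Finset.mem_range.1 hi; omega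
    refine ⟨by positivity, ?_⟩
    simp only [x]; nlinarith
  have hxB : ∀ i ∈ range J, B (x i) m ⊆ B 0 N := by
    intro i hi v
    have := hx i hi
    have h2 : (x i).2 = 0 := rfl
    rw [mem_B, mem_B, h2]; simp only [Prod.fst_zero, Prod.snd_zero]; omega
  have hdis : ∀ i ∈ range J, ∀ j ∈ range J, i ≠ j → Disjoint (ES (B (x i) m)) (ES (B (x j) m)) := by
    intro i _ j _ hij
    rw [Finset.disjoint_left]
    intro e h1 h2
    have h1 := (mem_B.1 (mem_ES.1 h1).1).1
    have h2 := (mem_B.1 (mem_ES.1 h2).1).1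
    simp only [x] at h1 h2
    rcases lt_or_gt_of_ne hij with h | h
    · have h : (i:ℤ) + 1 ≤ j := by omega
      nlinarith
    · have h : (j:ℤ) + 1 ≤ i := by omega
      nlinarith
  have s1 : Pr (1/2) (ES (B 0 N)) (fun T => ∀ i ∈ range J, ¬ reach (T ∩ ES (B (x i) m)) (x i) (x i) m)
      ≤ (1 - t) ^ J := by
    have := Pr_forall_indep half0 half1 (q := 1 - t) (range J) (fun i => ES (B (x i) m))
      (fun i T => ¬ reach T (x i) (x i) m) hdis (fun i hi => ?_) (ES (B 0 N))
      (fun i hi => ES_mono (hxB i hi))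
    · simpa using this
    · rw [Pr_not, th_eq _ hm _ (Finset.Subset.refl _)]; linarith [hlow m hm]
  have s2 : ∀ i ∈ range J, Pr (1/2) (ES (B 0 N)) (fun T => reach T (x i) (x i) m ∧ ¬ reach T (x i) 0 N)
      ≤ ε / (2 * (J + 1)) := by
    intro i hi
    have hxi := hx i hi
    have h2 : (x i).2 = 0 := rfl
    rw [Pr_and_not, th_eq _ hm _ (ES_mono (hxB i hi))]
    · have hNpos : 0 ≤ N := le_trans (by positivity) hN
      have e1 : Pr (1/2) (ES (B 0 N)) (fun T => reach T (x i) 0 N) =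
          Pr (1/2) (ES (B 0 N) ∪ ES (B (x i) (2 * N))) (fun T => reach T (x i) 0 N) := by
        rw [← Pr_inter (1/2) (F := ES (B 0 N) ∪ ES (B (x i) (2 * N))) Finset.subset_union_left]
        refine Pr_congr _ fun T _ => reach_inter ?_
        exact hxB i hi (B_self hm)
      have e2 : t ≤ Pr (1/2) (ES (B 0 N) ∪ ES (B (x i) (2 * N))) (fun T => reach T (x i) 0 N) := by
        refine (hlow (2 * N) (by omega)).trans ?_
        rw [← th_eq (1/2) (n := 2 * N) (by omega) (x i) (F := ES (B 0 N) ∪ ES (B (x i) (2 * N)))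
          Finset.subset_union_right]
        refine Pr_mono half0 half1 fun T _ r => r.weaken fun z => ?_
        simp only [far, h2, Prod.fst_zero, Prod.snd_zero]; omega
      rw [e1]; linarith
    · intro T _ r
      refine r.weaken fun z => ?_
      simp only [far, h2, Prod.fst_zero, Prod.snd_zero]; omega
  have s3 : Pr (1/2) (ES (B 0 N)) (fun T => ¬ ∃ u ∈ B 0 (J * (2 * m + 1)), reach T u 0 N) ≤
      Pr (1/2) (ES (B 0 N)) (fun T => (∀ i ∈ range J, ¬ reach (T ∩ ES (B (x i) m)) (x i) (x i) m) ∨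
        ∃ i ∈ range J, (reach T (x i) (x i) m ∧ ¬ reach T (x i) 0 N)) := by
    refine Pr_mono half0 half1 fun T _ h => ?_
    by_contra hc
    push Not at hc
    obtain ⟨⟨i, hi, hr⟩, h2⟩ := hc
    refine h ⟨x i, ?_, h2 i hi (hr.mono Finset.inter_subset_left)⟩
    have := hx i hi
    have h2 : (x i).2 = 0 := rfl
    rw [mem_B, h2]; simp only [Prod.fst_zero, Prod.snd_zero]; omega
  refine s3.trans ((Pr_or_le half0 half1 _ _ _).trans ?_)
  have s4 := (Pr_union_le half0 half1 (ES (B 0 N)) (range J)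
    (fun i T => reach T (x i) (x i) m ∧ ¬ reach T (x i) 0 N)).trans (Finset.sum_le_sum s2)
  rw [Finset.sum_const, Finset.card_range, nsmul_eq_mul] at s4
  have s5 : (J:ℝ) * (ε / (2 * (J + 1))) ≤ ε / 2 := by
    have : (J:ℝ) * (ε / (2 * (J + 1))) = (J / (J + 1)) * (ε / 2) := by field_simp
    rw [this]
    have : (J:ℝ) / (J + 1) ≤ 1 := by rw [div_le_one (by positivity)]; linarith
    nlinarith
  linarith

/-- arm to one side -/
def side (k : ℤ) (P : V → Prop) (T : Finset Edge) : Prop := ∃ u ∈ B 0 k, ∃ z, P z ∧ Conn T u z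

theorem side_mono {k : ℤ} {P : V → Prop} {T T' : Finset Edge} (h : T ⊆ T') (s : side k P T) :
    side k P T' := by
  obtain ⟨u, hu, z, hz, c⟩ := s; exact ⟨u, hu, z, hz, c.mono h⟩

theorem side_sym (s : Sym) (hs : ∀ n, (B 0 n).image s.g = B 0 n) (k N : ℤ) (P : V → Prop) :
    Pr (1/2) (ES (B 0 N)) (fun T => ¬ side k P T) =
      Pr (1/2) (ES (B 0 N)) (fun T => ¬ side k (fun z => P (s.g z)) T) := by
  conv_lhs => rw [← hs N, ← s.ES_image, s.Pr]
  refine Pr_congr _ fun T _ => not_congr ?_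
  have hm : ∀ u, s.g u ∈ B 0 k ↔ u ∈ B 0 k := by
    intro u; conv_lhs => rw [← hs k]
    simp
  constructor
  · rintro ⟨u, hu, z, hz, c⟩
    refine ⟨s.g.symm u, by rw [← hm]; simpa, s.g.symm z, by simpa, ?_⟩
    rw [← s.conn]; simpa using c
  · rintro ⟨u, hu, z, hz, c⟩
    exact ⟨s.g u, (hm u).2 hu, s.g z, hz, (s.conn _ _ _).2 c⟩

theorem image_eq_of {s : Sym} {S : Finset V} (h : ∀ v, v ∈ S → s.g v ∈ S) : S.image s.g = S := by
  refine Finset.eq_of_subset_of_card_le (fun v hv => ?_) ?_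
  · obtain ⟨w, hw, rfl⟩ := Finset.mem_image.1 hv; exact h w hw
  · rw [Finset.card_image_of_injective _ s.g.injective]

theorem reflx_B (n : ℤ) : (B 0 n).image reflx.g = B 0 n := image_eq_of fun v hv => by
  rw [mem_B] at *; simp [reflx] at *; omega
theorem transp_B (n : ℤ) : (B 0 n).image transp.g = B 0 n := image_eq_of fun v hv => by
  rw [mem_B] at *; simp [transp] at *; omega

theorem sides {k N : ℤ} {δ : ℝ} (hδ : 0 ≤ δ)
    (h : Pr (1/2) (ES (B 0 N)) (fun T => ¬ ∃ u ∈ B 0 k, reach T u 0 N) ≤ δ ^ 4) :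
    Pr (1/2) (ES (B 0 N)) (fun T => ¬ side k (fun z => z.1 ≤ -N) T) ≤ δ ∧
    Pr (1/2) (ES (B 0 N)) (fun T => ¬ side k (fun z => N ≤ z.1) T) ≤ δ := by
  set a := Pr (1/2) (ES (B 0 N)) (fun T => ¬ side k (fun z => z.1 ≤ -N) T) with ha
  have h2 : Pr (1/2) (ES (B 0 N)) (fun T => ¬ side k (fun z => N ≤ z.1) T) = a := by
    rw [side_sym reflx reflx_B, ha]
    congr! 5 with T z
    simp [reflx]; omega
  have h3 : Pr (1/2) (ES (B 0 N)) (fun T => ¬ side k (fun z => z.2 ≤ -N) T) = a := by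
    rw [side_sym transp transp_B, ha]; rfl
  have h4 : Pr (1/2) (ES (B 0 N)) (fun T => ¬ side k (fun z => N ≤ z.2) T) = a := by
    rw [side_sym transp transp_B, ← h2]; rfl
  have anti : ∀ P, Antitone (fun T => ind (¬ side k P T)) := fun P T T' hT =>
    ind_mono fun h h' => h (side_mono hT h')
  have a0 : 0 ≤ a := Pr_nonneg half0 half1 _ _
  suffices hh : a ^ 4 ≤ δ ^ 4 by
    have := le_of_pow_le_pow_left₀ (by norm_num) hδ hh
    exact ⟨this, h2 ▸ this⟩
  refine le_trans ?_ h
  have i1 : a * a ≤ Ex (1/2) (ES (B 0 N)) (fun T => ind (¬ side k (fun z => z.1 ≤ -N) T) *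
      ind (¬ side k (fun z => N ≤ z.1) T)) := by
    conv_lhs => rw [← h2]
    rw [h2]; nth_rewrite 2 [← h2]
    exact Ex_harris half0 half1 _ (anti _) (anti _)
  have i2 : a * a ≤ Ex (1/2) (ES (B 0 N)) (fun T => ind (¬ side k (fun z => z.2 ≤ -N) T) *
      ind (¬ side k (fun z => N ≤ z.2) T)) := by
    nth_rewrite 2 [← h4]; rw [← h3]
    exact Ex_harris half0 half1 _ (anti _) (anti _)
  have anti2 : ∀ P Q, Antitone (fun T => ind (¬ side k P T) * ind (¬ side k Q T)) := fun P Q T T' hT =>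
    mul_le_mul (anti P hT) (anti Q hT) (ind_nonneg _) (ind_nonneg _)
  have i3 := Ex_harris half0 half1 (ES (B 0 N)) (anti2 (fun z => z.1 ≤ -N) (fun z => N ≤ z.1))
    (anti2 (fun z => z.2 ≤ -N) (fun z => N ≤ z.2))
  have i4 : a ^ 4 = (a * a) * (a * a) := by ring
  rw [i4]
  refine (mul_le_mul i1 i2 (mul_nonneg a0 a0) ((mul_nonneg a0 a0).trans i1)).trans (i3.trans ?_)
  refine Ex_mono half0 half1 fun T _ => ?_
  rw [← ind_and, ← ind_and, ← ind_and]
  refine ind_mono ?_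
  rintro ⟨⟨n1, n2⟩, n3, n4⟩ ⟨u, hu, z, hz, c⟩
  simp only [far, Prod.fst_zero, Prod.snd_zero, zero_add, zero_sub] at hz
  rcases hz with hz | hz | hz | hz
  · exact n1 ⟨u, hu, z, hz, c⟩
  · exact n2 ⟨u, hu, z, hz, c⟩
  · exact n3 ⟨u, hu, z, hz, c⟩
  · exact n4 ⟨u, hu, z, hz, c⟩

end Perc

namespace Perc
open Finset Classical

theorem box_h {c : V} {n y x : ℤ} (h1 : (x, y) ∈ B c n) {x' : ℤ} (hx : x ≤ x') :
    (x', y) ∈ B c n → Conn (ES (B c n)) (x, y) (x', y) := by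
  induction x', hx using Int.leInduction with
  | base => exact fun _ => Conn.refl _ _
  | succ m hm ih =>
    intro h
    have h2 : (m, y) ∈ B c n := by rw [mem_B] at *; simp at *; omega
    refine (ih h2).trans (Conn.edge (e := ((m, y), false)) ?_)
    rw [mem_ES]; exact ⟨h2, h⟩

theorem box_v {c : V} {n y x : ℤ} (h1 : (x, y) ∈ B c n) {y' : ℤ} (hx : y ≤ y') :
    (x, y') ∈ B c n → Conn (ES (B c n)) (x, y) (x, y') := by
  induction y', hx using Int.leInduction with
  | base => exact fun _ => Conn.refl _ _
  | succ m hm ih =>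
    intro h
    have h2 : (x, m) ∈ B c n := by rw [mem_B] at *; simp at *; omega
    refine (ih h2).trans (Conn.edge (e := ((x, m), true)) ?_)
    rw [mem_ES]; exact ⟨h2, h⟩

theorem box_conn {c : V} {n : ℤ} {u w : V} (hu : u ∈ B c n) (hw : w ∈ B c n) :
    Conn (ES (B c n)) u w := by
  obtain ⟨x, y⟩ := u
  obtain ⟨x', y'⟩ := w
  have hm : (x', y) ∈ B c n := by rw [mem_B] at *; simp at *; omega
  have s1 : Conn (ES (B c n)) (x, y) (x', y) := by
    rcases le_total x x' with h | h
    · exact box_h hu h hm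
    · exact (box_h hm h hu).symm
  refine s1.trans ?_
  rcases le_total y y' with h | h
  · exact box_v hm h hw
  · exact (box_v hw h hm).symm

def Two (k N : ℤ) (T : Finset Edge) : Prop :=
  ∃ u ∈ B 0 k, ∃ w ∈ B 0 k, ¬ Conn T u w ∧ reach T u 0 N ∧ reach T w 0 N

theorem conn_mem {S : Finset V} {T : Finset Edge} (hT : T ⊆ ES S) {u z : V} (hu : u ∈ S)
    (c : Conn T u z) : z ∈ S := by
  induction c with
  | refl => exact hu
  | tail _ hb _ =>
    obtain ⟨e, he, hb⟩ := hb
    have := mem_ES.1 (hT he)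
    rcases hb with ⟨rfl, rfl⟩ | ⟨rfl, rfl⟩
    · exact this.2
    · exact this.1

theorem Pr_anti_set {p : ℝ} (h0 : 0 ≤ p) (h1 : p ≤ 1) {F F' : Finset Edge} (h : F' ⊆ F)
    {A : Finset Edge → Prop} (hA : ∀ T T', T ⊆ T' → A T → A T') :
    Pr p F (fun T => ¬ A T) ≤ Pr p F' (fun T => ¬ A T) := by
  rw [Pr_not, Pr_not]; linarith [Pr_mono_set h0 h1 h hA]

theorem two_arms {k N : ℤ} (hk : 0 ≤ k) (hN : k + 1 ≤ N)
    (h1 : Pr (1/2) (ES (B 0 N)) (fun T => ¬ side k (fun z => z.1 ≤ -N) T) ≤ 1/8)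
    (h2 : Pr (1/2) (ES (B 0 N)) (fun T => ¬ side k (fun z => N ≤ z.1) T) ≤ 1/8) :
    1/4 ≤ Pr (1/2) (ES (B 0 N)) (Two (k + 1) N) := by
  let a : V := (1, 0)
  let R : Finset Edge → Prop := fun T => ∃ u ∈ B a k, ∃ z : V, N + 1 ≤ z.1 ∧ Conn T u z
  have hR : ∀ T, R (T.image (transl a).φ) ↔ side k (fun z => N ≤ z.1) T := by
    intro T
    have hg : ∀ v, (transl a).g v = v + a := fun v => by simp [transl]
    have hB : ∀ v, v ∈ B a k ↔ v - a ∈ B 0 k := by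
      intro v; rw [mem_B, mem_B]; simp [a]; omega
    constructor
    · rintro ⟨u, hu, z, hz, c⟩
      refine ⟨u - a, (hB u).1 hu, z - a, by simp [a]; omega, ?_⟩
      rw [← (transl a).conn, hg, hg]; simpa using c
    · rintro ⟨u, hu, z, hz, c⟩
      refine ⟨u + a, (hB _).2 (by simpa using hu), z + a, by simp [a]; omega, ?_⟩
      rw [← (transl a).conn, hg, hg] at c; exact c
  have sub1 : ES (B 0 N) ⊆ ES (DD N) := ES_mono fun v => by
    rw [mem_B, mem_DD]; simp only [Prod.fst_zero, Prod.snd_zero]; omega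
  have sub2 : ES (B a N) ⊆ ES (DD N) := ES_mono fun v => by
    rw [mem_B, mem_DD]; simp only [a]; omega
  have h1' : Pr (1/2) (ES (DD N)) (fun T => ¬ side k (fun z => z.1 ≤ -N) T) ≤ 1/8 :=
    (Pr_anti_set half0 half1 sub1 fun T T' => side_mono).trans h1
  have h2' : Pr (1/2) (ES (DD N)) (fun T => ¬ R T) ≤ 1/8 := by
    refine (Pr_anti_set half0 half1 sub2 ?_).trans ?_
    · rintro T T' h ⟨u, hu, z, hz, c⟩; exact ⟨u, hu, z, hz, c.mono h⟩
    · have : ES (B a N) = (ES (B 0 N)).image (transl a).φ := by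
        rw [Sym.ES_image, B_transl, zero_add]
      rw [this, Sym.Pr]
      refine le_trans (le_of_eq ?_) h2
      exact Pr_congr _ fun T _ => not_congr (hR T)
  have h3 := cross_le_half (N := N) (by omega)
  have h4 : 1 ≤ Pr (1/2) (ES (DD N)) (fun T => Two (k + 1) N (T ∩ ES (B 0 N)) ∨
      (¬ side k (fun z => z.1 ≤ -N) T ∨ (¬ R T ∨ cross N T))) := by
    have h1eq : (1:ℝ) = Pr (1/2) (ES (DD N)) (fun _ => True) := by
      symm
      have : (fun _ : Finset Edge => ind True) = fun _ => (1:ℝ) := by funext; exact ind_true trivial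
      unfold Pr; rw [this, Ex_const]
    refine h1eq.le.trans (Pr_mono half0 half1 fun T hT _ => ?_)
    by_contra hc
    push Not at hc
    obtain ⟨hc1, ⟨u, hu, z, hz, c⟩, ⟨w, hw, z', hz', c'⟩, hcr⟩ := hc
    have huB : u ∈ B 0 (k + 1) := B_mono0 (by omega) hu
    have hwB : w ∈ B 0 (k + 1) := by rw [mem_B] at *; simp [a] at *; omega
    have huN : u ∈ B 0 N := B_mono0 (by omega) huB
    have hwN : w ∈ B 0 N := B_mono0 (by omega) hwB
    have huD : u ∈ DD N := by rw [mem_B] at huN; rw [mem_DD]; simp at huN; omega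
    have hwD : w ∈ DD N := by rw [mem_B] at hwN; rw [mem_DD]; simp at hwN; omega
    have hzD := conn_mem hT huD c
    have hzD' := conn_mem hT hwD c'
    refine hc1 ⟨u, huB, w, hwB, fun hcon => hcr ?_, ?_, ?_⟩
    · refine ⟨z, z', hzD, hzD', ?_, ?_, c.symm.trans ((hcon.mono Finset.inter_subset_left).trans c')⟩
      · rw [mem_DD] at hzD; omega
      · rw [mem_DD] at hzD'; omega
    · rw [reach_inter huN]; exact ⟨z, by simp only [far, Prod.fst_zero, Prod.snd_zero]; omega, c⟩
    · rw [reach_inter hwN]; exact ⟨z', by simp only [far, Prod.fst_zero, Prod.snd_zero]; omega, c'⟩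
  have h5 := Pr_or_le half0 half1 (ES (DD N)) (fun T => Two (k + 1) N (T ∩ ES (B 0 N)))
    (fun T => (¬ side k (fun z => z.1 ≤ -N) T ∨ (¬ R T ∨ cross N T)))
  have h6 := Pr_or_le half0 half1 (ES (DD N)) (fun T => ¬ side k (fun z => z.1 ≤ -N) T)
    (fun T => (¬ R T ∨ cross N T))
  have h7 := Pr_or_le half0 half1 (ES (DD N)) (fun T => ¬ R T) (cross N)
  rw [Pr_inter _ sub1] at h5
  linarith

theorem Ex_union_le {F U : Finset Edge} (hU : U ⊆ F) {f : Finset Edge → ℝ} (hf : ∀ T, 0 ≤ f T) :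
    Ex (1/2) F (fun T => f (T ∪ U)) ≤ 2 ^ U.card * Ex (1/2) F f := by
  induction U using Finset.induction_on generalizing f with
  | empty => simp
  | insert e U he ih =>
    have heF : e ∈ F := hU (Finset.mem_insert_self _ _)
    have h1 := ih (fun x hx => hU (Finset.mem_insert_of_mem hx)) (f := fun T => f (insert e T))
      (fun T => hf _)
    have h2 : Ex (1/2) F (fun T => f (insert e T)) ≤ 2 * Ex (1/2) F f := by
      have hne : e ∉ F.erase e := by simp
      rw [← Finset.insert_erase heF, Ex_insert _ hne, Ex_insert _ hne]
      have : 0 ≤ Ex (1/2) (F.erase e) f := Ex_nonneg half0 half1 fun T _ => hf T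
      simp only [Finset.insert_idem]
      linarith
    rw [Finset.card_insert_of_notMem he, pow_succ]
    simp only [Finset.union_insert]
    refine h1.trans ?_
    rw [mul_assoc]
    exact mul_le_mul_of_nonneg_left h2 (by positivity)

def Piv (c : V) (k : ℤ) (c' : V) (N : ℤ) (T : Finset Edge) : Prop :=
  ∃ e ∈ ES (B c k), ¬ Conn T (src e) (tgt e) ∧ reach T (src e) c' N ∧ reach T (tgt e) c' N

theorem piv_bound {k N : ℤ} (hkN : k ≤ N) (h : 1/4 ≤ Pr (1/2) (ES (B 0 N)) (Two k N)) :
    1 / 4 / 4 ^ (ES (B 0 k)).card ≤ Pr (1/2) (ES (B 0 N)) (Piv 0 k 0 N) := by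
  set E := ES (B 0 k) with hE
  have hEF : E ⊆ ES (B 0 N) := ES_mono (B_mono0 hkN)
  have h1 : Pr (1/2) (ES (B 0 N)) (Two k N) ≤
      Pr (1/2) (ES (B 0 N)) (fun T => ∃ U ∈ E.powerset, Piv 0 k 0 N (T ∪ U)) := by
    refine Pr_mono half0 half1 fun T _ => ?_
    rintro ⟨u, hu, w, hw, hn, hru, hrw⟩
    obtain ⟨U, hU, e, he, hn', -, hc⟩ := exists_pivot (E := E) hn
      ((box_conn hu hw).mono Finset.subset_union_right)
    refine ⟨U, Finset.mem_powerset.2 hU, e, he, ?_⟩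
    have hru' := hru.mono (Finset.subset_union_left (s₂ := U))
    have hrw' := hrw.mono (Finset.subset_union_left (s₂ := U))
    rcases hc with ⟨c1, c2⟩ | ⟨c1, c2⟩
    · exact ⟨fun hh => hn' (c1.trans (hh.trans c2)), hru'.of_conn c1.symm, hrw'.of_conn c2⟩
    · exact ⟨fun hh => hn' (c1.trans (hh.symm.trans c2)), hrw'.of_conn c2, hru'.of_conn c1.symm⟩
  have h2 := (h.trans h1).trans (Pr_union_le half0 half1 (ES (B 0 N)) E.powerset
    (fun U T => Piv 0 k 0 N (T ∪ U)))
  have h3 : ∀ U ∈ E.powerset, Pr (1/2) (ES (B 0 N)) (fun T => Piv 0 k 0 N (T ∪ U)) ≤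
      2 ^ E.card * Pr (1/2) (ES (B 0 N)) (Piv 0 k 0 N) := by
    intro U hU
    have hU := Finset.mem_powerset.1 hU
    refine (Ex_union_le (hU.trans hEF) (f := fun T => ind (Piv 0 k 0 N T)) fun T => ind_nonneg _).trans ?_
    refine mul_le_mul_of_nonneg_right ?_ (Pr_nonneg half0 half1 _ _)
    exact pow_le_pow_right₀ (by norm_num) (Finset.card_le_card hU)
  have h4 := h2.trans (Finset.sum_le_sum h3)
  rw [Finset.sum_const, Finset.card_powerset, nsmul_eq_mul] at h4
  rw [div_le_iff₀ (by positivity)]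
  refine h4.trans (le_of_eq ?_)
  have : (4:ℝ) ^ E.card = 2 ^ E.card * 2 ^ E.card := by rw [← mul_pow]; norm_num
  rw [this]; push_cast; ring

end Perc

namespace Perc
open Finset Classical

theorem card_B (c : V) {n : ℤ} (hn : 0 ≤ n) : ((B c n).card : ℝ) = (2 * n + 1) ^ 2 := by
  have h : ((c.1 + n + 1 - (c.1 - n)).toNat : ℤ) = 2 * n + 1 := by omega
  have h' : ((c.2 + n + 1 - (c.2 - n)).toNat : ℤ) = 2 * n + 1 := by omega
  unfold B
  rw [Finset.card_product, Int.card_Icc, Int.card_Icc]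
  push_cast
  have e1 : ((c.1 + n + 1 - (c.1 - n)).toNat : ℝ) = 2 * n + 1 := by exact_mod_cast h
  have e2 : ((c.2 + n + 1 - (c.2 - n)).toNat : ℝ) = 2 * n + 1 := by exact_mod_cast h'
  rw [e1, e2]; ring

noncomputable def bdy (n : ℤ) : Finset V := (B 0 n).filter (far 0 n)

theorem card_bdy {n : ℤ} (hn : 0 ≤ n) : ((bdy n).card : ℝ) ≤ 4 * (2 * n + 1) := by
  let I := Finset.Icc (-n) n
  have hsub : bdy n ⊆ ((({-n} : Finset ℤ) ×ˢ I) ∪ (({n} : Finset ℤ) ×ˢ I)) ∪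
      ((I ×ˢ ({-n} : Finset ℤ)) ∪ (I ×ˢ ({n} : Finset ℤ))) := by
    intro v hv
    rw [bdy, Finset.mem_filter, mem_B] at hv
    simp only [far, Prod.fst_zero, Prod.snd_zero] at hv
    simp only [Finset.mem_union, Finset.mem_product, Finset.mem_singleton, I, Finset.mem_Icc]
    omega
  have hI : (I.card : ℤ) = 2 * n + 1 := by simp only [I, Int.card_Icc]; omega
  have h1 : (bdy n).card ≤ (I.card + I.card) + (I.card + I.card) := by
    refine (Finset.card_le_card hsub).trans ((Finset.card_union_le _ _).trans
      (add_le_add ((Finset.card_union_le _ _).trans ?_) ((Finset.card_union_le _ _).trans ?_))) <;> simp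
  have h2 : ((bdy n).card : ℤ) ≤ 4 * (2 * n + 1) := by omega
  exact_mod_cast h2

theorem piv_transl {v : V} {k N : ℤ} {T : Finset Edge} (h : Piv 0 k 0 N T) :
    Piv v k v N (T.image (transl v).φ) := by
  have hg : ∀ w, (transl v).g w = w + v := fun v => by simp [transl]
  have hr : ∀ w, reach T w 0 N → reach (T.image (transl v).φ) ((transl v).g w) v N := by
    intro w hw
    have := (reach_transl v).2 hw
    rwa [zero_add, ← hg] at this
  obtain ⟨e, he, h1, h2, h3⟩ := h
  have hes : (transl v).φ e ∈ ES (B v k) := by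
    have : ES (B v k) = (ES (B 0 k)).image (transl v).φ := by
      rw [Sym.ES_image, B_transl, zero_add]
    rw [this]; exact Finset.mem_image_of_mem _ he
  refine ⟨(transl v).φ e, hes, ?_⟩
  rcases (transl v).h e with ⟨a, b⟩ | ⟨a, b⟩
  · rw [a, b, (transl v).conn]; exact ⟨h1, hr _ h2, hr _ h3⟩
  · rw [a, b, (transl v).conn]; exact ⟨fun h => h1 h.symm, hr _ h3, hr _ h2⟩

theorem piv_at {k n : ℤ} {c0 : ℝ} (hk : 0 ≤ k) (hkn : k ≤ n) {v : V} (hv : v ∈ B 0 n)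
    (h : c0 ≤ Pr (1/2) (ES (B 0 (3 * n))) (Piv 0 k 0 (3 * n))) :
    c0 ≤ Pr (1/2) (ES (B 0 (2 * n))) (Piv v k 0 (2 * n)) := by
  have e1 : ES (B v (3 * n)) = (ES (B 0 (3 * n))).image (transl v).φ := by
    rw [Sym.ES_image, B_transl, zero_add]
  have h1 : c0 ≤ Pr (1/2) (ES (B v (3 * n))) (Piv v k v (3 * n)) := by
    rw [e1, Sym.Pr]
    exact h.trans (Pr_mono half0 half1 fun T _ => piv_transl)
  rw [mem_B] at hv
  simp only [Prod.fst_zero, Prod.snd_zero] at hv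
  have hsub : ES (B 0 (2 * n)) ⊆ ES (B v (3 * n)) := ES_mono fun w => by
    rw [mem_B, mem_B]; simp only [Prod.fst_zero, Prod.snd_zero]; omega
  rw [← Pr_inter _ hsub]
  refine h1.trans (Pr_mono half0 half1 fun T _ => ?_)
  rintro ⟨e, he, a, b, c⟩
  have hin : ∀ w, w ∈ B v k → w ∈ B 0 (2 * n) := fun w => by
    rw [mem_B, mem_B]; simp only [Prod.fst_zero, Prod.snd_zero]; omega
  have hf : ∀ z, far v (3 * n) z → far 0 (2 * n) z := by
    intro z; simp only [far, Prod.fst_zero, Prod.snd_zero]; omega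
  have hes := mem_ES.1 he
  refine ⟨e, he, fun h => a (h.mono Finset.inter_subset_left), ?_, ?_⟩
  · rw [reach_inter (hin _ hes.1)]; exact b.weaken hf
  · rw [reach_inter (hin _ hes.2)]; exact c.weaken hf

theorem piv_sum {k n : ℤ} {c0 s : ℝ} (hk : 0 ≤ k) (hkn : k ≤ n) (hs : 0 < s) (hs2 : s ≤ 1/2)
    (h : c0 ≤ Pr (1/2) (ES (B 0 (3 * n))) (Piv 0 k 0 (3 * n))) :
    (2 * n + 1) ^ 2 * c0 ≤ (2 * k + 1) ^ 2 * (4 * (4 * n + 1) / s + 12 * s * (4 * n + 1) ^ 2) := by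
  set F := ES (B 0 (2 * n)) with hF
  have h1 : (2 * n + 1) ^ 2 * c0 ≤ ∑ v ∈ B 0 n, Pr (1/2) F (Piv v k 0 (2 * n)) := by
    rw [← card_B 0 (hk.trans hkn), ← nsmul_eq_mul, ← Finset.sum_const]
    exact Finset.sum_le_sum fun v hv => piv_at hk hkn hv h
  have h2 : ∑ v ∈ B 0 n, Pr (1/2) F (Piv v k 0 (2 * n)) ≤
      (2 * k + 1) ^ 2 * Ex (1/2) F (fun T => (X2 F T (bdy (2 * n)) : ℝ)) := by
    unfold Pr
    rw [← Ex_sum, ← Ex_mul]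
    refine Ex_mono half0 half1 fun T hT => ?_
    let X := F.filter (fun e => ¬ Conn T (src e) (tgt e) ∧ CK T (bdy (2 * n)) (src e) ∧
      CK T (bdy (2 * n)) (tgt e))
    have hsubB : ∀ v ∈ B 0 n, B v k ⊆ B 0 (2 * n) := fun v hv w hw => by
      rw [mem_B] at *; simp only [Prod.fst_zero, Prod.snd_zero] at *; omega
    have k1 : ∀ v ∈ B 0 n, ind (Piv v k 0 (2 * n) T) ≤
        ((X.filter (fun e => e ∈ ES (B v k))).card : ℝ) := by
      intro v hv
      by_cases hp : Piv v k 0 (2 * n) T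
      · rw [ind_true hp]
        have : 0 < (X.filter (fun e => e ∈ ES (B v k))).card := by
          rw [Finset.card_pos]
          obtain ⟨e, he, a, b, c⟩ := hp
          have hTe : T ∩ F = T := Finset.inter_eq_left.2 hT
          have hes := mem_ES.1 he
          have hck : ∀ w, w ∈ B v k → reach T w 0 (2 * n) → CK T (bdy (2 * n)) w := by
            intro w hw hr
            obtain ⟨z, z1, z2, z3⟩ := reach_hit (hsubB v hv hw) hr
            refine ⟨z, by simp only [bdy, Finset.coe_filter]; exact ⟨z1, z2⟩, ?_⟩
            exact (z3.mono Finset.inter_subset_left).symm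
          refine ⟨e, ?_⟩
          simp only [X, Finset.mem_filter]
          exact ⟨⟨ES_mono (hsubB v hv) he, a, hck _ hes.1 b, hck _ hes.2 c⟩, he⟩
        exact_mod_cast this
      · rw [ind_false hp]; positivity
    refine (Finset.sum_le_sum k1).trans ?_
    have := Finset.sum_card_bipartiteAbove_eq_sum_card_bipartiteBelow
      (s := B 0 n) (t := X) (fun v e => e ∈ ES (B v k))
    simp only [Finset.bipartiteAbove, Finset.bipartiteBelow] at this
    rw [← Nat.cast_sum, this, Nat.cast_sum]
    have k2 : ∀ e ∈ X, (((B 0 n).filter (fun v => e ∈ ES (B v k))).card : ℝ) ≤ (2 * k + 1) ^ 2 := by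
      intro e _
      rw [← card_B (src e) hk]
      norm_cast
      refine Finset.card_le_card fun v hv => ?_
      have := mem_B.1 (mem_ES.1 (Finset.mem_filter.1 hv).2).1
      rw [mem_B]; omega
    refine (Finset.sum_le_sum k2).trans (le_of_eq ?_)
    rw [Finset.sum_const, nsmul_eq_mul, mul_comm]; rfl
  refine h1.trans (h2.trans ?_)
  refine mul_le_mul_of_nonneg_left ?_ (by positivity)
  refine (akn F (bdy (2 * n)) hs hs2).trans ?_
  have hn : 0 ≤ 2 * n := by omega
  have k3 := card_bdy hn
  have k4 : (F.card : ℝ) ≤ 2 * (4 * n + 1) ^ 2 := by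
    have : (F.card : ℝ) ≤ 2 * (B 0 (2 * n)).card := by exact_mod_cast card_ES_le _
    rw [card_B 0 hn] at this
    push_cast at this
    refine this.trans (le_of_eq (by ring))
  push_cast at k3
  refine add_le_add ?_ ?_
  · exact div_le_div_of_nonneg_right (by linarith) hs.le
  · nlinarith

theorem theta_half {ε : ℝ} (hε : 0 < ε) : ∃ n, 0 ≤ n ∧ th (1/2) n ≤ ε := by
  by_contra hcon
  push Not at hcon
  let f : ℕ → ℝ := fun n => th (1/2) n
  have hbdd : BddBelow (Set.range f) := ⟨0, by rintro _ ⟨n, rfl⟩; exact Pr_nonneg half0 half1 _ _⟩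
  set t := ⨅ n, f n with ht
  have ht0 : 0 < t := lt_of_lt_of_le hε (le_ciInf fun n => (hcon n (by positivity)).le)
  have hlow : ∀ n, 0 ≤ n → t ≤ th (1/2) n := by
    intro n hn
    lift n to ℕ using hn
    exact ciInf_le hbdd n
  have happ : ∀ ε > 0, ∃ m, 0 ≤ m ∧ th (1/2) m ≤ t + ε := by
    intro ε hε
    obtain ⟨n, hn⟩ := exists_lt_of_ciInf_lt (show ⨅ n, f n < t + ε by rw [← ht]; linarith)
    exact ⟨n, by positivity, hn.le⟩
  obtain ⟨k, hk, hw⟩ := whp ht0 hlow happ (ε := (1/8) ^ 4) (by norm_num)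
  have hp : ∀ N, k + 1 ≤ N → 1 / 4 / 4 ^ (ES (B 0 (k + 1))).card ≤
      Pr (1/2) (ES (B 0 N)) (Piv 0 (k + 1) 0 N) := by
    intro N hN
    obtain ⟨s1, s2⟩ := sides (by norm_num) (hw N (by omega))
    exact piv_bound hN (two_arms hk hN s1 s2)
  set c0 : ℝ := 1 / 4 / 4 ^ (ES (B 0 (k + 1))).card with hc0
  have hc0p : 0 < c0 := by positivity
  set D : ℝ := (2 * ((k + 1 : ℤ) : ℝ) + 1) ^ 2 with hD
  have hDp : 0 < D := by
    have : (0:ℝ) ≤ ((k + 1 : ℤ) : ℝ) := by exact_mod_cast (by omega : (0:ℤ) ≤ k + 1)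
    positivity
  set s : ℝ := min (1/2) (c0 / (300 * D)) with hs
  have hsp : 0 < s := lt_min (by norm_num) (by positivity)
  have hs1 : s ≤ 1/2 := min_le_left _ _
  have hs2 : D * (300 * s) ≤ c0 := by
    have : s ≤ c0 / (300 * D) := min_le_right _ _
    rw [le_div_iff₀ (by positivity)] at this; linarith
  obtain ⟨M, hM⟩ := exists_nat_gt (20 * D / s / (3 * c0))
  set n : ℤ := max (k + 1) (max M 1) with hn
  have hnk : k + 1 ≤ n := le_max_left _ _
  have hn1 : 1 ≤ n := (le_max_right _ _).trans (le_max_right _ _)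
  have hnM : (M:ℤ) ≤ n := (le_max_left _ _).trans (le_max_right _ _)
  have hn1' : (1:ℝ) ≤ n := by exact_mod_cast hn1
  have hnM' : (M:ℝ) ≤ n := by exact_mod_cast hnM
  have key := piv_sum (k := k + 1) (n := n) (by omega) hnk hsp hs1 (hp (3 * n) (by omega))
  rw [← hD] at key
  have k1 : 4 * (4 * (n:ℝ) + 1) / s ≤ 20 * n / s :=
    div_le_div_of_nonneg_right (by linarith) hsp.le
  have k2 : 12 * s * (4 * (n:ℝ) + 1) ^ 2 ≤ 300 * s * n ^ 2 := by
    have : (4 * (n:ℝ) + 1) ^ 2 ≤ 25 * n ^ 2 := by nlinarith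
    nlinarith
  have k3 : 4 * (n:ℝ) ^ 2 * c0 ≤ D * (20 * n / s) + c0 * n ^ 2 := by
    have a1 : 4 * (n:ℝ) ^ 2 * c0 ≤ (2 * n + 1) ^ 2 * c0 := by
      refine mul_le_mul_of_nonneg_right ?_ hc0p.le; nlinarith
    have a2 := mul_le_mul_of_nonneg_left (add_le_add k1 k2) hDp.le
    have a3 := mul_le_mul_of_nonneg_right hs2 (sq_nonneg (n:ℝ))
    nlinarith
  have k4 : 20 * D / s / (3 * c0) < n := hM.trans_le hnM'
  rw [div_lt_iff₀ (by positivity)] at k4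
  have k5 : D * (20 * n / s) = (20 * D / s) * n := by ring
  rw [k5] at k3
  nlinarith

end Perc

namespace Perc
open Finset Classical

theorem Ex_mono_p {p q : ℝ} (h0 : 0 ≤ p) (hpq : p ≤ q) (h1 : q ≤ 1) (F : Finset Edge)
    {f : Finset Edge → ℝ} (hf : Monotone f) : Ex p F f ≤ Ex q F f := by
  induction F using Finset.induction_on generalizing f with
  | empty => simp [Ex_empty]
  | insert a F ha ih =>
    rw [Ex_insert _ ha, Ex_insert _ ha]
    have hm : Monotone (fun T => f (insert a T)) := fun T T' h => hf (Finset.insert_subset_insert _ h)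
    have i1 := ih hm
    have i2 := ih hf
    have i3 : Ex q F f ≤ Ex q F (fun T => f (insert a T)) :=
      Ex_mono (h0.trans hpq) h1 fun T _ => hf (Finset.subset_insert _ _)
    nlinarith

theorem Pr_mono_p {p q : ℝ} (h0 : 0 ≤ p) (hpq : p ≤ q) (h1 : q ≤ 1) (F : Finset Edge)
    {A : Finset Edge → Prop} (hA : ∀ T T', T ⊆ T' → A T → A T') : Pr p F A ≤ Pr q F A :=
  Ex_mono_p h0 hpq h1 F fun T T' h => ind_mono (hA T T' h)

def prevE (e : Edge) : Edge := match e with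
  | ((x, y), true) => ((x, y - 1), true)
  | ((x, y), false) => ((x - 1, y), false)

noncomputable def nbE (S : Finset V) : Finset Edge :=
  (S ×ˢ (Finset.univ : Finset Bool)) ∪ (S ×ˢ (Finset.univ : Finset Bool)).image prevE

theorem mem_nbE {S : Finset V} {e : Edge} : e ∈ nbE S ↔ src e ∈ S ∨ tgt e ∈ S := by
  obtain ⟨⟨x, y⟩, b⟩ := e
  simp only [nbE, Finset.mem_union, Finset.mem_product, Finset.mem_univ, and_true, Finset.mem_image]
  refine or_congr Iff.rfl ⟨?_, fun h => ?_⟩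
  · rintro ⟨⟨⟨x', y'⟩, b'⟩, h, he⟩
    cases b' <;> simp only [prevE, Prod.mk.injEq] at he <;> obtain ⟨⟨rfl, rfl⟩, rfl⟩ := he <;>
      simpa [tgt] using h
  · cases b
    · exact ⟨((x + 1, y), false), h, by simp [prevE]⟩
    · exact ⟨((x, y + 1), true), h, by simp [prevE]⟩

noncomputable def DS (S : Finset V) : Finset Edge :=
  (nbE S).filter (fun e => ¬ (src e ∈ S ∧ tgt e ∈ S))

theorem mem_DS {S : Finset V} {e : Edge} : e ∈ DS S ↔
    (src e ∈ S ∧ tgt e ∉ S) ∨ (src e ∉ S ∧ tgt e ∈ S) := by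
  rw [DS, Finset.mem_filter, mem_nbE]; tauto

noncomputable def inn (S : Finset V) (e : Edge) : V := if src e ∈ S then src e else tgt e
noncomputable def out (S : Finset V) (e : Edge) : V := if src e ∈ S then tgt e else src e

noncomputable def phi (p : ℝ) (S : Finset V) : ℝ :=
  p * ∑ e ∈ DS S, Pr p (ES S) (fun T => Conn T 0 (inn S e))

theorem conn_up {u v : V} : ∀ T T' : Finset Edge, T ⊆ T' → Conn T u v → Conn T' u v :=
  fun _ _ h c => c.mono h

theorem phi_mono {p q : ℝ} (h0 : 0 ≤ p) (hpq : p ≤ q) (h1 : q ≤ 1) (S : Finset V) :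
    phi p S ≤ phi q S :=
  mul_le_mul hpq (Finset.sum_le_sum fun e _ => Pr_mono_p h0 hpq h1 _ conn_up)
    (Finset.sum_nonneg fun e _ => Pr_nonneg h0 (hpq.trans h1) _ _) (h0.trans hpq)

theorem CK_insert2 {T : Finset Edge} {K : Set V} {e e' : Edge} (he : touch e K) (z : V) :
    CK (insert e' (insert e T)) K z ↔ CK (insert e' T) (K ∪ {src e, tgt e}) z := by
  rw [Finset.insert_comm]; exact CK_insert he z

theorem dct_explore {p : ℝ} (h0 : 0 ≤ p) (h1 : p ≤ 1)
    (hphi : ∀ S : Finset V, 0 ∈ S → 1 ≤ phi p S) (n : ℤ) (F : Finset Edge) (K : Set V) :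
    {z | far 0 n z} ⊆ K → (∀ e ∈ ES (B 0 n), ¬ touch e K → e ∈ F) →
    Pr p F (fun T => ¬ CK T K 0) ≤
      Ex p F (fun T => ∑ e ∈ ES (B 0 n), ind (¬ CK T K 0 ∧ CK (insert e T) K 0)) := by
  refine explore (P := fun F K => {z | far 0 n z} ⊆ K → (∀ e ∈ ES (B 0 n), ¬ touch e K → e ∈ F) →
    Pr p F (fun T => ¬ CK T K 0) ≤
      Ex p F (fun T => ∑ e ∈ ES (B 0 n), ind (¬ CK T K 0 ∧ CK (insert e T) K 0))) ?_ ?_ F K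
  · intro F K hb hK hF
    by_cases h0K : (0 : V) ∈ K
    · have : Pr p F (fun T => ¬ CK T K 0) = 0 := by
        unfold Pr
        rw [Ex_congr (g := fun _ => 0), Ex_const]
        intro T _; rw [ind_false]; exact not_not.2 ⟨0, h0K, Conn.refl _ _⟩
      rw [this]
      exact Ex_nonneg h0 h1 fun T _ => Finset.sum_nonneg fun e _ => ind_nonneg _
    · let S := (B 0 n).filter (fun v => v ∉ K)
      have hnfar : ∀ v, v ∉ K → ¬ far 0 n v := fun v hv hf => hv (hK hf)
      have hS : ∀ v, v ∈ S ↔ v ∉ K := by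
        intro v
        simp only [S, Finset.mem_filter, and_iff_right_iff_imp]
        intro hv
        have := hnfar v hv
        rw [mem_B]; simp only [far, Prod.fst_zero, Prod.snd_zero] at *; omega
      have h0S : (0:V) ∈ S := (hS 0).2 h0K
      have hES : ES S ⊆ F := by
        intro e he
        rw [mem_ES] at he
        refine hF e (mem_ES.2 ⟨(Finset.mem_filter.1 he.1).1, (Finset.mem_filter.1 he.2).1⟩) ?_
        rintro (h | h)
        · exact (hS _).1 he.1 h
        · exact (hS _).1 he.2 h
      have hDS : DS S ⊆ ES (B 0 n) := by
        intro e he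
        rw [mem_DS, hS, hS] at he
        rw [mem_ES, mem_B, mem_B]
        have t := tgt_cases e
        have a1 := hnfar (src e)
        have a2 := hnfar (tgt e)
        simp only [far, Prod.fst_zero, Prod.snd_zero] at *
        rcases he with ⟨b, _⟩ | ⟨_, b⟩
        · have := a1 b; omega
        · have := a2 b; omega
      have hsum : 1 ≤ ∑ e ∈ DS S, Pr p (ES S) (fun T => Conn T 0 (inn S e)) := by
        have := hphi S h0S
        unfold phi at this
        have hn : 0 ≤ ∑ e ∈ DS S, Pr p (ES S) (fun T => Conn T 0 (inn S e)) :=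
          Finset.sum_nonneg fun e _ => Pr_nonneg h0 h1 _ _
        nlinarith
      refine (Pr_le_one h0 h1 _ _).trans (hsum.trans ?_)
      refine (Finset.sum_le_sum fun e _ => Pr_mono_set h0 h1 hES conn_up).trans ?_
      unfold Pr
      rw [← Ex_sum]
      refine Ex_mono h0 h1 fun T hT => ?_
      refine le_trans ?_ (Finset.sum_le_sum_of_subset_of_nonneg hDS fun e _ _ => ind_nonneg _)
      refine Finset.sum_le_sum fun e he => ind_mono fun hc => ⟨fun h => h0K ?_, ?_⟩
      · exact CK_base (fun e he => hb e (hT he)) h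
      · rw [mem_DS, hS, hS] at he
        have hcon : Conn (insert e T) (src e) (tgt e) := Conn.edge (Finset.mem_insert_self _ _)
        have hc' := (hc.mono (Finset.subset_insert e T)).symm
        rcases he with ⟨b1, b2⟩ | ⟨b1, b2⟩
        · rw [inn, if_pos ((hS _).2 b1)] at hc'
          exact ⟨tgt e, not_not.1 b2, hcon.symm.trans hc'⟩
        · rw [inn, if_neg (fun h => (hS _).1 h (not_not.1 b1))] at hc'
          exact ⟨src e, not_not.1 b1, hcon.trans hc'⟩
  · intro F K e heF ht ih1 ih2 hK hF
    have ih1 := ih1 (hK.trans Set.subset_union_left) (fun e' he' hn => by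
      have hn' : ¬ touch e' K := fun h => hn (touch_mono Set.subset_union_left h)
      have := hF e' he' hn'
      rcases Finset.mem_insert.1 this with rfl | h
      · exact absurd ht hn'
      · exact h)
    have ih2 := ih2 hK (fun e' he' hn' => by
      have := hF e' he' hn'
      rcases Finset.mem_insert.1 this with rfl | h
      · exact absurd ht hn'
      · exact h)
    unfold Pr at *
    rw [Ex_insert _ heF, Ex_insert _ heF]
    simp only [CK_insert ht, CK_insert2 ht]
    exact add_le_add (mul_le_mul_of_nonneg_left ih1 h0) (mul_le_mul_of_nonneg_left ih2 (by linarith))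

theorem reach_iff_CK {T : Finset Edge} {n : ℤ} : reach T 0 0 n ↔ CK T {z | far 0 n z} 0 :=
  ⟨fun ⟨z, hz, c⟩ => ⟨z, hz, c.symm⟩, fun ⟨z, hz, c⟩ => ⟨z, hz, c.symm⟩⟩

theorem exists_phi_lt {p : ℝ} (h0 : 0 ≤ p) (hp : p < 1/2) : ∃ S : Finset V, 0 ∈ S ∧ phi p S < 1 := by
  by_contra hcon
  push Not at hcon
  obtain ⟨n, hn, hth⟩ := theta_half (ε := min (1/2) ((1/2 - p) / 4)) (lt_min (by norm_num) (by linarith))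
  have hth1 := hth.trans (min_le_left _ _)
  have hth2 := hth.trans (min_le_right _ _)
  set f : Finset Edge → ℝ := fun T => ind (reach T 0 0 n) with hf
  have hd : ∀ q, HasDerivAt (fun q => th q n) (Ex q (ES (B 0 n)) (fun T => ∑ e ∈ ES (B 0 n),
      (f (insert e T) - f (T.erase e)))) q := fun q => Ex_hasDeriv _ f q
  obtain ⟨q, hq, hs⟩ := exists_hasDerivAt_eq_slope (fun q => th q n) _ hp
    (fun q _ => (hd q).continuousAt.continuousWithinAt) (fun q _ => hd q)
  have q0 : 0 ≤ q := h0.trans hq.1.le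
  have q1 : q ≤ 1 := hq.2.le.trans half1
  have hge : 1/2 ≤ Ex q (ES (B 0 n)) (fun T => ∑ e ∈ ES (B 0 n),
      (f (insert e T) - f (T.erase e))) := by
    have a1 := dct_explore q0 q1 (fun S hS => (hcon S hS).trans (phi_mono h0 hq.1.le q1 S)) n
      (ES (B 0 n)) {z | far 0 n z} subset_rfl (fun e he _ => he)
    rw [Pr_not] at a1
    have a2 : Pr q (ES (B 0 n)) (fun T => CK T {z | far 0 n z} 0) = th q n :=
      Pr_congr _ fun T _ => reach_iff_CK.symm
    have a3 : th q n ≤ th (1/2) n := Pr_mono_p q0 hq.2.le half1 _ fun T T' h r => r.mono h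
    rw [a2] at a1
    refine le_trans (by linarith) (a1.trans (Ex_mono q0 q1 fun T _ => Finset.sum_le_sum fun e _ => ?_))
    by_cases hh : ¬ CK T {z | far 0 n z} 0 ∧ CK (insert e T) {z | far 0 n z} 0
    · have b1 : f (insert e T) = 1 := ind_true (reach_iff_CK.2 hh.2)
      have b2 : f (T.erase e) = 0 := ind_false fun h => hh.1
        (reach_iff_CK.1 (h.mono (Finset.erase_subset _ _)))
      rw [b1, b2, ind_true hh]; norm_num
    · rw [ind_false hh, sub_nonneg]
      exact ind_mono fun h => h.mono ((Finset.erase_subset _ _).trans (Finset.subset_insert _ _))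
  rw [hs, le_div_iff₀ (by linarith)] at hge
  have : 0 ≤ th p n := Pr_nonneg h0 (by linarith) _ _
  linarith

theorem last_exit {T : Finset Edge} {K : Set V} {k z : V} (hk : k ∈ K) (hz : z ∉ K) (c : Conn T k z) :
    ∃ e ∈ T, (src e ∈ K ∧ tgt e ∉ K ∧ Conn (T.filter (fun e => ¬ touch e K)) (tgt e) z) ∨
      (tgt e ∈ K ∧ src e ∉ K ∧ Conn (T.filter (fun e => ¬ touch e K)) (src e) z) := by
  have key : (k ∉ K ∧ Conn (T.filter (fun e => ¬ touch e K)) k z) ∨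
    ∃ e ∈ T, (src e ∈ K ∧ tgt e ∉ K ∧ Conn (T.filter (fun e => ¬ touch e K)) (tgt e) z) ∨
      (tgt e ∈ K ∧ src e ∉ K ∧ Conn (T.filter (fun e => ¬ touch e K)) (src e) z) := by
    clear hk
    induction c using Relation.ReflTransGen.head_induction_on with
    | refl => exact Or.inl ⟨hz, Conn.refl _ _⟩
    | @head a b hab _ ih =>
      rcases ih with ⟨hb, hc⟩ | h
      · obtain ⟨e, he, hab⟩ := hab
        by_cases ha : a ∈ K
        · right
          refine ⟨e, he, ?_⟩
          rcases hab with ⟨rfl, rfl⟩ | ⟨rfl, rfl⟩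
          · exact Or.inl ⟨ha, hb, hc⟩
          · exact Or.inr ⟨ha, hb, hc⟩
        · left
          refine ⟨ha, Relation.ReflTransGen.head ⟨e, ?_, hab⟩ hc⟩
          rw [Finset.mem_filter]
          refine ⟨he, ?_⟩
          rcases hab with ⟨rfl, rfl⟩ | ⟨rfl, rfl⟩ <;> rintro (h | h) <;> contradiction
      · exact Or.inr h
  rcases key with h | h
  · exact absurd hk h.1
  · exact h

theorem Pr_edge_and {p : ℝ} (h0 : 0 ≤ p) (h1 : p ≤ 1) {F G : Finset Edge} {e : Edge} (hG : G ⊆ F)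
    (he : e ∉ G) (A : Finset Edge → Prop) :
    Pr p F (fun T => e ∈ T ∧ A (T ∩ G)) ≤ p * Pr p G A := by
  by_cases heF : e ∈ F
  · have hne : e ∉ F.erase e := by simp
    have hG' : G ⊆ F.erase e := fun x hx => Finset.mem_erase.2 ⟨fun h => he (h ▸ hx), hG hx⟩
    unfold Pr
    conv_lhs => rw [← Finset.insert_erase heF]
    rw [Ex_insert _ hne]
    have e1 : Ex p (F.erase e) (fun T => ind (e ∈ insert e T ∧ A (insert e T ∩ G))) =
        Ex p G (fun T => ind (A T)) := by
      rw [← Ex_inter p hG']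
      refine Ex_congr p fun T _ => ind_congr ?_
      rw [Finset.insert_inter_of_notMem he]; simp
    have e2 : Ex p (F.erase e) (fun T => ind (e ∈ T ∧ A (T ∩ G))) = 0 := by
      rw [Ex_congr (g := fun _ => 0), Ex_const]
      intro T hT
      rw [ind_false]; exact fun h => hne (hT h.1)
    rw [e1, e2]; linarith
  · have e2 : Pr p F (fun T => e ∈ T ∧ A (T ∩ G)) = 0 := by
      unfold Pr
      rw [Ex_congr (g := fun _ => 0), Ex_const]
      intro T hT
      rw [ind_false]; exact fun h => heF (hT h.1)
    rw [e2]; exact mul_nonneg h0 (Pr_nonneg h0 h1 _ _)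

theorem decay_explore {p M : ℝ} (h0 : 0 ≤ p) (h1 : p ≤ 1) (hM0 : 0 ≤ M) (S : Finset V) (Z : Set V)
    (hZ : ∀ z ∈ Z, z ∉ S)
    (hM : ∀ e ∈ DS S, ∀ F', Pr p F' (fun T => ∃ z ∈ Z, Conn T (out S e) z) ≤ M)
    (F2 : Finset Edge) (hF2 : Disjoint F2 (ES S)) (F1 : Finset Edge) (K : Set V) :
    F1 ⊆ ES S → K ⊆ S → Pr p (F1 ∪ F2) (fun T => ∃ z ∈ Z, CK T K z) ≤
      ∑ e ∈ DS S, Pr p F1 (fun T => CK T K (inn S e)) * (p * M) := by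
  refine explore (P := fun F1 K => F1 ⊆ ES S → K ⊆ S →
    Pr p (F1 ∪ F2) (fun T => ∃ z ∈ Z, CK T K z) ≤
      ∑ e ∈ DS S, Pr p F1 (fun T => CK T K (inn S e)) * (p * M)) ?_ ?_ F1 K
  · intro F1 K hb hF1 hK
    set G := (F1 ∪ F2).filter (fun e => ¬ touch e K) with hG
    have s1 : Pr p (F1 ∪ F2) (fun T => ∃ z ∈ Z, CK T K z) ≤
        Pr p (F1 ∪ F2) (fun T => ∃ e ∈ (DS S).filter (fun e => inn S e ∈ K),
          (e ∈ T ∧ ∃ z ∈ Z, Conn (T ∩ G) (out S e) z)) := by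
      refine Pr_mono h0 h1 fun T hT => ?_
      rintro ⟨z, hz, k, hk, c⟩
      have hzK : z ∉ K := fun h => hZ z hz (hK h)
      obtain ⟨e, he, hc⟩ := last_exit hk hzK c
      have hTG : T.filter (fun e => ¬ touch e K) ⊆ T ∩ G := by
        intro x hx
        rw [Finset.mem_filter] at hx
        rw [Finset.mem_inter, hG, Finset.mem_filter]
        exact ⟨hx.1, hT hx.1, hx.2⟩
      have hte : touch e K := by rcases hc with h | h; exacts [Or.inl h.1, Or.inr h.1]
      have heS : e ∉ ES S := by
        rcases Finset.mem_union.1 (hT he) with h | h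
        · exact absurd hte (hb e h)
        · exact Finset.disjoint_left.1 hF2 h
      rw [mem_ES] at heS
      rcases hc with ⟨c1, c2, c3⟩ | ⟨c1, c2, c3⟩
      · have i1 : src e ∈ S := hK c1
        have i2 : tgt e ∉ S := fun h => heS ⟨i1, h⟩
        refine ⟨e, ?_, he, z, hz, ?_⟩
        · rw [Finset.mem_filter, mem_DS, inn, if_pos i1]; exact ⟨Or.inl ⟨i1, i2⟩, c1⟩
        · rw [out, if_pos i1]; exact c3.mono hTG
      · have i1 : tgt e ∈ S := hK c1
        have i2 : src e ∉ S := fun h => heS ⟨h, i1⟩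
        refine ⟨e, ?_, he, z, hz, ?_⟩
        · rw [Finset.mem_filter, mem_DS, inn, if_neg i2]; exact ⟨Or.inr ⟨i2, i1⟩, c1⟩
        · rw [out, if_neg i2]; exact c3.mono hTG
    refine s1.trans ((Pr_union_le h0 h1 _ _ _).trans ?_)
    refine le_trans (Finset.sum_le_sum (g := fun e => Pr p F1 (fun T => CK T K (inn S e)) * (p * M))
      fun e he => ?_) (Finset.sum_le_sum_of_subset_of_nonneg (Finset.filter_subset _ _)
        fun e _ _ => mul_nonneg (Pr_nonneg h0 h1 _ _) (mul_nonneg h0 hM0))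
    rw [Finset.mem_filter] at he
    have hone : Pr p F1 (fun T => CK T K (inn S e)) = 1 := by
      unfold Pr
      rw [Ex_congr (g := fun _ => 1), Ex_const]
      intro T _
      exact ind_true ⟨_, he.2, Conn.refl _ _⟩
    rw [hone, one_mul]
    have heG : e ∉ G := by
      rw [hG, Finset.mem_filter]
      rintro ⟨_, h⟩
      apply h
      have := he.2
      unfold inn at this
      split_ifs at this
      · exact Or.inl this
      · exact Or.inr this
    refine (Pr_edge_and h0 h1 (Finset.filter_subset _ _) heG
      (fun T => ∃ z ∈ Z, Conn T (out S e) z)).trans ?_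
    exact mul_le_mul_of_nonneg_left (hM e he.1 _) h0
  · intro F1 K e heF ht ih1 ih2 hF1 hK
    have heS : e ∈ ES S := hF1 (Finset.mem_insert_self _ _)
    have hF1' : F1 ⊆ ES S := (Finset.subset_insert _ _).trans hF1
    have ih1 := ih1 hF1' (Set.union_subset hK (by
      rintro x (rfl | rfl)
      · exact (mem_ES.1 heS).1
      · exact (mem_ES.1 heS).2))
    have ih2 := ih2 hF1' hK
    have heU : e ∉ F1 ∪ F2 := by
      rw [Finset.mem_union]; rintro (h | h)
      · exact heF h
      · exact Finset.disjoint_left.1 hF2 h heS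
    unfold Pr at *
    rw [Finset.insert_union, Ex_insert _ heU]
    simp only [Ex_insert _ heF, CK_insert ht]
    refine (add_le_add (mul_le_mul_of_nonneg_left ih1 h0)
      (mul_le_mul_of_nonneg_left ih2 (by linarith : 0 ≤ 1 - p))).trans (le_of_eq ?_)
    rw [Finset.mul_sum, Finset.mul_sum, ← Finset.sum_add_distrib]
    exact Finset.sum_congr rfl fun e _ => by ring

theorem decay {p : ℝ} (h0 : 0 ≤ p) (hp : p < 1/2) :
    ∃ c : ℝ, 0 ≤ c ∧ c < 1 ∧ ∃ L : ℤ, 1 ≤ L ∧ ∀ j : ℕ, th p (j * L) ≤ c ^ j := by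
  have h1 : p ≤ 1 := by linarith
  obtain ⟨S, h0S, hphi⟩ := exists_phi_lt h0 hp
  have hphi0 : 0 ≤ phi p S := mul_nonneg h0 (Finset.sum_nonneg fun e _ => Pr_nonneg h0 h1 _ _)
  obtain ⟨L, hL0, hL⟩ : ∃ L : ℤ, 0 ≤ L ∧ ∀ v ∈ S, v ∈ B 0 L := by
    refine ⟨∑ v ∈ S, (|v.1| + |v.2|), Finset.sum_nonneg fun v _ => by positivity, fun v hv => ?_⟩
    have := Finset.single_le_sum (f := fun v : V => |v.1| + |v.2|) (fun v _ => by positivity) hv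
    have a1 := abs_nonneg v.1
    have a2 := abs_nonneg v.2
    have a3 := neg_abs_le v.1
    have a4 := neg_abs_le v.2
    have a5 := le_abs_self v.1
    have a6 := le_abs_self v.2
    rw [mem_B]; simp only [Prod.fst_zero, Prod.snd_zero] at *; omega
  refine ⟨phi p S, hphi0, hphi, L + 1, by omega, fun j => ?_⟩
  induction j with
  | zero => rw [pow_zero]; exact Pr_le_one h0 h1 _ _
  | succ j ih =>
    set N : ℤ := ((j + 1 : ℕ) : ℤ) * (L + 1) with hN
    have hNj : N = j * (L + 1) + (L + 1) := by rw [hN]; push_cast; ring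
    have hjL : 0 ≤ (j:ℤ) * (L + 1) := by positivity
    generalize (j:ℤ) * (L + 1) = m at *
    have hF : ES (B 0 N) = (ES S) ∪ (ES (B 0 N) \ ES S) := by
      rw [Finset.union_sdiff_of_subset]
      exact ES_mono fun v hv => B_mono0 (by omega) (hL v hv)
    have key := decay_explore h0 h1 (pow_nonneg hphi0 j) S {z | far 0 N z} (fun z hz hS => by
        have := hL z hS
        rw [mem_B] at this
        simp only [Set.mem_ofPred_eq, far, Prod.fst_zero, Prod.snd_zero] at *
        omega) (fun e he F' => by
        refine le_trans ?_ ((th_ge h0 h1 hjL (out S e) F').trans ih)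
        refine Pr_mono h0 h1 fun T _ => ?_
        rintro ⟨z, hz, c⟩
        refine ⟨z, ?_, c⟩
        have ht := tgt_cases e
        rw [mem_DS] at he
        have hs : (out S e) ∈ B 0 (L + 1) := by
          rcases he with ⟨b1, b2⟩ | ⟨b1, b2⟩
          · have := hL _ b1
            rw [out, if_pos b1]; rw [mem_B] at *; omega
          · have := hL _ b2
            rw [out, if_neg b1]; rw [mem_B] at *; omega
        rw [mem_B] at hs
        simp only [Set.mem_ofPred_eq, far, Prod.fst_zero, Prod.snd_zero] at *
        omega)
      (ES (B 0 N) \ ES S) Finset.sdiff_disjoint (ES S) {0} (Finset.Subset.refl _)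
      (by simpa using h0S)
    rw [← hF] at key
    have e1 : th p N = Pr p (ES (B 0 N)) (fun T => ∃ z ∈ {z | far 0 N z}, CK T {0} z) := by
      refine Pr_congr _ fun T _ => ?_
      constructor
      · rintro ⟨z, hz, c⟩; exact ⟨z, hz, 0, rfl, c⟩
      · rintro ⟨z, hz, k, rfl, c⟩; exact ⟨z, hz, c⟩
    rw [e1]
    refine key.trans (le_of_eq ?_)
    rw [← Finset.sum_mul, pow_succ, phi]
    have e2 : ∀ e, Pr p (ES S) (fun T => CK T {0} (inn S e)) = Pr p (ES S) (fun T => Conn T 0 (inn S e)) := by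
      intro e
      refine Pr_congr _ fun T _ => ?_
      constructor
      · rintro ⟨k, rfl, c⟩; exact c
      · intro c; exact ⟨0, rfl, c⟩
    simp only [e2]; ring

end Perc

namespace PercM
open MeasureTheory ProbabilityTheory DaC Measure

instance : IsProbabilityMeasure base := ⟨by simp [base]⟩

theorem boolOf_true {P : Prop} : boolOf P = true ↔ P := by simp [boolOf]
theorem boolOf_false {P : Prop} : boolOf P = false ↔ ¬ P := by simp [boolOf]

theorem bit_double (n : ℕ) (x : ℝ) : bit (n+1) x = bit n (2 * x) := by
  unfold bit
  congr 4
  ring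

theorem bit_sub_one (n : ℕ) (x : ℝ) : bit n (x - 1) = bit n x := by
  unfold bit
  have : (x - 1) * 2 ^ (n+1) = x * 2 ^ (n+1) - ((2 * 2 ^ n : ℤ) : ℝ) := by push_cast; ring
  rw [this, Int.floor_sub_intCast]
  congr 2
  rw [Int.sub_mul_emod_self_left]

theorem measurable_bit (n : ℕ) : Measurable (bit n) := by
  apply measurable_to_bool
  have : bit n ⁻¹' {true} = (fun x : ℝ => ⌊x * 2 ^ (n + 1)⌋) ⁻¹' {z | z % 2 = 1} := by
    ext x; simp [bit, boolOf]
  rw [this]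
  exact (Int.measurable_floor.comp (measurable_id.mul_const _)) (MeasurableSet.of_discrete)

noncomputable def fair : Measure Bool := (2⁻¹ : ENNReal) • Measure.count

theorem bit0_lo {x : ℝ} (h0 : 0 < x) (h1 : x < 1/2) : bit 0 x = false := by
  unfold bit; rw [boolOf_false]
  have : ⌊x * 2 ^ (0+1)⌋ = 0 := by rw [Int.floor_eq_iff]; constructor <;> norm_num <;> linarith
  rw [this]; norm_num

theorem bit0_hi {x : ℝ} (h0 : 1/2 < x) (h1 : x < 1) : bit 0 x = true := by
  unfold bit; rw [boolOf_true]
  have : ⌊x * 2 ^ (0+1)⌋ = 1 := by rw [Int.floor_eq_iff]; constructor <;> norm_num <;> linarith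
  rw [this]; norm_num

theorem base_apply (S : Set ℝ) (hS : MeasurableSet S) : base S = volume (S ∩ Set.Ioo 0 1) := by
  rw [base, ← Measure.restrict_congr_set Ioo_ae_eq_Ioc, Measure.restrict_apply hS]

open Classical in
theorem fair_apply (t : Set Bool) :
    fair t = (if false ∈ t then (2⁻¹ : ENNReal) else 0) + (if true ∈ t then (2⁻¹ : ENNReal) else 0) := by
  rw [fair, Measure.smul_apply, smul_eq_mul, ← MeasureTheory.lintegral_indicator_one (MeasurableSet.of_discrete),
    MeasureTheory.lintegral_count, tsum_fintype]
  simp only [Fintype.sum_bool, Set.indicator_apply]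
  split_ifs <;> simp [mul_add]

instance : IsProbabilityMeasure fair := ⟨by
  rw [fair_apply]; simp [ENNReal.inv_two_add_inv_two]⟩

theorem split_base (t : Set Bool) (S : Set ℝ) (hS : MeasurableSet S) (hinv : ∀ x, x - 1 ∈ S ↔ x ∈ S) :
    base {x | bit 0 x ∈ t ∧ 2 * x ∈ S} = fair t * base S := by
  classical
  have m0 : MeasurableSet {x | bit 0 x ∈ t ∧ 2 * x ∈ S} :=
    ((measurable_bit 0) (MeasurableSet.of_discrete (s := t))).inter ((measurable_const_mul (2:ℝ)) hS)
  have m1 : MeasurableSet ((fun x : ℝ => 2 * x) ⁻¹' (S ∩ Set.Ioo 0 1)) :=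
    (measurable_const_mul (2:ℝ)) (hS.inter measurableSet_Ioo)
  have lo : volume ((fun x : ℝ => 2 * x) ⁻¹' (S ∩ Set.Ioo 0 1)) = 2⁻¹ * volume (S ∩ Set.Ioo 0 1) := by
    rw [Real.volume_preimage_mul_left (by norm_num)]
    congr 1
    rw [abs_of_pos (by norm_num), ENNReal.ofReal_inv_of_pos (by norm_num)]; simp
  have hi : volume ((fun x : ℝ => 2 * x) ⁻¹' (S ∩ Set.Ioo 1 2)) = 2⁻¹ * volume (S ∩ Set.Ioo 0 1) := by
    rw [← lo]
    have : (fun x : ℝ => 2 * x) ⁻¹' (S ∩ Set.Ioo 1 2)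
        = (fun x : ℝ => x + (-(1/2))) ⁻¹' ((fun x : ℝ => 2 * x) ⁻¹' (S ∩ Set.Ioo 0 1)) := by
      ext x
      simp only [Set.mem_preimage, Set.mem_inter_iff, Set.mem_Ioo]
      rw [← hinv (2 * x), show 2 * (x + -(1/2)) = 2 * x - 1 by ring]
      constructor <;> rintro ⟨h, h1, h2⟩ <;> exact ⟨h, by linarith, by linarith⟩
    rw [this, measure_preimage_add_right]
  have hd : volume ({x | bit 0 x ∈ t ∧ 2 * x ∈ S} ∩ Set.Ioo 0 1)
     = volume ({x | false ∈ t ∧ x ∈ (fun x : ℝ => 2 * x) ⁻¹' (S ∩ Set.Ioo 0 1)} ∪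
        {x | true ∈ t ∧ x ∈ (fun x : ℝ => 2 * x) ⁻¹' (S ∩ Set.Ioo 1 2)}) := by
    apply measure_congr
    have : ∀ᵐ x : ℝ, x ≠ 1/2 := by
      simp [ae_iff]
    filter_upwards [this] with x hx
    apply propext
    change (x ∈ {x | bit 0 x ∈ t ∧ 2 * x ∈ S} ∩ Set.Ioo 0 1) ↔ (x ∈ {x | false ∈ t ∧ x ∈ (fun x : ℝ => 2 * x) ⁻¹' (S ∩ Set.Ioo 0 1)} ∪
        {x | true ∈ t ∧ x ∈ (fun x : ℝ => 2 * x) ⁻¹' (S ∩ Set.Ioo 1 2)})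
    simp only [Set.mem_inter_iff, Set.mem_union, Set.mem_ofPred_eq, Set.mem_preimage, Set.mem_Ioo]
    rcases lt_or_gt_of_ne hx with h | h
    · constructor
      · rintro ⟨⟨h1, h2⟩, h3, h4⟩
        rw [bit0_lo h3 h] at h1
        exact Or.inl ⟨h1, h2, by linarith, by linarith⟩
      · rintro (⟨h1, h2, h3, h4⟩ | ⟨h1, h2, h3, h4⟩)
        · rw [bit0_lo (by linarith) h]; exact ⟨⟨h1, h2⟩, by linarith, by linarith⟩
        · linarith
    · constructor
      · rintro ⟨⟨h1, h2⟩, h3, h4⟩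
        rw [bit0_hi h h4] at h1
        exact Or.inr ⟨h1, h2, by linarith, by linarith⟩
      · rintro (⟨h1, h2, h3, h4⟩ | ⟨h1, h2, h3, h4⟩)
        · linarith
        · rw [bit0_hi h (by linarith)]; exact ⟨⟨h1, h2⟩, by linarith, by linarith⟩
  rw [base_apply _ m0, base_apply _ hS, hd, fair_apply, measure_union]
  · have e : ∀ (q : Prop) [Decidable q] (Z : Set ℝ), volume {x | q ∧ x ∈ Z} = if q then volume Z else 0 := by
      intro q _ Z
      split_ifs with h <;> simp [h]
    rw [e, e, lo, hi, add_mul]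
    split_ifs <;> simp
  · rw [Set.disjoint_left]
    rintro x ⟨_, _, h1⟩ ⟨_, _, h2⟩
    simp only [Set.mem_Ioo] at h1 h2; linarith
  · exact MeasurableSet.inter (MeasurableSet.const _) ((measurable_const_mul (2:ℝ)) (hS.inter measurableSet_Ioo))


theorem base_cyl (N : ℕ) : ∀ t : ℕ → Set Bool,
    base {x | ∀ n < N, bit n x ∈ t n} = ∏ n ∈ Finset.range N, fair (t n) := by
  induction N with
  | zero => intro t; simp
  | succ N ih =>
    intro t
    have h := split_base (t 0) {x | ∀ n < N, bit n x ∈ t (n+1)} (by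
      have : {x | ∀ n < N, bit n x ∈ t (n+1)} = ⋂ n, ⋂ (_ : n < N), bit n ⁻¹' (t (n+1)) := by
        ext x; simp
      rw [this]
      exact MeasurableSet.iInter fun n => MeasurableSet.iInter fun _ =>
        measurable_bit n MeasurableSet.of_discrete) (fun x => by
        simp only [Set.mem_ofPred_eq, bit_sub_one])
    rw [ih (fun n => t (n+1))] at h
    rw [Finset.prod_range_succ', mul_comm, ← h]
    congr 1
    ext x
    simp only [Set.mem_ofPred_eq, ← bit_double]
    constructor
    · intro h; exact ⟨h 0 (by omega), fun n hn => h (n+1) (by omega)⟩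
    · rintro ⟨h0, h⟩ n hn
      cases n with
      | zero => exact h0
      | succ n => exact h n (by omega)

theorem map_bits : base.map (fun x n => bit n x) = infinitePi (fun _ : ℕ => fair) := by
  classical
  refine eq_infinitePi _ fun s t ht => ?_
  rw [Measure.map_apply (measurable_pi_lambda _ measurable_bit)
    (.pi (Finset.countable_toSet _) fun _ _ ↦ ht _)]
  obtain ⟨N, hN⟩ : ∃ N, s ⊆ Finset.range N := ⟨s.sup id + 1, fun i hi => by
    have := Finset.le_sup (f := id) hi
    simp at this ⊢; omega⟩
  have h := base_cyl N (fun n => if n ∈ s then t n else Set.univ)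
  have e : ∏ n ∈ Finset.range N, fair (if n ∈ s then t n else Set.univ) = ∏ n ∈ s, fair (t n) := by
    rw [← Finset.prod_subset hN]
    · exact Finset.prod_congr rfl fun i hi => by rw [if_pos hi]
    · intro i _ hi; rw [if_neg hi]; exact measure_univ
  rw [← e, ← h]
  congr 1
  ext x
  simp only [Set.mem_preimage, Set.mem_pi, Finset.mem_coe, Set.mem_ofPred_eq]
  constructor
  · intro h n _; split_ifs with hn
    · exact h n hn
    · trivial
  · intro h n hn
    have := h n (by simpa using hN hn)
    rwa [if_pos hn] at this

noncomputable def U (s : ℕ → Bool) : ℝ := ∑' k : ℕ, if s k then ((2 : ℝ)⁻¹) ^ (k + 1) else 0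

theorem measurable_U : Measurable U := by
  apply Continuous.measurable
  unfold U
  refine continuous_tsum (u := fun k => ((2:ℝ)⁻¹)^(k+1)) (fun k => ?_) ?_ ?_
  · exact (continuous_of_discreteTopology (f := fun b : Bool => if b then ((2 : ℝ)⁻¹) ^ (k + 1) else 0)).comp (continuous_apply k)
  · exact (summable_geometric_of_lt_one (by norm_num) (by norm_num)).comp_injective (add_left_injective 1)
  · intro k s
    split_ifs
    · rw [Real.norm_of_nonneg (by positivity)]
    · simp

theorem U_bit {x : ℝ} (h0 : 0 < x) (h1 : x < 1) : U (fun n => bit n x) = x := by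
  have h := Real.hasSum_ofDigitsTerm_digits x (b := 2) (by norm_num) ⟨h0.le, h1⟩
  refine Eq.trans ?_ h.tsum_eq
  rw [U]
  refine tsum_congr fun k => ?_
  have hf : ⌊x * 2 ^ (k+1)⌋ = (⌊x * 2 ^ (k+1)⌋₊ : ℤ) := by
    rw [Int.natCast_floor_eq_floor (by positivity)]
  simp only [Real.ofDigitsTerm, Real.digits, bit, boolOf_true, hf, Fin.val_ofNat, Nat.cast_ofNat]
  rcases Nat.mod_two_eq_zero_or_one ⌊x * 2 ^ (k+1)⌋₊ with h | h
  · rw [if_neg (by omega), h]; simp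
  · rw [if_pos (by omega), h]; simp

theorem unif_eq (i : ℕ) (x : ℝ) : unif i x = U (fun k => bit (Nat.pair i k) x) := rfl

theorem measurable_unif (i : ℕ) : Measurable (unif i) :=
  measurable_U.comp (measurable_pi_lambda _ fun k => measurable_bit _)

theorem map_rows : base.map (fun x i k => bit (Nat.pair i k) x)
    = infinitePi (fun _ : ℕ => infinitePi (fun _ : ℕ => fair)) := by
  rw [← infinitePi_map_curry (fun _ _ : ℕ => fair)]
  have := map_infinitePi_infinitePi_of_inj (P := fun _ : ℕ => fair) (f := fun q : ℕ × ℕ => Nat.pair q.1 q.2)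
    (fun a b h => Prod.ext (Nat.pair_eq_pair.1 h).1 (Nat.pair_eq_pair.1 h).2)
  rw [← this, ← map_bits, Measure.map_map (by fun_prop) (measurable_pi_lambda _ measurable_bit),
    Measure.map_map (by fun_prop)]
  · rfl
  · exact Measurable.comp (by fun_prop) (measurable_pi_lambda _ measurable_bit)

theorem map_row (i : ℕ) : base.map (fun x k => bit (Nat.pair i k) x) = infinitePi (fun _ : ℕ => fair) := by
  have := map_infinitePi_infinitePi_of_inj (P := fun _ : ℕ => fair) (f := fun k : ℕ => Nat.pair i k)
    (fun a b h => (Nat.pair_eq_pair.1 h).2)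
  rw [← this, ← map_bits, Measure.map_map (by fun_prop) (measurable_pi_lambda _ measurable_bit)]
  rfl

theorem indep_unif : iIndepFun unif base := by
  have h := iIndepFun_infinitePi (P := fun _ : ℕ => infinitePi (fun _ : ℕ => fair))
    (X := fun _ => U) (fun _ => measurable_U)
  rw [iIndepFun_iff_map_fun_eq_infinitePi_map measurable_unif]
  have hU : ∀ i : ℕ, Measurable (fun ω : ℕ → ℕ → Bool => U (ω i)) :=
    fun i => measurable_U.comp (measurable_pi_apply i)
  rw [iIndepFun_iff_map_fun_eq_infinitePi_map hU] at h
  have hm : Measurable (fun x i k => bit (Nat.pair i k) x) :=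
    measurable_pi_lambda _ fun i => measurable_pi_lambda _ fun k => measurable_bit _
  rw [← map_rows, Measure.map_map (measurable_pi_lambda _ hU) hm] at h
  refine Eq.trans ?_ (h.trans ?_)
  · rfl
  · congr 1; ext1 i
    rw [Measure.map_map (hU i) hm]; rfl

theorem unif_lt (i : ℕ) {q : ℝ} (h0 : 0 ≤ q) (h1 : q ≤ 1) : base {x | unif i x < q} = ENNReal.ofReal q := by
  have hrow : Measurable (fun x k => bit (Nat.pair i k) x) := measurable_pi_lambda _ fun k => measurable_bit _
  have hb : Measurable (fun x k => bit k x) := measurable_pi_lambda _ measurable_bit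
  have hS : MeasurableSet {s | U s < q} := measurable_U measurableSet_Iio
  have e1 : base {x | unif i x < q} = base {x | U (fun k => bit k x) < q} := by
    have a := Measure.map_apply (μ := base) hrow hS
    have b := Measure.map_apply (μ := base) hb hS
    rw [map_row] at a; rw [map_bits] at b
    exact a.symm.trans b
  have hS' : MeasurableSet {x | U (fun k => bit k x) < q} := hb hS
  rw [e1, base_apply _ hS']
  have : {x | U (fun k => bit k x) < q} ∩ Set.Ioo 0 1 = Set.Ioo 0 q := by
    ext x
    simp only [Set.mem_inter_iff, Set.mem_ofPred_eq, Set.mem_Ioo]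
    constructor
    · rintro ⟨h, h2, h3⟩; rw [U_bit h2 h3] at h; exact ⟨h2, h⟩
    · rintro ⟨h, h2⟩; rw [U_bit h (by linarith)]; exact ⟨h2, h, by linarith⟩
  rw [this]; simp

end PercM

namespace PercM
open MeasureTheory ProbabilityTheory DaC Measure

/-- threshold of index `i` -/
noncomputable def qq (p r : ℝ) (i : ℕ) : ℝ := if i % 2 = 0 then p else r

noncomputable def Y (p r : ℝ) (i : ℕ) (x : ℝ) : Bool := boolOf (unif i x < qq p r i)

theorem measurable_Y (p r : ℝ) (i : ℕ) : Measurable (Y p r i) := by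
  apply measurable_to_bool
  have : Y p r i ⁻¹' {true} = unif i ⁻¹' Set.Iio (qq p r i) := by
    ext x; simp [Y, boolOf]
  rw [this]
  exact measurable_unif i measurableSet_Iio

theorem indep_Y (p r : ℝ) : iIndepFun (Y p r) base := by
  have h := indep_unif.comp (fun i (u : ℝ) => boolOf (u < qq p r i)) (fun i => by
    apply measurable_to_bool
    have : (fun u => boolOf (u < qq p r i)) ⁻¹' {true} = Set.Iio (qq p r i) := by
      ext x; simp [boolOf]
    rw [this]; exact measurableSet_Iio)
  exact h

def Dep (p r : ℝ) (I : Finset ℕ) (S : Set ℝ) : Prop :=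
  ∀ x x', (∀ i ∈ I, Y p r i x = Y p r i x') → (x ∈ S ↔ x' ∈ S)

theorem Dep.eq {p r : ℝ} {I : Finset ℕ} {S : Set ℝ} (h : Dep p r I S) :
    S = (fun x (i : I) => Y p r i x) ⁻¹' ((fun x (i : I) => Y p r i x) '' S) := by
  ext x
  constructor
  · intro hx; exact ⟨x, hx, rfl⟩
  · rintro ⟨x', hx', he⟩
    exact (h x' x fun i hi => congrFun he ⟨i, hi⟩).1 hx'

theorem Dep.meas {p r : ℝ} {I : Finset ℕ} {S : Set ℝ} (h : Dep p r I S) : MeasurableSet S := by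
  rw [h.eq]
  exact (measurable_pi_lambda _ fun i : I => measurable_Y p r i) (Set.toFinite _).measurableSet

theorem Dep.mul {p r : ℝ} {I J : Finset ℕ} {S S' : Set ℝ} (h : Dep p r I S) (h' : Dep p r J S')
    (hd : Disjoint I J) : base.real (S ∩ S') = base.real S * base.real S' := by
  have hi := (indep_Y p r).indepFun_finset I J hd (measurable_Y p r)
  have := hi.measure_inter_preimage_eq_mul _ _ (Set.toFinite ((fun x (i : I) => Y p r i x) '' S)).measurableSet
    (Set.toFinite ((fun x (i : J) => Y p r i x) '' S')).measurableSet
  rw [← h.eq, ← h'.eq] at this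
  rw [Measure.real, this, ENNReal.toReal_mul]; rfl

theorem eIdx_symm (u v : V) : eIdx u v = eIdx v u := by unfold eIdx; rw [min_comm]

theorem eIdx_inj {u v u' v' : V} (h : eIdx u v = eIdx u' v') :
    (u = u' ∧ v = v') ∨ (u = v' ∧ v = u') := by
  unfold eIdx at h
  rcases min_choice (Encodable.encode (u, v)) (Encodable.encode (v, u)) with h1 | h1 <;>
  rcases min_choice (Encodable.encode (u', v')) (Encodable.encode (v', u')) with h2 | h2 <;>
  rw [h1, h2] at h <;> have := Encodable.encode_injective h <;> simp only [Prod.mk.injEq] at this <;> tauto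

noncomputable def eI (e : Perc.Edge) : ℕ := 2 * eIdx (Perc.src e) (Perc.tgt e)

theorem eI_inj : Function.Injective eI := by
  intro e e' h
  have h' : eIdx (Perc.src e) (Perc.tgt e) = eIdx (Perc.src e') (Perc.tgt e') := by
    unfold eI at h; omega
  have t := Perc.tgt_cases e
  have t' := Perc.tgt_cases e'
  rcases eIdx_inj h' with ⟨a, b⟩ | ⟨a, b⟩
  · obtain ⟨s, o⟩ := e
    obtain ⟨s', o'⟩ := e'
    simp only [Perc.src] at a
    subst a
    cases o <;> cases o' <;> simp [Perc.tgt] at b ⊢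
  · rw [a, b] at t; exfalso; omega

theorem Y_eI (p r : ℝ) (e : Perc.Edge) (x : ℝ) :
    Y p r (eI e) x = true ↔ edgeU (Perc.src e) (Perc.tgt e) x < p := by
  unfold Y eI edgeU qq; rw [boolOf_true]
  rw [if_pos (by omega)]

open Classical in
noncomputable def opn (p r : ℝ) (F : Finset Perc.Edge) (x : ℝ) : Finset Perc.Edge :=
  F.filter (fun e => Y p r (eI e) x = true)

theorem opn_insert_pos {p r : ℝ} {F : Finset Perc.Edge} {a : Perc.Edge} {x : ℝ} (h : Y p r (eI a) x = true) :
    opn p r (insert a F) x = insert a (opn p r F x) := by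
  unfold opn; rw [Finset.filter_insert, if_pos h]

theorem opn_insert_neg {p r : ℝ} {F : Finset Perc.Edge} {a : Perc.Edge} {x : ℝ} (h : ¬ Y p r (eI a) x = true) :
    opn p r (insert a F) x = opn p r F x := by
  unfold opn; rw [Finset.filter_insert, if_neg h]

theorem dep_opn (p r : ℝ) (F : Finset Perc.Edge) (A : Finset Perc.Edge → Prop) :
    Dep p r (F.image eI) {x | A (opn p r F x)} := by
  intro x x' h
  have : opn p r F x = opn p r F x' := by
    unfold opn
    refine Finset.filter_congr fun e he => ?_
    rw [h _ (Finset.mem_image_of_mem _ he)]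
  simp only [Set.mem_ofPred_eq, this]

theorem dep_one (p r : ℝ) (i : ℕ) (b : Bool) : Dep p r {i} {x | Y p r i x = b} := by
  intro x x' h
  simp only [Set.mem_ofPred_eq, h i (Finset.mem_singleton_self i)]

theorem base_Y_true {p r : ℝ} (h0 : 0 ≤ p) (h1 : p ≤ 1) (e : Perc.Edge) :
    base.real {x | Y p r (eI e) x = true} = p := by
  have : {x | Y p r (eI e) x = true} = {x | unif (eI e) x < p} := by
    ext x; rw [Set.mem_ofPred_eq, Y_eI]; rfl
  rw [this, Measure.real, unif_lt _ h0 h1, ENNReal.toReal_ofReal h0]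

theorem base_opn {p r : ℝ} (h0 : 0 ≤ p) (h1 : p ≤ 1) (F : Finset Perc.Edge) :
    ∀ (A : Finset Perc.Edge → Prop), base.real {x | A (opn p r F x)} = Perc.Pr p F A := by
  induction F using Finset.induction_on with
  | empty =>
    intro A
    rw [Perc.Pr, Perc.Ex_empty]
    by_cases h : A ∅ <;> simp [opn, h, Perc.ind]
  | insert a F ha ih =>
    intro A
    have hd : Disjoint ({eI a} : Finset ℕ) (F.image eI) := by
      rw [Finset.disjoint_singleton_left, Finset.mem_image]
      rintro ⟨e, he, h⟩; rw [eI_inj h] at he; exact ha he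
    have m1 := (dep_one p r (eI a) true).mul (dep_opn p r F (fun T => A (insert a T))) hd
    have m2 := (dep_one p r (eI a) false).mul (dep_opn p r F A) hd
    have e2 : {x | Y p r (eI a) x = false} = {x | Y p r (eI a) x = true}ᶜ := by
      ext x; simp
    have : {x | A (opn p r (insert a F) x)} =
       ({x | Y p r (eI a) x = true} ∩ {x | A (insert a (opn p r F x))}) ∪
       ({x | Y p r (eI a) x = false} ∩ {x | A (opn p r F x)}) := by
      ext x
      simp only [Set.mem_ofPred_eq, Set.mem_union, Set.mem_inter_iff]
      by_cases h : Y p r (eI a) x = true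
      · rw [opn_insert_pos h]; simp [h]
      · rw [opn_insert_neg h]; simp [h]
    rw [this, measureReal_union, m1, m2, ih A, ih (fun T => A (insert a T)), e2, measureReal_compl (dep_one p r (eI a) true).meas,
      base_Y_true h0 h1]; unfold Perc.Pr; rw [Perc.Ex_insert _ ha]
    · simp
    · rw [Set.disjoint_left]; rintro x ⟨h, _⟩ ⟨h', _⟩
      simp only [Set.mem_ofPred_eq] at h h'; rw [h] at h'; cases h'
    · exact (dep_one p r (eI a) false).meas.inter (dep_opn p r F A).meas

end PercM

namespace PercM
open MeasureTheory ProbabilityTheory DaC Measure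

theorem sq_cases {u v : V} (h : SqAdj u v) : ∃ e : Perc.Edge,
    (Perc.src e = u ∧ Perc.tgt e = v) ∨ (Perc.src e = v ∧ Perc.tgt e = u) := by
  obtain ⟨a, b⟩ := u
  obtain ⟨a', b'⟩ := v
  unfold SqAdj at h
  simp only at h
  have h1 : (a - a') ≤ 1 := by nlinarith [sq_nonneg (b - b')]
  have h2 : -1 ≤ (a - a') := by nlinarith [sq_nonneg (b - b')]
  have h3 : (b - b') ≤ 1 := by nlinarith [sq_nonneg (a - a')]
  have h4 : -1 ≤ (b - b') := by nlinarith [sq_nonneg (a - a')]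
  obtain ⟨k, rfl⟩ : ∃ k, a = a' + k := ⟨a - a', by ring⟩
  obtain ⟨l, rfl⟩ : ∃ l, b = b' + l := ⟨b - b', by ring⟩
  simp only [add_sub_cancel_left] at *
  have hk : k = -1 ∨ k = 0 ∨ k = 1 := by omega
  have hl : l = -1 ∨ l = 0 ∨ l = 1 := by omega
  rcases hk with rfl | rfl | rfl <;> rcases hl with rfl | rfl | rfl <;> norm_num at h
  · exact ⟨((a' + -1, b' + 0), false), Or.inl (by simp [Perc.src, Perc.tgt])⟩
  · exact ⟨((a' + 0, b' + -1), true), Or.inl (by simp [Perc.src, Perc.tgt])⟩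
  · exact ⟨((a', b'), true), Or.inr (by simp [Perc.src, Perc.tgt])⟩
  · exact ⟨((a', b'), false), Or.inr (by simp [Perc.src, Perc.tgt])⟩

theorem edgeU_symm (u v : V) (x : ℝ) : edgeU u v x = edgeU v u x := by
  unfold edgeU; rw [eIdx_symm]

/-- If the cluster of `v` leaves the box, there is an arm in the box. -/
theorem exit_box (p r x : ℝ) (v : V) (m : ℤ) (hm : 0 ≤ m) {w : V}
    (h : DaC.Conn (edgeCfg SqAdj p x) v w) :
    Perc.reach (opn p r (Perc.ES (Perc.B v m)) x) v v m ∨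
      (w ∈ Perc.B v m ∧ Perc.Conn (opn p r (Perc.ES (Perc.B v m)) x) v w) := by
  induction h with
  | refl =>
    right
    refine ⟨?_, Perc.Conn.refl _ _⟩
    rw [Perc.mem_B]; omega
  | @tail b c hb hbc ih =>
    rcases ih with ih | ⟨hB, ih⟩
    · exact Or.inl ih
    by_cases hf : Perc.far v m b
    · exact Or.inl ⟨b, hf, ih⟩
    right
    simp only [edgeCfg, Bool.and_eq_true, boolOf_true] at hbc
    obtain ⟨hadj, hop⟩ := hbc
    obtain ⟨e, he⟩ := sq_cases hadj
    have ht := Perc.tgt_cases e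
    have hc : c ∈ Perc.B v m := by
      rw [Perc.mem_B] at *
      unfold Perc.far at hf
      rcases he with ⟨rfl, rfl⟩ | ⟨rfl, rfl⟩ <;> omega
    refine ⟨hc, ih.trans ?_⟩
    refine Relation.ReflTransGen.single ⟨e, ?_, he⟩
    unfold opn
    rw [Finset.mem_filter, Perc.mem_ES, Y_eI]
    rcases he with ⟨rfl, rfl⟩ | ⟨rfl, rfl⟩
    · exact ⟨⟨hB, hc⟩, hop⟩
    · rw [edgeU_symm]; exact ⟨⟨hc, hB⟩, hop⟩

/-- restricted edge configuration -/
noncomputable def rCfg (N : Finset V) (η : EdgeCfg) : EdgeCfg :=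
  fun a b => η a b && boolOf (a ∈ N) && boolOf (b ∈ N)

theorem rCfg_true {N : Finset V} {η : EdgeCfg} {a b : V} :
    rCfg N η a b = true ↔ η a b = true ∧ a ∈ N ∧ b ∈ N := by
  simp [rCfg, boolOf_true, and_assoc]

theorem rCfg_cluster {N : Finset V} {η : EdgeCfg} {v : V} (h : pCluster η v ⊆ N) :
    pCluster (rCfg N η) v = pCluster η v := by
  ext w
  constructor
  · intro hw
    exact Relation.ReflTransGen.mono (fun a b hab => (rCfg_true.1 hab).1) _ _ hw
  · intro hw
    change Relation.ReflTransGen _ v w at hw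
    change Relation.ReflTransGen _ v w
    induction hw with
    | refl => exact .refl
    | @tail b c hb hbc ih =>
      exact ih.tail (rCfg_true.2 ⟨hbc, h hb, h (hb.tail hbc)⟩)

theorem rep_mem (η : EdgeCfg) (v : V) : clusterRep η v ∈ pCluster η v := by
  have hne : (Encodable.encode '' pCluster η v).Nonempty := ⟨_, v, Relation.ReflTransGen.refl, rfl⟩
  obtain ⟨w, hw, he⟩ := Nat.sInf_mem hne
  unfold clusterRep
  rw [← he, Encodable.encodek]
  exact hw

theorem rCfg_sub {N : Finset V} {η : EdgeCfg} {v : V} (hv : v ∈ N) : pCluster (rCfg N η) v ⊆ N := by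
  intro w hw
  change Relation.ReflTransGen _ v w at hw
  induction hw with
  | refl => exact hv
  | tail _ hbc _ => exact (rCfg_true.1 hbc).2.2

theorem rep_congr {η η' : EdgeCfg} {v : V} (h : pCluster η v = pCluster η' v) :
    clusterRep η v = clusterRep η' v := by
  unfold clusterRep; rw [h]

/-- restricted colour configuration -/
noncomputable def rCol (p r : ℝ) (N : Finset V) (x : ℝ) : ColourCfg :=
  fun v => boolOf (vtxU (clusterRep (rCfg N (edgeCfg SqAdj p x)) v) x < r)

noncomputable def vI (v : V) : ℕ := 2 * Encodable.encode v + 1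

open Classical in
noncomputable def idx (N : Finset V) : Finset ℕ :=
  (N ×ˢ N).image (fun q => 2 * eIdx q.1 q.2) ∪ N.image vI

theorem idx_disj {N N' : Finset V} (h : Disjoint N N') : Disjoint (idx N) (idx N') := by
  rw [Finset.disjoint_left] at h ⊢
  intro i hi hi'
  simp only [idx, Finset.mem_union, Finset.mem_image, Finset.mem_product, vI] at hi hi'
  rcases hi with ⟨⟨a, b⟩, ⟨ha, hb⟩, e⟩ | ⟨a, ha, e⟩ <;> rcases hi' with ⟨⟨a', b'⟩, ⟨ha', hb'⟩, e'⟩ | ⟨a', ha', e'⟩ <;> try simp only at *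
  · rcases eIdx_inj (show eIdx a b = eIdx a' b' by omega) with ⟨rfl, rfl⟩ | ⟨rfl, rfl⟩
    · exact h ha ha'
    · exact h ha hb'
  · omega
  · omega
  · have : a = a' := Encodable.encode_injective (by omega)
    subst this; exact h ha ha'

theorem rCol_dep {p r : ℝ} {N : Finset V} {x x' : ℝ} (h : ∀ i ∈ idx N, Y p r i x = Y p r i x')
    {v : V} (hv : v ∈ N) : rCol p r N x v = rCol p r N x' v := by
  have hc : rCfg N (edgeCfg SqAdj p x) = rCfg N (edgeCfg SqAdj p x') := by
    funext a b
    rw [Bool.eq_iff_iff, rCfg_true, rCfg_true]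
    refine and_congr_left fun ⟨ha, hb⟩ => ?_
    have := h (2 * eIdx a b) (by
      unfold idx
      exact Finset.mem_union_left _ (Finset.mem_image.2 ⟨(a, b), by simp [ha, hb], rfl⟩))
    unfold Y qq at this
    rw [if_pos (by omega), Bool.eq_iff_iff, boolOf_true, boolOf_true] at this
    simp only [edgeCfg, Bool.and_eq_true, boolOf_true, edgeU, this]
  unfold rCol
  rw [hc]
  have hm := rCfg_sub (η := edgeCfg SqAdj p x') hv (rep_mem _ v)
  generalize clusterRep (rCfg N (edgeCfg SqAdj p x')) v = w at *
  have := h (vI w) (by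
    unfold idx
    exact Finset.mem_union_right _ (Finset.mem_image_of_mem _ hm))
  have h2 : ¬ (2 * Encodable.encode w + 1) % 2 = 0 := by omega
  unfold Y qq vI at this
  rw [if_neg h2] at this
  exact this

def bad (p r : ℝ) (m : ℤ) (v : V) : Set ℝ :=
  {x | Perc.reach (opn p r (Perc.ES (Perc.B v m)) x) v v m}

theorem base_bad {p r : ℝ} (h0 : 0 ≤ p) (h1 : p ≤ 1) {m : ℤ} (hm : 0 ≤ m) (v : V) :
    base.real (bad p r m v) ≤ Perc.th p m := by
  unfold bad
  rw [base_opn h0 h1 _ (fun T => Perc.reach T v v m)]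
  exact Perc.th_ge h0 h1 hm _ _

theorem good_col {p r x : ℝ} {m : ℤ} (hm : 0 ≤ m) {v : V} {N : Finset V} (hN : Perc.B v m ⊆ N)
    (h : x ∉ bad p r m v) : rCol p r N x v = colourCfg SqAdj p r x v := by
  have : pCluster (edgeCfg SqAdj p x) v ⊆ N := by
    intro w hw
    rcases exit_box p r x v m hm hw with h' | h'
    · exact absurd h' h
    · exact hN h'.1
  unfold rCol colourCfg
  rw [rep_congr (rCfg_cluster this)]

noncomputable def Phi (p r x : ℝ) : Config := (edgeCfg SqAdj p x, colourCfg SqAdj p r x)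

noncomputable def nbh (W : Finset V) (m : ℤ) : Finset V := W.biUnion (fun v => Perc.B v m)

theorem sub_nbh {W : Finset V} {m : ℤ} {v : V} (hv : v ∈ W) : Perc.B v m ⊆ nbh W m :=
  Finset.subset_biUnion_of_mem (fun v => Perc.B v m) hv

theorem self_nbh {W : Finset V} {m : ℤ} (hm : 0 ≤ m) {v : V} (hv : v ∈ W) : v ∈ nbh W m :=
  sub_nbh hv (by rw [Perc.mem_B]; omega)

def Sr (p r : ℝ) (W : Finset V) (m : ℤ) (A : Set Config) : Set ℝ :=
  {x | ((edgeCfg SqAdj p x, rCol p r (nbh W m) x) : Config) ∈ A}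

theorem Sr_dep {p r : ℝ} {W : Finset V} {m : ℤ} (hm : 0 ≤ m) {A : Set Config}
    (hA : DependsOnColoursIn A (W : Set V)) : Dep p r (idx (nbh W m)) (Sr p r W m A) := by
  intro x x' h
  exact hA _ _ fun v hv => rCol_dep h (self_nbh hm hv)

theorem Sr_eq {p r x : ℝ} {W : Finset V} {m : ℤ} (hm : 0 ≤ m) {A : Set Config}
    (hA : DependsOnColoursIn A (W : Set V)) (h : ∀ v ∈ W, x ∉ bad p r m v) :
    x ∈ Sr p r W m A ↔ Phi p r x ∈ A :=
  hA _ _ fun v hv => good_col hm (sub_nbh hv) (h v hv)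

theorem A_meas {W : Finset V} {A : Set Config} (hA : DependsOnColoursIn A (W : Set V)) : MeasurableSet A := by
  have : A = (fun (ω : Config) (v : W) => ω.2 v) ⁻¹' ((fun (ω : Config) (v : W) => ω.2 v) '' A) := by
    ext ω
    constructor
    · intro h; exact ⟨ω, h, rfl⟩
    · rintro ⟨ω', h', e⟩
      exact (hA ω' ω fun v hv => congrFun e ⟨v, hv⟩).1 h'
  rw [this]
  exact (measurable_pi_lambda _ fun v : W => (measurable_pi_apply (v : V)).comp measurable_snd)
    (Set.toFinite _).measurableSet

theorem close {S S' D : Set ℝ} (h : ∀ x ∉ D, x ∈ S ↔ x ∈ S') :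
    |base.real S - base.real S'| ≤ base.real D := by
  have a : base.real S ≤ base.real S' + base.real D :=
    (measureReal_mono (fun x hx => by
      by_cases hD : x ∈ D
      · exact Or.inr hD
      · exact Or.inl ((h x hD).1 hx))).trans (measureReal_union_le S' D)
  have b : base.real S' ≤ base.real S + base.real D :=
    (measureReal_mono (fun x hx => by
      by_cases hD : x ∈ D
      · exact Or.inr hD
      · exact Or.inl ((h x hD).2 hx))).trans (measureReal_union_le S D)
  rw [abs_le]; constructor <;> linarith

theorem finite_indep {p r : ℝ} (h0 : 0 ≤ p) (h1 : p ≤ 1) {m : ℤ} (hm : 0 ≤ m) (W1 W2 : Finset V)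
    (hW : Disjoint (nbh W1 m) (nbh W2 m)) {A1 A2 : Set Config}
    (hA1 : DependsOnColoursIn A1 (W1 : Set V)) (hA2 : DependsOnColoursIn A2 (W2 : Set V)) :
    |(DaCMeasure SqAdj p r (A1 ∩ A2)).toReal -
            (DaCMeasure SqAdj p r A1).toReal * (DaCMeasure SqAdj p r A2).toReal|
      ≤ 3 * ((W1.card + W2.card) * Perc.th p m) := by
  have hth : 0 ≤ Perc.th p m := Perc.Pr_nonneg h0 h1 _ _
  by_cases hae : AEMeasurable (Phi p r) base
  swap
  · have : DaCMeasure SqAdj p r = 0 := Measure.map_of_not_aemeasurable hae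
    rw [this]; simp; positivity
  have hmap : ∀ A, MeasurableSet A → (DaCMeasure SqAdj p r A).toReal = base.real (Phi p r ⁻¹' A) := by
    intro A hA
    have : DaCMeasure SqAdj p r A = base (Phi p r ⁻¹' A) := Measure.map_apply_of_aemeasurable hae hA
    rw [this]; rfl
  have m1 := A_meas hA1
  have m2 := A_meas hA2
  rw [hmap _ m1, hmap _ m2, hmap _ (m1.inter m2)]
  set D : Set ℝ := (⋃ v ∈ W1, bad p r m v) ∪ (⋃ v ∈ W2, bad p r m v) with hDdef
  have hW' : ∀ W : Finset V, base.real (⋃ v ∈ W, bad p r m v) ≤ W.card * Perc.th p m := by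
    intro W
    refine (measureReal_biUnion_finset_le W _).trans ?_
    refine (Finset.sum_le_sum fun v _ => base_bad h0 h1 hm v).trans ?_
    simp
  have hD : base.real D ≤ (W1.card + W2.card) * Perc.th p m := by
    refine (measureReal_union_le _ _).trans ?_
    have := hW' W1
    have := hW' W2
    linarith
  have g1 : ∀ x ∉ D, x ∈ Phi p r ⁻¹' A1 ↔ x ∈ Sr p r W1 m A1 := fun x hx =>
    (Sr_eq hm hA1 fun v hv hb => hx (Or.inl (Set.mem_biUnion hv hb))).symm
  have g2 : ∀ x ∉ D, x ∈ Phi p r ⁻¹' A2 ↔ x ∈ Sr p r W2 m A2 := fun x hx =>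
    (Sr_eq hm hA2 fun v hv hb => hx (Or.inr (Set.mem_biUnion hv hb))).symm
  have c1 := close g1
  have c2 := close g2
  have c3 := close (S := Phi p r ⁻¹' (A1 ∩ A2)) (S' := Sr p r W1 m A1 ∩ Sr p r W2 m A2) (D := D)
    (fun x hx => and_congr (g1 x hx) (g2 x hx))
  have hmul := (Sr_dep (p := p) (r := r) hm hA1).mul (Sr_dep hm hA2) (idx_disj hW)
  rw [hmul] at c3
  have b1 : base.real (Phi p r ⁻¹' A1) ≤ 1 := measureReal_le_one
  have b2 : base.real (Sr p r W2 m A2) ≤ 1 := measureReal_le_one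
  have b3 : 0 ≤ base.real (Phi p r ⁻¹' A1) := measureReal_nonneg
  have b4 : 0 ≤ base.real (Sr p r W2 m A2) := measureReal_nonneg
  generalize base.real (Phi p r ⁻¹' A1) = a at *
  generalize base.real (Phi p r ⁻¹' A2) = b at *
  generalize base.real (Sr p r W1 m A1) = a' at *
  generalize base.real (Sr p r W2 m A2) = b' at *
  generalize base.real (Phi p r ⁻¹' (A1 ∩ A2)) = c at *
  have key : |c - a * b| ≤ |c - a' * b'| + |a - a'| * b' + a * |b - b'| := by
    have : c - a * b = (c - a' * b') + (-((a - a') * b')) + (-(a * (b - b'))) := by ring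
    rw [this]
    refine (abs_add_three _ _ _).trans ?_
    rw [abs_neg, abs_neg, abs_mul, abs_mul, abs_of_nonneg b4, abs_of_nonneg b3]
  have k1 : |a - a'| * b' ≤ |a - a'| := mul_le_of_le_one_right (abs_nonneg _) b2
  have k2 : a * |b - b'| ≤ |b - b'| := mul_le_of_le_one_left (abs_nonneg _) b1
  linarith

end PercM

namespace PercM
open MeasureTheory ProbabilityTheory DaC Measure

theorem th_tendsto {p : ℝ} (h0 : 0 ≤ p) (hp : p < 1/2) :
    Filter.Tendsto (fun n : ℕ => ((n:ℝ)+1)^2 * Perc.th p n) Filter.atTop (nhds 0) := by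
  have h1 : p ≤ 1 := by linarith
  obtain ⟨c, hc0, hc1, L, hL, hd⟩ := Perc.decay h0 hp
  obtain ⟨l, rfl⟩ : ∃ l : ℕ, L = l := ⟨L.toNat, by omega⟩
  have hl : 1 ≤ l := by omega
  have g : Filter.Tendsto (fun j : ℕ => (l:ℝ)^2 * (2 * ((j:ℝ)^2 * c^j) + 2 * c^j)) Filter.atTop (nhds 0) := by
    have a := tendsto_pow_const_mul_const_pow_of_abs_lt_one 2 (r := c) (by rwa [abs_of_nonneg hc0])
    have b := tendsto_pow_atTop_nhds_zero_of_lt_one hc0 hc1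
    simpa using ((a.const_mul 2).add (b.const_mul 2)).const_mul ((l:ℝ)^2)
  have g' := g.comp (Nat.tendsto_div_const_atTop (n := l) (by omega))
  refine squeeze_zero (fun n => ?_) (fun n => ?_) g'
  · have : 0 ≤ Perc.th p n := Perc.Pr_nonneg h0 h1 _ _
    positivity
  · simp only [Function.comp]
    have h2 : l * (n / l) ≤ n := Nat.mul_div_le n l
    have h3 : n < l * (n / l) + l := by
      have := Nat.lt_mul_div_succ n (b := l) (by omega)
      linarith [this, Nat.mul_add l (n/l) 1]
    have ht : Perc.th p n ≤ c ^ (n / l) := by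
      refine (Perc.th_anti h0 h1 (n := ((n / l : ℕ) : ℤ) * l) (by positivity) ?_).trans (hd (n / l))
      have : n / l * l ≤ n := Nat.div_mul_le_self n l
      exact_mod_cast this
    generalize n / l = j at *
    have h4 : (n:ℝ) + 1 ≤ l * (j + 1) := by
      have : n + 1 ≤ l * (j + 1) := by linarith
      exact_mod_cast this
    calc ((n:ℝ)+1)^2 * Perc.th p n ≤ ((l:ℝ) * (j+1))^2 * c^j := by
          have : 0 ≤ Perc.th p n := Perc.Pr_nonneg h0 h1 _ _
          gcongr
      _ = (l:ℝ)^2 * (((j:ℝ)+1)^2 * c^j) := by ring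
      _ ≤ _ := by
        have : 0 ≤ c^j := by positivity
        have : ((j:ℝ)+1)^2 * c^j ≤ (2 * (j:ℝ)^2 + 2) * c^j := by
          gcongr; nlinarith [sq_nonneg ((j:ℝ) - 1)]
        have h5 : (2 * (j:ℝ)^2 + 2) * c^j = 2 * ((j:ℝ)^2 * c^j) + 2 * c^j := by ring
        rw [← h5]
        gcongr

/-- lattice points of a scaled rectangle -/
noncomputable def WF (lam a b c d : ℝ) : Finset V :=
  Finset.Icc ⌈lam * a⌉ ⌊lam * b⌋ ×ˢ Finset.Icc ⌈lam * c⌉ ⌊lam * d⌋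

theorem mem_WF {lam a b c d : ℝ} {w : V} : w ∈ WF lam a b c d ↔
    (lam * a ≤ w.1 ∧ w.1 ≤ lam * b) ∧ (lam * c ≤ w.2 ∧ w.2 ≤ lam * d) := by
  simp [WF, Int.ceil_le, Int.le_floor]

theorem card_Icc_le {lam a b δ M : ℝ} (hab : a < b) (hδ : 0 < δ) (hM : 0 ≤ M) (hlam : lam * δ ≤ 3 * (M + 1))
    : ((Finset.Icc ⌈lam * a⌉ ⌊lam * b⌋).card : ℝ) ≤ (3 * (b - a) / δ + 1) * (M + 1) := by
  have h1 : (0:ℝ) ≤ (3 * (b - a) / δ + 1) * (M + 1) := by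
    have : 0 < b - a := by linarith
    positivity
  rw [Int.card_Icc]
  rcases le_or_gt (⌊lam * b⌋ + 1 - ⌈lam * a⌉) 0 with h | h
  · rw [Int.toNat_of_nonpos h]; simpa using h1
  · have e : (((⌊lam * b⌋ + 1 - ⌈lam * a⌉).toNat : ℕ) : ℝ) = ((⌊lam * b⌋ + 1 - ⌈lam * a⌉ : ℤ) : ℝ) := by
      have : (((⌊lam * b⌋ + 1 - ⌈lam * a⌉).toNat : ℕ) : ℤ) = ⌊lam * b⌋ + 1 - ⌈lam * a⌉ := Int.toNat_of_nonneg h.le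
      exact_mod_cast congrArg (Int.cast : ℤ → ℝ) this
    rw [e]; push_cast
    have f1 := Int.floor_le (lam * b)
    have f2 := Int.le_ceil (lam * a)
    have f3 : lam * (b - a) ≤ 3 * (b - a) / δ * (M + 1) := by
      rw [div_mul_eq_mul_div, le_div_iff₀ hδ]
      nlinarith
    nlinarith

theorem card_WF_le {lam a b c d δ M : ℝ} (hab : a < b) (hcd : c < d) (hδ : 0 < δ) (hM : 0 ≤ M)
    (hlam : lam * δ ≤ 3 * (M + 1)) :
    ((WF lam a b c d).card : ℝ) ≤ (3 * (b - a) / δ + 1) * (3 * (d - c) / δ + 1) * (M + 1)^2 := by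
  rw [WF, Finset.card_product]; push_cast
  have h1 := card_Icc_le hab hδ hM hlam
  have h2 := card_Icc_le hcd hδ hM hlam
  calc _ ≤ ((3 * (b - a) / δ + 1) * (M + 1)) * ((3 * (d - c) / δ + 1) * (M + 1)) := by
        gcongr
    _ = _ := by ring

theorem scaled_eq {lam a b c d : ℝ} (hlam : 0 < lam) :
    {w : V | ((w.1 : ℝ), (w.2 : ℝ)) ∈ (fun x : ℝ × ℝ => (lam * x.1, lam * x.2)) '' (Set.Icc a b ×ˢ Set.Icc c d)}
      = (WF lam a b c d : Set V) := by
  ext w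
  rw [Finset.mem_coe, mem_WF]
  simp only [Set.mem_ofPred_eq, Set.mem_image, Set.mem_prod, Set.mem_Icc, Prod.mk.injEq]
  constructor
  · rintro ⟨x, ⟨⟨h1, h2⟩, h3, h4⟩, h5, h6⟩
    rw [← h5, ← h6]
    refine ⟨⟨?_, ?_⟩, ?_, ?_⟩ <;> gcongr
  · rintro ⟨⟨h1, h2⟩, h3, h4⟩
    refine ⟨(w.1 / lam, w.2 / lam), ⟨⟨?_, ?_⟩, ?_, ?_⟩, ?_, ?_⟩
    · rw [le_div_iff₀ hlam]; linarith
    · rw [div_le_iff₀ hlam]; linarith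
    · rw [le_div_iff₀ hlam]; linarith
    · rw [div_le_iff₀ hlam]; linarith
    · field_simp
    · field_simp

theorem gap {a b c d a' b' c' d' : ℝ} (hab : a < b) (hcd : c < d) (hab' : a' < b') (hcd' : c' < d')
    (h : Disjoint (Set.Icc a b ×ˢ Set.Icc c d) (Set.Icc a' b' ×ˢ Set.Icc c' d')) :
    ∃ δ : ℝ, 0 < δ ∧ (b + δ ≤ a' ∨ b' + δ ≤ a ∨ d + δ ≤ c' ∨ d' + δ ≤ c) := by
  by_cases h1 : b < a'
  · exact ⟨a' - b, by linarith, Or.inl (by linarith)⟩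
  by_cases h2 : b' < a
  · exact ⟨a - b', by linarith, Or.inr (Or.inl (by linarith))⟩
  by_cases h3 : d < c'
  · exact ⟨c' - d, by linarith, Or.inr (Or.inr (Or.inl (by linarith)))⟩
  by_cases h4 : d' < c
  · exact ⟨c - d', by linarith, Or.inr (Or.inr (Or.inr (by linarith)))⟩
  exfalso
  push Not at h1 h2 h3 h4
  refine absurd (show (max a a', max c c') ∈ Set.Icc a' b' ×ˢ Set.Icc c' d' from ?_) (Set.disjoint_left.1 h (?_ : (max a a', max c c') ∈ _)) <;>
  simp only [Set.mem_prod, Set.mem_Icc, le_max_left, le_max_right, max_le_iff, true_and] <;>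
  exact ⟨⟨by linarith, by linarith⟩, by linarith, by linarith⟩

theorem nbh_disj {lam a b c d a' b' c' d' δ : ℝ} {m : ℕ} (hm : 1 ≤ m) (hlam : 0 < lam) (hmδ : 3 * (m:ℝ) ≤ lam * δ)
    (h : b + δ ≤ a' ∨ b' + δ ≤ a ∨ d + δ ≤ c' ∨ d' + δ ≤ c) :
    Disjoint (nbh (WF lam a b c d) m) (nbh (WF lam a' b' c' d') m) := by
  rw [Finset.disjoint_left]
  intro z h1 h2
  unfold nbh at h1 h2
  rw [Finset.mem_biUnion] at h1 h2
  obtain ⟨v, hv, h1⟩ := h1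
  obtain ⟨w, hw, h2⟩ := h2
  rw [mem_WF] at hv hw
  rw [Perc.mem_B] at h1 h2
  have hm' : (1:ℝ) ≤ m := by exact_mod_cast hm
  have k : ∀ s t : ℝ, s + δ ≤ t → lam * s + 3 * m ≤ lam * t := by
    intro s t h; nlinarith
  have x1 : v.1 - w.1 ≤ 2 * m := by omega
  have x2 : w.1 - v.1 ≤ 2 * m := by omega
  have x3 : v.2 - w.2 ≤ 2 * m := by omega
  have x4 : w.2 - v.2 ≤ 2 * m := by omega
  have y1 : (v.1:ℝ) - w.1 ≤ 2 * m := by exact_mod_cast x1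
  have y2 : (w.1:ℝ) - v.1 ≤ 2 * m := by exact_mod_cast x2
  have y3 : (v.2:ℝ) - w.2 ≤ 2 * m := by exact_mod_cast x3
  have y4 : (w.2:ℝ) - v.2 ≤ 2 * m := by exact_mod_cast x4
  rcases h with h | h | h | h <;> have := k _ _ h <;> linarith [hv.1.1, hv.1.2, hv.2.1, hv.2.2, hw.1.1, hw.1.2, hw.2.1, hw.2.2]

end PercM

namespace DaC

/-- **Asymptotic independence (Lemma 2.7).** For `p < 1/2` and disjoint
rectangles `R₁, R₂`, and every `ε > 0`, there is `λ₀ > 0` such that for all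
`λ > λ₀` any two events defined in terms of the colours of the vertices in
`λR₁ ∩ ℤ²` and `λR₂ ∩ ℤ²` respectively are `ε`-nearly independent. -/
theorem asymptotic_independence (p r : ℝ) (hp0 : 0 ≤ p) (hp : p < 1 / 2)
    (hr0 : 0 ≤ r) (hr1 : r ≤ 1)
    (a b c d a' b' c' d' : ℝ) (hab : a < b) (hcd : c < d)
    (hab' : a' < b') (hcd' : c' < d')
    (R1 R2 : Set (ℝ × ℝ))
    (hR1 : R1 = Set.Icc a b ×ˢ Set.Icc c d)
    (hR2 : R2 = Set.Icc a' b' ×ˢ Set.Icc c' d')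
    (hdisj : Disjoint R1 R2) (ε : ℝ) (hε : 0 < ε) :
    ∃ lam0 : ℝ, 0 < lam0 ∧ ∀ lam : ℝ, lam0 < lam →
      ∀ A1 A2 : Set Config,
        DependsOnColoursIn A1
          {w : V | ((w.1 : ℝ), (w.2 : ℝ)) ∈ (fun x : ℝ × ℝ => (lam * x.1, lam * x.2)) '' R1} →
        DependsOnColoursIn A2
          {w : V | ((w.1 : ℝ), (w.2 : ℝ)) ∈ (fun x : ℝ × ℝ => (lam * x.1, lam * x.2)) '' R2} →
        |(DaCMeasure SqAdj p r (A1 ∩ A2)).toReal -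
            (DaCMeasure SqAdj p r A1).toReal * (DaCMeasure SqAdj p r A2).toReal| ≤ ε := by
  subst hR1 hR2
  obtain ⟨δ, hδ, hgap⟩ := PercM.gap hab hcd hab' hcd' hdisj
  have h1 : p ≤ 1 := by linarith
  set K : ℝ := (3 * (b - a) / δ + 1) * (3 * (d - c) / δ + 1)
    + (3 * (b' - a') / δ + 1) * (3 * (d' - c') / δ + 1) with hK
  have ht := ((PercM.th_tendsto hp0 hp).const_mul (3 * K))
  rw [mul_zero] at ht
  have hev := ht.eventually (ge_mem_nhds hε)
  rw [Filter.eventually_atTop] at hev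
  obtain ⟨n0, hn0⟩ := hev
  refine ⟨3 * ((n0:ℝ) + 1) / δ, by positivity, fun lam hlam A1 A2 hA1 hA2 => ?_⟩
  have hlam0 : 0 < lam := lt_trans (by positivity) hlam
  rw [PercM.scaled_eq hlam0] at hA1 hA2
  rw [div_lt_iff₀ hδ] at hlam
  set m : ℕ := ⌊lam * δ / 3⌋₊ with hm
  have hm1 : (m:ℝ) ≤ lam * δ / 3 := Nat.floor_le (by positivity)
  have hm2 : lam * δ / 3 < m + 1 := Nat.lt_floor_add_one _
  have hm3 : n0 + 1 ≤ m := Nat.le_floor (by push_cast; linarith)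
  have key := PercM.finite_indep (r := r) hp0 h1 (m := (m:ℤ)) (by positivity) _ _
    (PercM.nbh_disj (m := m) (by omega) hlam0 (by linarith) hgap) hA1 hA2
  refine key.trans (le_trans ?_ (hn0 m (by omega)))
  have c1 := PercM.card_WF_le (lam := lam) (M := m) hab hcd hδ (by positivity) (by linarith)
  have c2 := PercM.card_WF_le (lam := lam) (M := m) hab' hcd' hδ (by positivity) (by linarith)
  have hth : 0 ≤ Perc.th p m := Perc.Pr_nonneg hp0 h1 _ _
  calc _ ≤ 3 * ((K * ((m:ℝ) + 1) ^ 2) * Perc.th p m) := by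
        gcongr
        rw [hK, add_mul]
        linarith
    _ = _ := by ring

end DaC
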